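/- arXiv:2303.09069 — 6 statements merged into one kernel-verified Lean document; each statement's English description precedes it below -/
import Mathlib

section
/- Theorem (A₂ Bailey chain). For all nonnegative integers n, m, Σ_{r=0}^n Σ_{s=0}^m 𝒦_{n,m;r,s}(z,w;q) Φ_{r,s}(z,w;q) = Φ_{n,m}(z,w;q), as an identity of rational functions in z, w, q over ℚ. -/
noncomputable section

namespace Stmt11

/-- The field `ℚ(z, w, q)` of rational functions in three variables over `ℚ`. -/
abbrev F : Type := FractionRing (MvPolynomial (Fin 3) ℚ)

/-- The variable `z`. -/
def z : F := algebraMap (MvPolynomial (Fin 3) ℚ) F (MvPolynomial.X 0)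

/-- The variable `w`. -/
def w : F := algebraMap (MvPolynomial (Fin 3) ℚ) F (MvPolynomial.X 1)

/-- The variable `q`. -/
def q : F := algebraMap (MvPolynomial (Fin 3) ℚ) F (MvPolynomial.X 2)

/-- `(a; b)_n`, the finite q-Pochhammer symbol. -/
def qPoch (a b : F) (n : ℕ) : F := ∏ j ∈ Finset.range n, (1 - a * b ^ j)

/-- `Φ_{n,m}(z,w;q) = (zwq;q)_{n+m}/((q,zq,zwq;q)_n (q,wq,zwq;q)_m)`. -/
def Phi (n m : ℕ) (zz ww qq : F) : F :=
  qPoch (zz * ww * qq) qq (n + m) /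
    ((qPoch qq qq n * qPoch (zz * qq) qq n * qPoch (zz * ww * qq) qq n) *
      (qPoch qq qq m * qPoch (ww * qq) qq m * qPoch (zz * ww * qq) qq m))

/-- `𝒦_{n,m;r,s}(z,w;q) = z^r w^s q^{r²-rs+s²}/((q;q)_{n-r}(q;q)_{m-s})`. -/
def Kker (n m r s : ℕ) (zz ww qq : F) : F :=
  zz ^ r * ww ^ s * qq ^ (r ^ 2 + s ^ 2 - r * s) /
    (qPoch qq qq (n - r) * qPoch qq qq (m - s))

section GeneralField

variable {K : Type*} [Field K]

/-- The finite q-Pochhammer symbol `(a; b)_n` over an arbitrary field. -/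
def qPochhammer (a b : K) (n : ℕ) : K := ∏ j ∈ Finset.range n, (1 - a * b ^ j)

@[simp]
lemma qPochhammer_zero (a b : K) : qPochhammer a b 0 = 1 := by
  simp [qPochhammer]

@[simp]
lemma qPochhammer_zero_left (b : K) (n : ℕ) : qPochhammer 0 b n = 1 := by
  simp [qPochhammer]

lemma qPochhammer_succ (a b : K) (n : ℕ) :
    qPochhammer a b (n + 1) = qPochhammer a b n * (1 - a * b ^ n) :=
  Finset.prod_range_succ _ _

lemma qPochhammer_add (a b : K) (n m : ℕ) :
    qPochhammer a b (n + m) = qPochhammer a b n * qPochhammer (a * b ^ n) b m := by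
  simp only [qPochhammer, Finset.prod_range_add, pow_add, mul_assoc]

lemma qPochhammer_succ' (a b : K) (n : ℕ) :
    qPochhammer a b (n + 1) = (1 - a) * qPochhammer (a * b) b n := by
  rw [add_comm, qPochhammer_add, pow_one, qPochhammer_succ]
  simp

lemma qPochhammer_ne_zero {a b : K} (h : ∀ j, a * b ^ j ≠ 1) (n : ℕ) :
    qPochhammer a b n ≠ 0 :=
  Finset.prod_ne_zero_iff.mpr fun j _ => sub_ne_zero.mpr (h j).symm

lemma mul_self_mul_pow_ne_one {a b : K} (h : ∀ j, a * b * b ^ j ≠ 1) (k j : ℕ) :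
    a * b ^ k * b * b ^ j ≠ 1 := by
  have := h (k + j)
  rwa [show a * b ^ k * b * b ^ j = a * b * b ^ (k + j) by ring]

/-- The Gaussian binomial coefficient with base `b`. -/
def qBinom (b : K) (n k : ℕ) : K :=
  if k ≤ n then qPochhammer b b n / (qPochhammer b b k * qPochhammer b b (n - k)) else 0

lemma qBinom_of_lt (b : K) {n k : ℕ} (h : n < k) : qBinom b n k = 0 :=
  if_neg h.not_ge

lemma qBinom_add (b : K) (k d : ℕ) :
    qBinom b (k + d) k =
      qPochhammer b b (k + d) / (qPochhammer b b k * qPochhammer b b d) := by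
  simp [qBinom]

lemma qBinom_zero_right {b : K} (hb : ∀ j, b * b ^ j ≠ 1) (n : ℕ) : qBinom b n 0 = 1 := by
  simp [qBinom, qPochhammer_ne_zero hb]

lemma qBinom_self {b : K} (hb : ∀ j, b * b ^ j ≠ 1) (n : ℕ) : qBinom b n n = 1 := by
  simp [qBinom, qPochhammer_ne_zero hb]

lemma qBinom_succ_succ {b : K} (hb : ∀ j, b * b ^ j ≠ 1) (n k : ℕ) :
    qBinom b (n + 1) (k + 1) = b ^ (k + 1) * qBinom b n (k + 1) + qBinom b n k := by
  rcases lt_trichotomy k n with h | rfl | h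
  · obtain ⟨d, rfl⟩ := Nat.exists_eq_add_of_lt h
    rw [show k + d + 1 + 1 = (k + 1) + (d + 1) by ring, qBinom_add,
      show k + d + 1 = (k + 1) + d by ring, qBinom_add,
      show k + 1 + d = k + (d + 1) by ring, qBinom_add,
      show k + 1 + (d + 1) = k + (d + 1) + 1 by ring]
    have hk := qPochhammer_ne_zero hb k
    have hd := qPochhammer_ne_zero hb d
    have hk' := sub_ne_zero.mpr (hb k).symm
    have hd' := sub_ne_zero.mpr (hb d).symm
    simp only [qPochhammer_succ b b k, qPochhammer_succ b b d,
      qPochhammer_succ b b (k + (d + 1))]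
    field_simp
    ring
  · rw [qBinom_self hb, qBinom_self hb, qBinom_of_lt b k.lt_succ_self]
    simp
  · rw [qBinom_of_lt b h, qBinom_of_lt b (by omega), qBinom_of_lt b (by omega)]
    simp

lemma qBinom_succ_succ' {b : K} (hb : ∀ j, b * b ^ j ≠ 1) {n k : ℕ} (hkn : k ≤ n) :
    qBinom b (n + 1) (k + 1) = qBinom b n (k + 1) + b ^ (n - k) * qBinom b n k := by
  rcases hkn.lt_or_eq with h | rfl
  · obtain ⟨d, rfl⟩ := Nat.exists_eq_add_of_lt h
    rw [show k + d + 1 - k = d + 1 by omega,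
      show k + d + 1 + 1 = (k + 1) + (d + 1) by ring, qBinom_add,
      show k + d + 1 = (k + 1) + d by ring, qBinom_add,
      show k + 1 + d = k + (d + 1) by ring, qBinom_add,
      show k + 1 + (d + 1) = k + (d + 1) + 1 by ring]
    have hk := qPochhammer_ne_zero hb k
    have hd := qPochhammer_ne_zero hb d
    have hk' := sub_ne_zero.mpr (hb k).symm
    have hd' := sub_ne_zero.mpr (hb d).symm
    simp only [qPochhammer_succ b b k, qPochhammer_succ b b d,
      qPochhammer_succ b b (k + (d + 1))]
    field_simp
    ring
  · rw [qBinom_self hb, qBinom_self hb, qBinom_of_lt b k.lt_succ_self]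
    simp

lemma qBinom_mul_qBinom {b : K} (hb : ∀ j, b * b ^ j ≠ 1) {d j : ℕ} (h : j ≤ d) (k : ℕ) :
    qBinom b (k + d) (k + j) * qBinom b (k + j) k = qBinom b (k + d) k * qBinom b d j := by
  obtain ⟨e, rfl⟩ := Nat.exists_eq_add_of_le h
  rw [← add_assoc, qBinom_add, qBinom_add, add_assoc k j e, qBinom_add, qBinom_add]
  have := qPochhammer_ne_zero hb
  have h1 := this k
  have h2 := this j
  have h3 := this e
  have h4 := this (k + j)
  have h5 := this (j + e)
  field_simp

lemma inv_qPochhammer_sub {b : K} (hb : ∀ j, b * b ^ j ≠ 1) {n k : ℕ} (h : k ≤ n) :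
    (qPochhammer b b (n - k))⁻¹ = qBinom b n k * qPochhammer b b k / qPochhammer b b n := by
  have := qPochhammer_ne_zero hb
  have h1 := this k
  have h2 := this n
  have h3 := this (n - k)
  rw [qBinom, if_pos h]
  field_simp

lemma qPochhammer_pow_inv {b : K} (hb0 : b ≠ 0) (hb : ∀ j, b * b ^ j ≠ 1) (r k : ℕ) :
    qPochhammer (b ^ r) b⁻¹ k = qBinom b r k * qPochhammer b b k := by
  rcases le_or_gt k r with h | h
  · induction k with
    | zero => simp [qBinom_zero_right hb]
    | succ k ih =>
      obtain ⟨d, rfl⟩ := Nat.exists_eq_add_of_le h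
      rw [qPochhammer_succ, ih (by omega), qBinom_add, show k + 1 + d = k + (d + 1) by ring,
        qBinom_add, qPochhammer_succ b b k, qPochhammer_succ b b d]
      have hk := qPochhammer_ne_zero hb k
      have hd := qPochhammer_ne_zero hb d
      have hk' := sub_ne_zero.mpr (hb k).symm
      have hd' := sub_ne_zero.mpr (hb d).symm
      have : b ^ (k + (d + 1)) * b⁻¹ ^ k = b * b ^ d := by
        rw [inv_pow]; field_simp; ring
      rw [this]
      field_simp
  · rw [qBinom_of_lt b h, zero_mul]
    refine Finset.prod_eq_zero (Finset.mem_range.mpr h) ?_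
    rw [inv_pow, mul_inv_cancel₀ (pow_ne_zero _ hb0), sub_self]

lemma sum_range_succ_of_pascal {M : Type*} [AddCommMonoid M] {f g h : ℕ → M} {n : ℕ}
    (h0 : f 0 = g 0) (hn : g (n + 1) = 0) (hs : ∀ k ≤ n, f (k + 1) = g (k + 1) + h k) :
    ∑ k ∈ Finset.range (n + 1 + 1), f k =
      ∑ k ∈ Finset.range (n + 1), g k + ∑ k ∈ Finset.range (n + 1), h k := by
  rw [Finset.sum_range_succ', h0, Finset.sum_congr rfl
    fun k hk => hs k (Finset.mem_range_succ_iff.mp hk), Finset.sum_add_distrib,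
    add_right_comm, ← Finset.sum_range_succ', Finset.sum_range_succ g (n + 1), hn, add_zero]

/-- A form of the q-Chu–Vandermonde sum. -/
lemma qChuVandermonde {b : K} (hb0 : b ≠ 0) (hb : ∀ j, b * b ^ j ≠ 1) (n : ℕ) :
    ∀ {a : K} (x : K), (∀ j, a * b * b ^ j ≠ 1) →
      ∑ k ∈ Finset.range (n + 1),
        a ^ k * b ^ k ^ 2 * qBinom b n k * qPochhammer x b⁻¹ k / qPochhammer (a * b) b k =
      qPochhammer (a * x * b) b n / qPochhammer (a * b) b n := by
  induction n with
  | zero => intro a x _; simp [qBinom_zero_right hb]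
  | succ n ih =>
    intro a x ha
    have ha' : ∀ j, a * b * b * b ^ j ≠ 1 := by
      simpa using mul_self_mul_pow_ne_one ha 1
    have h1 : 1 - a * b ≠ 0 := sub_ne_zero.mpr (by simpa using (ha 0).symm)
    rw [sum_range_succ_of_pascal
      (g := fun k => a ^ k * b ^ k ^ 2 * qBinom b n k * qPochhammer x b⁻¹ k /
        qPochhammer (a * b) b k)
      (h := fun k => a * b ^ (n + 1) * (1 - x) / (1 - a * b) *
        ((a * b) ^ k * b ^ k ^ 2 * qBinom b n k * qPochhammer (x * b⁻¹) b⁻¹ k /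
          qPochhammer (a * b * b) b k))]
    · rw [← Finset.mul_sum, ih x ha, ih (x * b⁻¹) ha',
        show a * b * (x * b⁻¹) * b = a * x * b by field_simp,
        qPochhammer_succ (a * x * b)]
      have h2 := qPochhammer_ne_zero ha n
      have h3 := qPochhammer_ne_zero ha' n
      have h4 := sub_ne_zero.mpr (ha n).symm
      have e := (qPochhammer_succ (a * b) b n).symm.trans (qPochhammer_succ' (a * b) b n)
      rw [div_mul_div_comm, ← e, qPochhammer_succ (a * b)]
      field_simp
      ring
    · simp [qBinom_zero_right hb]
    · simp [qBinom_of_lt]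
    · intro k hk
      have h3 := qPochhammer_ne_zero ha' k
      obtain ⟨d, rfl⟩ := Nat.exists_eq_add_of_le hk
      rw [qBinom_succ_succ' hb hk, qPochhammer_succ' x, qPochhammer_succ' (a * b)]
      simp only [add_tsub_cancel_left]
      field_simp
      ring

/-- The reversed form of the q-Chu–Vandermonde sum. -/
lemma qChuVandermonde_reversed {b : K} (hb0 : b ≠ 0) (hb : ∀ j, b * b ^ j ≠ 1) (n : ℕ) :
    ∀ {a x : K}, x ≠ 0 → (∀ j, a * b * b ^ j ≠ 1) →
      ∑ k ∈ Finset.range (n + 1),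
        b ^ k ^ 2 / (b ^ (n * k) * x ^ k) * qBinom b n k * qPochhammer x b⁻¹ k /
          qPochhammer (a * b) b k =
      qPochhammer (a * x * b) b n / (x ^ n * qPochhammer (a * b) b n) := by
  induction n with
  | zero => intro a x _ _; simp [qBinom_zero_right hb]
  | succ n ih =>
    intro a x hx ha
    have ha' : ∀ j, a * b * b * b ^ j ≠ 1 := by
      simpa using mul_self_mul_pow_ne_one ha 1
    have h1 : 1 - a * b ≠ 0 := sub_ne_zero.mpr (by simpa using (ha 0).symm)
    rw [sum_range_succ_of_pascal
      (g := fun k => b ^ k ^ 2 / (b ^ (n * k) * x ^ k) * qBinom b n k * qPochhammer x b⁻¹ k /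
        qPochhammer (a * b) b k)
      (h := fun k => (1 - x) / (b ^ n * x * (1 - a * b)) *
        (b ^ k ^ 2 / (b ^ (n * k) * (x * b⁻¹) ^ k) * qBinom b n k *
          qPochhammer (x * b⁻¹) b⁻¹ k / qPochhammer (a * b * b) b k))]
    · rw [← Finset.mul_sum, ih hx ha, ih (mul_ne_zero hx (inv_ne_zero hb0)) ha',
        show a * b * (x * b⁻¹) * b = a * x * b by field_simp,
        qPochhammer_succ (a * x * b)]
      have h2 := qPochhammer_ne_zero ha n
      have h3 := qPochhammer_ne_zero ha' n
      have h4 := sub_ne_zero.mpr (ha n).symm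
      have e := (qPochhammer_succ (a * b) b n).symm.trans (qPochhammer_succ' (a * b) b n)
      rw [div_mul_div_comm, show b ^ n * x * (1 - a * b) *
        ((x * b⁻¹) ^ n * qPochhammer (a * b * b) b n) =
          x ^ (n + 1) * (qPochhammer (a * b) b n * (1 - a * b * b ^ n)) by
            rw [e, mul_pow, inv_pow]; field_simp; ring, qPochhammer_succ (a * b)]
      field_simp
      ring
    · simp [qBinom_zero_right hb]
    · simp [qBinom_of_lt]
    · intro k hk
      have h3 := qPochhammer_ne_zero ha' k
      rw [qBinom_succ_succ hb, qPochhammer_succ' x, qPochhammer_succ' (a * b), mul_pow, inv_pow]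
      field_simp
      ring

lemma sum_qBinom_mul_qBinom {b : K} (hb0 : b ≠ 0) (hb : ∀ j, b * b ^ j ≠ 1) {a : K}
    (ha : ∀ j, a * b * b ^ j ≠ 1) (n k : ℕ) :
    ∑ r ∈ Finset.range (n + 1),
      a ^ r * b ^ r ^ 2 / b ^ (r * k) * qBinom b n r * qBinom b r k / qPochhammer (a * b) b r =
    a ^ k * qBinom b n k / qPochhammer (a * b) b n := by
  rcases le_or_gt k n with h | h
  · obtain ⟨d, rfl⟩ := Nat.exists_eq_add_of_le h
    have ha' := mul_self_mul_pow_ne_one ha k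
    have key := qChuVandermonde hb0 hb d 0 ha'
    have e : a * b * b ^ k = a * b ^ k * b := by ring
    have hp := qPochhammer_ne_zero ha k
    rw [add_assoc, Finset.sum_range_add, Finset.sum_eq_zero, zero_add, qPochhammer_add, e,
      show a ^ k * qBinom b (k + d) k / (qPochhammer (a * b) b k * qPochhammer (a * b ^ k * b) b d)
        = a ^ k * qBinom b (k + d) k / qPochhammer (a * b) b k *
          (qPochhammer (a * b ^ k * 0 * b) b d / qPochhammer (a * b ^ k * b) b d) by
        rw [mul_zero, zero_mul, qPochhammer_zero_left, div_mul_div_comm, mul_one], ← key, Finset.mul_sum]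
    · refine Finset.sum_congr rfl fun j hj => ?_
      have hp' := qPochhammer_ne_zero ha' j
      rw [mul_assoc (_ / _), qBinom_mul_qBinom hb (Finset.mem_range_succ_iff.mp hj),
        qPochhammer_add, e, qPochhammer_zero_left]
      field_simp
      ring
    · intro r hr
      rw [qBinom_of_lt b (Finset.mem_range.mp hr)]
      simp
  · rw [qBinom_of_lt b h, mul_zero, zero_div]
    refine Finset.sum_eq_zero fun r hr => ?_
    rw [qBinom_of_lt b (by have := Finset.mem_range.mp hr; omega : r < k)]
    simp

lemma qPochhammer_add_div {b : K} {a : K} (ha : ∀ j, a * b * b ^ j ≠ 1) (n m : ℕ) :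
    qPochhammer (a * b ^ n * b) b m / qPochhammer (a * b) b m =
      qPochhammer (a * b) b (n + m) / (qPochhammer (a * b) b n * qPochhammer (a * b) b m) := by
  have h1 := qPochhammer_ne_zero ha n
  rw [qPochhammer_add, mul_right_comm a, mul_div_mul_left _ _ h1]

lemma sum_qBinom_eq_qPochhammer_add {b : K} (hb0 : b ≠ 0) (hb : ∀ j, b * b ^ j ≠ 1) {a : K}
    (ha : ∀ j, a * b * b ^ j ≠ 1) (n m : ℕ) :
    ∑ k ∈ Finset.range (m + 1),
      a ^ k * b ^ k ^ 2 * qBinom b m k * qBinom b n k * qPochhammer b b k /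
        qPochhammer (a * b) b k =
    qPochhammer (a * b) b (n + m) / (qPochhammer (a * b) b n * qPochhammer (a * b) b m) := by
  rw [← qPochhammer_add_div ha, ← qChuVandermonde hb0 hb m _ ha]
  refine Finset.sum_congr rfl fun k _ => ?_
  rw [qPochhammer_pow_inv hb0 hb]
  ring

lemma qPochhammer_add_eq_sum_qBinom {b : K} (hb0 : b ≠ 0) (hb : ∀ j, b * b ^ j ≠ 1) {a : K}
    (ha : ∀ j, a * b * b ^ j ≠ 1) (r : ℕ) {s m : ℕ} (hs : s ≤ m) :
    qPochhammer (a * b) b (r + s) /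
      (b ^ (r * s) * (qPochhammer (a * b) b r * qPochhammer (a * b) b s)) =
    ∑ k ∈ Finset.range (m + 1),
      b ^ k ^ 2 / (b ^ (r * k) * b ^ (s * k)) * qBinom b r k * qBinom b s k *
        qPochhammer b b k / qPochhammer (a * b) b k := by
  rw [← Finset.sum_subset (Finset.range_mono (Nat.succ_le_succ hs)), mul_comm (b ^ (r * s)),
    ← div_div, ← qPochhammer_add_div ha, div_div, mul_comm _ (b ^ (r * s)), pow_mul,
    ← qChuVandermonde_reversed hb0 hb s (pow_ne_zero r hb0) ha]
  · refine Finset.sum_congr rfl fun k _ => ?_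
    rw [qPochhammer_pow_inv hb0 hb, pow_mul]
    ring
  · intro k _ hk
    rw [qBinom_of_lt b (by simpa using hk : s < k)]
    simp

/-- The `A₂` Bailey chain over a field in which no denominator vanishes. -/
theorem qPochhammer_A2_bailey_chain {z w b : K} (hb0 : b ≠ 0) (hb : ∀ j, b * b ^ j ≠ 1)
    (hz : ∀ j, z * b * b ^ j ≠ 1) (hw : ∀ j, w * b * b ^ j ≠ 1)
    (hzw : ∀ j, z * w * b * b ^ j ≠ 1) (n m : ℕ) :
    ∑ r ∈ Finset.range (n + 1), ∑ s ∈ Finset.range (m + 1),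
      z ^ r * w ^ s * b ^ (r ^ 2 + s ^ 2 - r * s) /
          (qPochhammer b b (n - r) * qPochhammer b b (m - s)) *
        (qPochhammer (z * w * b) b (r + s) /
          ((qPochhammer b b r * qPochhammer (z * b) b r * qPochhammer (z * w * b) b r) *
            (qPochhammer b b s * qPochhammer (w * b) b s * qPochhammer (z * w * b) b s))) =
      qPochhammer (z * w * b) b (n + m) /
        ((qPochhammer b b n * qPochhammer (z * b) b n * qPochhammer (z * w * b) b n) *
          (qPochhammer b b m * qPochhammer (w * b) b m * qPochhammer (z * w * b) b m)) := by
  have pb := qPochhammer_ne_zero hb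
  have expand : ∀ r ∈ Finset.range (n + 1), ∀ s ∈ Finset.range (m + 1),
      z ^ r * w ^ s * b ^ (r ^ 2 + s ^ 2 - r * s) /
          (qPochhammer b b (n - r) * qPochhammer b b (m - s)) *
        (qPochhammer (z * w * b) b (r + s) /
          ((qPochhammer b b r * qPochhammer (z * b) b r * qPochhammer (z * w * b) b r) *
            (qPochhammer b b s * qPochhammer (w * b) b s * qPochhammer (z * w * b) b s))) =
      ∑ k ∈ Finset.range (m + 1),
        (qPochhammer b b n * qPochhammer b b m)⁻¹ *
          (b ^ k ^ 2 * qPochhammer b b k / qPochhammer (z * w * b) b k) *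
          ((z ^ r * b ^ r ^ 2 / b ^ (r * k) * qBinom b n r * qBinom b r k /
              qPochhammer (z * b) b r) *
            (w ^ s * b ^ s ^ 2 / b ^ (s * k) * qBinom b m s * qBinom b s k /
              qPochhammer (w * b) b s)) := by
    intro r hr s hs
    rw [Finset.mem_range_succ_iff] at hr hs
    have hrs : r * s ≤ r ^ 2 + s ^ 2 := by nlinarith [sq_nonneg ((r : ℤ) - s)]
    trans (qPochhammer b b n * qPochhammer b b m)⁻¹ *
      (z ^ r * b ^ r ^ 2 * qBinom b n r / qPochhammer (z * b) b r) *
      (w ^ s * b ^ s ^ 2 * qBinom b m s / qPochhammer (w * b) b s) *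
      (qPochhammer (z * w * b) b (r + s) /
        (b ^ (r * s) * (qPochhammer (z * w * b) b r * qPochhammer (z * w * b) b s)))
    · rw [pow_sub₀ b hb0 hrs, pow_add, div_eq_mul_inv _ (_ * qPochhammer b b (m - s)), mul_inv,
        inv_qPochhammer_sub hb hr, inv_qPochhammer_sub hb hs]
      have h1 := pb r
      have h2 := pb s
      have h3 := pb n
      have h4 := pb m
      have h5 := qPochhammer_ne_zero hz r
      have h6 := qPochhammer_ne_zero hw s
      have h7 := qPochhammer_ne_zero hzw r
      have h8 := qPochhammer_ne_zero hzw s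
      field_simp
    · rw [qPochhammer_add_eq_sum_qBinom hb0 hb hzw r hs, Finset.mul_sum]
      refine Finset.sum_congr rfl fun k _ => ?_
      ring
  rw [Finset.sum_congr rfl fun r hr => Finset.sum_congr rfl (expand r hr)]
  rw [Finset.sum_congr rfl fun _ _ => Finset.sum_comm, Finset.sum_comm]
  simp_rw [← Finset.mul_sum, ← Finset.sum_mul, sum_qBinom_mul_qBinom hb0 hb hz,
    sum_qBinom_mul_qBinom hb0 hb hw]
  trans (qPochhammer b b n * qPochhammer b b m *
      (qPochhammer (z * b) b n * qPochhammer (w * b) b m))⁻¹ *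
    (qPochhammer (z * w * b) b (n + m) /
      (qPochhammer (z * w * b) b n * qPochhammer (z * w * b) b m))
  · rw [← sum_qBinom_eq_qPochhammer_add hb0 hb hzw, Finset.mul_sum]
    refine Finset.sum_congr rfl fun k _ => ?_
    rw [mul_pow]
    ring
  · ring

end GeneralField

lemma algebraMap_ne_one {p : MvPolynomial (Fin 3) ℚ} (hp : MvPolynomial.eval 0 p = 0) :
    algebraMap (MvPolynomial (Fin 3) ℚ) F p ≠ 1 := by
  intro h
  rw [← map_one (algebraMap (MvPolynomial (Fin 3) ℚ) F)] at h
  rw [IsFractionRing.injective _ F h] at hp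
  simp at hp

lemma q_ne_zero : q ≠ 0 := by
  rw [q, Ne, map_eq_zero_iff _ (IsFractionRing.injective (MvPolynomial (Fin 3) ℚ) F)]
  exact MvPolynomial.X_ne_zero _

lemma q_mul_pow_ne_one (j : ℕ) : q * q ^ j ≠ 1 := by
  simp only [q, ← map_mul, ← map_pow]
  exact algebraMap_ne_one (by simp)

lemma z_mul_q_mul_pow_ne_one (j : ℕ) : z * q * q ^ j ≠ 1 := by
  simp only [z, q, ← map_mul, ← map_pow]
  exact algebraMap_ne_one (by simp)

lemma w_mul_q_mul_pow_ne_one (j : ℕ) : w * q * q ^ j ≠ 1 := by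
  simp only [w, q, ← map_mul, ← map_pow]
  exact algebraMap_ne_one (by simp)

lemma z_mul_w_mul_q_mul_pow_ne_one (j : ℕ) : z * w * q * q ^ j ≠ 1 := by
  simp only [z, w, q, ← map_mul, ← map_pow]
  exact algebraMap_ne_one (by simp)

/-- The `A₂` Bailey chain (Theorem 4.2 of the paper), as an identity of rational
functions in `z, w, q`. -/
theorem A2_bailey_chain (n m : ℕ) :
    ∑ r ∈ Finset.range (n + 1), ∑ s ∈ Finset.range (m + 1),
      Kker n m r s z w q * Phi r s z w q = Phi n m z w q := by
  exact qPochhammer_A2_bailey_chain q_ne_zero q_mul_pow_ne_one z_mul_q_mul_pow_ne_one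
    w_mul_q_mul_pow_ne_one z_mul_w_mul_q_mul_pow_ne_one n m

end Stmt11
end
end

section
/- Theorem (A₂ Bailey tree, part I). For all nonnegative integers n, m, Σ_{r=0}^n Σ_{s=0}^m 𝒦_{n,m;r,s}(z/q, w; q) Φ_{r,s}(u,v;z,w;q) = Φ_{n,m}(uz, vw; z,w;q), as an identity of rational functions in u, v, z, w, q over ℚ. -/
noncomputable section

namespace Stmt13

/-- The field `ℚ(u, v, z, w, q)` of rational functions in five variables over `ℚ`. -/
abbrev F : Type := FractionRing (MvPolynomial (Fin 5) ℚ)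

/-- The variable `u`. -/
def u : F := algebraMap (MvPolynomial (Fin 5) ℚ) F (MvPolynomial.X 0)

/-- The variable `v`. -/
def v : F := algebraMap (MvPolynomial (Fin 5) ℚ) F (MvPolynomial.X 1)

/-- The variable `z`. -/
def z : F := algebraMap (MvPolynomial (Fin 5) ℚ) F (MvPolynomial.X 2)

/-- The variable `w`. -/
def w : F := algebraMap (MvPolynomial (Fin 5) ℚ) F (MvPolynomial.X 3)

/-- The variable `q`. -/
def q : F := algebraMap (MvPolynomial (Fin 5) ℚ) F (MvPolynomial.X 4)

/-- `(a; b)_n`, the finite q-Pochhammer symbol. -/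
def qPoch (a b : F) (n : ℕ) : F := ∏ j ∈ Finset.range n, (1 - a * b ^ j)

/-- `Φ_{n,m}(z,w;q) = (zwq;q)_{n+m}/((q,zq,zwq;q)_n (q,wq,zwq;q)_m)`. -/
def Phi (n m : ℕ) (zz ww qq : F) : F :=
  qPoch (zz * ww * qq) qq (n + m) /
    ((qPoch qq qq n * qPoch (zz * qq) qq n * qPoch (zz * ww * qq) qq n) *
      (qPoch qq qq m * qPoch (ww * qq) qq m * qPoch (zz * ww * qq) qq m))

/-- `Φ_{n,m}` for integer indices, vanishing when an index is negative
(the convention `1/(q;q)_{-1} = 0`). -/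
def PhiZ (n m : ℤ) (zz ww qq : F) : F :=
  if 0 ≤ n ∧ 0 ≤ m then Phi n.toNat m.toNat zz ww qq else 0

/-- The two-parameter deformation
`Φ_{n,m}(u,v;z,w;q) = Φ_{n,m}(z/q,w;q) - (uz/(z;q)₂)Φ_{n-1,m}(zq,w/q;q)
+ (uvzw²/((w;q)₂(zw;q)₂))Φ_{n-1,m-1}(z,wq;q)`. -/
def PhiUV (n m : ℤ) (uu vv zz ww qq : F) : F :=
  PhiZ n m (zz / qq) ww qq -
    uu * zz / qPoch zz qq 2 * PhiZ (n - 1) m (zz * qq) (ww / qq) qq +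
    uu * vv * zz * ww ^ 2 / (qPoch ww qq 2 * qPoch (zz * ww) qq 2) *
      PhiZ (n - 1) (m - 1) zz (ww * qq) qq

/-- `𝒦_{n,m;r,s}(z,w;q) = z^r w^s q^{r²-rs+s²}/((q;q)_{n-r}(q;q)_{m-s})`. -/
def Kker (n m r s : ℕ) (zz ww qq : F) : F :=
  zz ^ r * ww ^ s * qq ^ (r ^ 2 + s ^ 2 - r * s) /
    (qPoch qq qq (n - r) * qPoch qq qq (m - s))

section General

open Finset

variable {K : Type*} [Field K]

/-- The finite q-Pochhammer symbol `(a; q)_n` over an arbitrary field. -/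
def qPochhammer (a q : K) (n : ℕ) : K := ∏ j ∈ range n, (1 - a * q ^ j)

/-- `1/(q; q)_{n-k}`, vanishing for `n < k`. -/
def invQFactSub (q : K) (n k : ℕ) : K := if k ≤ n then (qPochhammer q q (n - k))⁻¹ else 0

lemma qPochhammer_zero (a q : K) : qPochhammer a q 0 = 1 := by simp [qPochhammer]

lemma qPochhammer_succ (a q : K) (n : ℕ) :
    qPochhammer a q (n + 1) = qPochhammer a q n * (1 - a * q ^ n) := by
  simp [qPochhammer, prod_range_succ]

lemma qPochhammer_succ' (a q : K) (n : ℕ) :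
    qPochhammer a q (n + 1) = (1 - a) * qPochhammer (a * q) q n := by
  simp only [qPochhammer, prod_range_succ']
  rw [mul_comm]
  simp [pow_succ', mul_assoc]

lemma qPochhammer_add (a q : K) (m n : ℕ) :
    qPochhammer a q (m + n) = qPochhammer a q m * qPochhammer (a * q ^ m) q n := by
  simp only [qPochhammer, prod_range_add, pow_add, mul_assoc]

lemma one_sub_ne_zero_of_forall {x q : K} (hx : ∀ i : ℕ, x * q ^ (i + 1) ≠ 1) (i : ℕ) :
    1 - x * q ^ (i + 1) ≠ 0 :=
  sub_ne_zero.mpr (hx i).symm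

lemma qPochhammer_ne_zero {x q : K} (hx : ∀ i : ℕ, x * q ^ (i + 1) ≠ 1) (n : ℕ) :
    qPochhammer (x * q) q n ≠ 0 := by
  refine prod_ne_zero_iff.mpr fun j _ => ?_
  rw [mul_assoc, ← pow_succ']
  exact one_sub_ne_zero_of_forall hx j

lemma qPochhammer_self_ne_zero {q : K} (hq : ∀ i : ℕ, q ^ (i + 1) ≠ 1) (n : ℕ) :
    qPochhammer q q n ≠ 0 := by
  simpa using qPochhammer_ne_zero (x := 1) (q := q) (by simpa using hq) n

lemma invQFactSub_of_le {n k : ℕ} (q : K) (h : k ≤ n) :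
    invQFactSub q n k = (qPochhammer q q (n - k))⁻¹ := if_pos h

lemma invQFactSub_of_lt {n k : ℕ} (q : K) (h : n < k) : invQFactSub q n k = 0 :=
  if_neg (not_le.mpr h)

lemma invQFactSub_succ_succ (q : K) (n k : ℕ) :
    invQFactSub q (n + 1) (k + 1) = invQFactSub q n k := by
  simp [invQFactSub]

lemma invQFactSub_add_add (q : K) (n k j : ℕ) :
    invQFactSub q (j + n) (j + k) = invQFactSub q n k := by
  simp [invQFactSub, Nat.add_sub_add_left]

lemma invQFactSub_succ_mul {q : K} (hq : ∀ i : ℕ, q ^ (i + 1) ≠ 1) {n k : ℕ}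
    (hk : k ≤ n + 1) :
    invQFactSub q (n + 1) k * (1 - q ^ (n + 1 - k)) = invQFactSub q n k := by
  rcases Nat.lt_or_ge n k with h | h
  · obtain rfl : k = n + 1 := by omega
    simp [invQFactSub_of_lt q h]
  · obtain ⟨d, rfl⟩ := Nat.exists_eq_add_of_le h
    have h1 : k + d + 1 - k = d + 1 := by omega
    have h2 : k + d - k = d := by omega
    have h3 := sub_ne_zero.mpr (hq d).symm
    have h4 := qPochhammer_self_ne_zero hq d
    rw [invQFactSub_of_le q hk, invQFactSub_of_le q h, h1, h2, qPochhammer_succ, ← pow_succ']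
    field_simp

lemma one_sub_mul_inv_qPochhammer_succ {q : K} (hq : ∀ i : ℕ, q ^ (i + 1) ≠ 1) (k : ℕ) :
    (1 - q ^ (k + 1)) * (qPochhammer q q (k + 1))⁻¹ = (qPochhammer q q k)⁻¹ := by
  have h3 := sub_ne_zero.mpr (hq k).symm
  have h4 := qPochhammer_self_ne_zero hq k
  rw [qPochhammer_succ, ← pow_succ']
  field_simp

/-- Summation form of the q-Pascal rule
`1 - q^{n+1} = (1 - q^{n+1-k}) + q^{n+1-k} (1 - q^k)`. -/
lemma one_sub_mul_sum_qPascal {q : K} (hq : ∀ i : ℕ, q ^ (i + 1) ≠ 1) (n : ℕ) (f : ℕ → K) :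
    (1 - q ^ (n + 1)) *
        ∑ k ∈ range (n + 2), invQFactSub q (n + 1) k * (qPochhammer q q k)⁻¹ * f k =
      ∑ k ∈ range (n + 1), invQFactSub q n k * (qPochhammer q q k)⁻¹ * f k +
      ∑ k ∈ range (n + 1),
        invQFactSub q n k * (qPochhammer q q k)⁻¹ * (q ^ (n - k) * f (k + 1)) := by
  have key : ∀ k ∈ range (n + 2),
      (1 - q ^ (n + 1)) * (invQFactSub q (n + 1) k * (qPochhammer q q k)⁻¹ * f k) =
        invQFactSub q n k * (qPochhammer q q k)⁻¹ * f k +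
        invQFactSub q (n + 1) k * ((1 - q ^ k) * (qPochhammer q q k)⁻¹) *
          (q ^ (n + 1 - k) * f k) := by
    intro k hk
    have hk' : k ≤ n + 1 := by simpa [Nat.lt_succ_iff] using hk
    have hpow : q ^ (n + 1) = q ^ (n + 1 - k) * q ^ k := by
      rw [← pow_add, Nat.sub_add_cancel hk']
    rw [← invQFactSub_succ_mul hq hk', hpow]
    ring
  rw [mul_sum, sum_congr rfl key, sum_add_distrib, sum_range_succ _ (n + 1),
    invQFactSub_of_lt q n.lt_succ_self, sum_range_succ' _ (n + 1)]
  simp [invQFactSub_succ_succ, one_sub_mul_inv_qPochhammer_succ hq]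

/-- Summation form of the q-Pascal rule
`1 - q^{n+1} = q^k (1 - q^{n+1-k}) + (1 - q^k)`. -/
lemma one_sub_mul_sum_qPascal' {q : K} (hq : ∀ i : ℕ, q ^ (i + 1) ≠ 1) (n : ℕ) (f : ℕ → K) :
    (1 - q ^ (n + 1)) *
        ∑ k ∈ range (n + 2), invQFactSub q (n + 1) k * (qPochhammer q q k)⁻¹ * f k =
      ∑ k ∈ range (n + 1), invQFactSub q n k * (qPochhammer q q k)⁻¹ * (q ^ k * f k) +
      ∑ k ∈ range (n + 1), invQFactSub q n k * (qPochhammer q q k)⁻¹ * f (k + 1) := by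
  have key : ∀ k ∈ range (n + 2),
      (1 - q ^ (n + 1)) * (invQFactSub q (n + 1) k * (qPochhammer q q k)⁻¹ * f k) =
        invQFactSub q n k * (qPochhammer q q k)⁻¹ * (q ^ k * f k) +
        invQFactSub q (n + 1) k * ((1 - q ^ k) * (qPochhammer q q k)⁻¹) * f k := by
    intro k hk
    have hk' : k ≤ n + 1 := by simpa [Nat.lt_succ_iff] using hk
    have hpow : q ^ (n + 1) = q ^ (n + 1 - k) * q ^ k := by
      rw [← pow_add, Nat.sub_add_cancel hk']
    rw [← invQFactSub_succ_mul hq hk', hpow]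
    ring
  rw [mul_sum, sum_congr rfl key, sum_add_distrib, sum_range_succ _ (n + 1),
    invQFactSub_of_lt q n.lt_succ_self, sum_range_succ' _ (n + 1)]
  simp [invQFactSub_succ_succ, one_sub_mul_inv_qPochhammer_succ hq]

lemma forall_mul_self_ne_one {x q : K} (hx : ∀ i : ℕ, x * q ^ (i + 1) ≠ 1) (i : ℕ) :
    x * q * q ^ (i + 1) ≠ 1 := by
  rw [mul_assoc, ← pow_succ']
  exact hx (i + 1)

/-- The `m → ∞` limit of `sum_qVandermonde`. -/
lemma sum_qVandermonde_limit {q : K} (hq : ∀ i : ℕ, q ^ (i + 1) ≠ 1) (n : ℕ) :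
    ∀ x : K, (∀ i : ℕ, x * q ^ (i + 1) ≠ 1) →
    ∑ k ∈ range (n + 1), invQFactSub q n k * (qPochhammer q q k)⁻¹ *
        (x ^ k * q ^ (k ^ 2) * (qPochhammer (x * q) q k)⁻¹) =
      (qPochhammer q q n * qPochhammer (x * q) q n)⁻¹ := by
  induction n with
  | zero => intro x _; simp [invQFactSub, qPochhammer_zero]
  | succ n ih =>
    intro x hx
    have hn := sub_ne_zero.mpr (hq n).symm
    have hx0 : 1 - x * q ≠ 0 := by simpa using one_sub_ne_zero_of_forall hx 0
    have hxn := one_sub_ne_zero_of_forall hx n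
    have hQ := qPochhammer_self_ne_zero hq n
    have hX := qPochhammer_ne_zero hx n
    apply mul_left_cancel₀ hn
    rw [one_sub_mul_sum_qPascal hq, ih x hx]
    have hshift : ∀ k ∈ range (n + 1), invQFactSub q n k * (qPochhammer q q k)⁻¹ *
        (q ^ (n - k) * (x ^ (k + 1) * q ^ ((k + 1) ^ 2) * (qPochhammer (x * q) q (k + 1))⁻¹)) =
        x * q ^ (n + 1) / (1 - x * q) * (invQFactSub q n k * (qPochhammer q q k)⁻¹ *
        ((x * q) ^ k * q ^ (k ^ 2) * (qPochhammer (x * q * q) q k)⁻¹)) := by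
      intro k hk
      have hk' : k ≤ n := by simpa [Nat.lt_succ_iff] using hk
      have hpow : q ^ n = q ^ (n - k) * q ^ k := by rw [← pow_add, Nat.sub_add_cancel hk']
      rw [qPochhammer_succ', pow_succ q n, hpow, mul_inv]
      ring
    rw [sum_congr rfl hshift, ← mul_sum, ih (x * q) (forall_mul_self_ne_one hx)]
    have hrel : (1 - x * q) * qPochhammer (x * q * q) q n =
        qPochhammer (x * q) q n * (1 - x * q ^ (n + 1)) := by
      rw [← qPochhammer_succ', qPochhammer_succ, mul_assoc x, ← pow_succ']
    have hY' : qPochhammer (x * q * q) q n =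
        qPochhammer (x * q) q n * (1 - x * q ^ (n + 1)) / (1 - x * q) := by
      rw [eq_div_iff hx0, ← hrel, mul_comm]
    rw [hY', qPochhammer_succ q, qPochhammer_succ (x * q), mul_assoc x q (q ^ n), ← pow_succ']
    field_simp
    ring

/-- The q-Chu–Vandermonde sum with quadratic exponent `k²`. -/
lemma sum_qVandermonde {q : K} (hq : ∀ i : ℕ, q ^ (i + 1) ≠ 1) (n : ℕ) :
    ∀ (m : ℕ) (x : K), (∀ i : ℕ, x * q ^ (i + 1) ≠ 1) →
    ∑ k ∈ range (n + 1), invQFactSub q n k * (qPochhammer q q k)⁻¹ *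
        (invQFactSub q m k * (x ^ k * q ^ (k ^ 2) * (qPochhammer (x * q) q k)⁻¹)) =
      qPochhammer (x * q) q (n + m) / (qPochhammer q q n * qPochhammer q q m *
        (qPochhammer (x * q) q n * qPochhammer (x * q) q m)) := by
  induction n with
  | zero =>
    intro m x hx
    have hX := qPochhammer_ne_zero hx m
    simp [invQFactSub, qPochhammer_zero]
    field_simp
  | succ n ih =>
    intro m x hx
    have hn := sub_ne_zero.mpr (hq n).symm
    have hx0 : 1 - x * q ≠ 0 := by simpa using one_sub_ne_zero_of_forall hx 0
    have hxn := one_sub_ne_zero_of_forall hx n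
    have hQ := qPochhammer_self_ne_zero hq n
    have hX := qPochhammer_ne_zero hx n
    apply mul_left_cancel₀ hn
    rw [one_sub_mul_sum_qPascal hq, ih m x hx]
    cases m with
    | zero =>
      simp [invQFactSub_of_lt, qPochhammer_zero, qPochhammer_succ q]
      rw [← pow_succ']
      have hX' := qPochhammer_ne_zero hx (n + 1)
      field_simp
    | succ m =>
      have hm := sub_ne_zero.mpr (hq m).symm
      have hxm := one_sub_ne_zero_of_forall hx m
      have hR := qPochhammer_self_ne_zero hq m
      have hZ := qPochhammer_ne_zero hx m
      have hshift : ∀ k ∈ range (n + 1), invQFactSub q n k * (qPochhammer q q k)⁻¹ *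
          (q ^ (n - k) * (invQFactSub q (m + 1) (k + 1) *
            (x ^ (k + 1) * q ^ ((k + 1) ^ 2) * (qPochhammer (x * q) q (k + 1))⁻¹))) =
          x * q ^ (n + 1) / (1 - x * q) * (invQFactSub q n k * (qPochhammer q q k)⁻¹ *
          (invQFactSub q m k *
            ((x * q) ^ k * q ^ (k ^ 2) * (qPochhammer (x * q * q) q k)⁻¹))) := by
        intro k hk
        have hk' : k ≤ n := by simpa [Nat.lt_succ_iff] using hk
        have hpow : q ^ n = q ^ (n - k) * q ^ k := by rw [← pow_add, Nat.sub_add_cancel hk']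
        rw [qPochhammer_succ', pow_succ q n, hpow, mul_inv, invQFactSub_succ_succ]
        ring
      rw [sum_congr rfl hshift, ← mul_sum, ih m (x * q) (forall_mul_self_ne_one hx)]
      have hY' : ∀ j, qPochhammer (x * q * q) q j =
          qPochhammer (x * q) q (j + 1) / (1 - x * q) := by
        intro j
        rw [eq_div_iff hx0, qPochhammer_succ', mul_comm]
      rw [hY', hY', hY', show n + 1 + (m + 1) = n + (m + 1) + 1 by ring,
        show n + (m + 1) = n + m + 1 by ring, qPochhammer_succ (x * q) q (n + m + 1),
        qPochhammer_succ (x * q) q n, qPochhammer_succ (x * q) q m,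
        qPochhammer_succ q q n, qPochhammer_succ q q m]
      simp only [mul_assoc x q, ← pow_succ']
      field_simp
      ring

/-- The q-Chu–Vandermonde sum with quadratic exponent `(n - k)(m - k)`. -/
lemma sum_qVandermonde' {q : K} (hq : ∀ i : ℕ, q ^ (i + 1) ≠ 1) (n : ℕ) :
    ∀ (m : ℕ) (x : K), (∀ i : ℕ, x * q ^ (i + 1) ≠ 1) →
    ∑ k ∈ range (n + 1), invQFactSub q n k * (qPochhammer q q k)⁻¹ *
        (invQFactSub q m k * (q ^ ((n - k) * (m - k)) * (qPochhammer (x * q) q k)⁻¹)) =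
      qPochhammer (x * q) q (n + m) / (qPochhammer q q n * qPochhammer q q m *
        (qPochhammer (x * q) q n * qPochhammer (x * q) q m)) := by
  induction n with
  | zero =>
    intro m x hx
    have hX := qPochhammer_ne_zero hx m
    simp [invQFactSub, qPochhammer_zero]
    field_simp
  | succ n ih =>
    intro m x hx
    have hn := sub_ne_zero.mpr (hq n).symm
    have hx0 : 1 - x * q ≠ 0 := by simpa using one_sub_ne_zero_of_forall hx 0
    have hxn := one_sub_ne_zero_of_forall hx n
    have hQ := qPochhammer_self_ne_zero hq n
    have hX := qPochhammer_ne_zero hx n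
    apply mul_left_cancel₀ hn
    rw [one_sub_mul_sum_qPascal' hq]
    have hfirst : ∀ k ∈ range (n + 1), invQFactSub q n k * (qPochhammer q q k)⁻¹ *
        (q ^ k * (invQFactSub q m k *
          (q ^ ((n + 1 - k) * (m - k)) * (qPochhammer (x * q) q k)⁻¹))) =
        q ^ m * (invQFactSub q n k * (qPochhammer q q k)⁻¹ *
        (invQFactSub q m k *
          (q ^ ((n - k) * (m - k)) * (qPochhammer (x * q) q k)⁻¹))) := by
      intro k hk
      have hk' : k ≤ n := by simpa [Nat.lt_succ_iff] using hk
      rcases Nat.lt_or_ge m k with h | h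
      · simp [invQFactSub_of_lt q h]
      · have hpow : q ^ m = q ^ (m - k) * q ^ k := by rw [← pow_add, Nat.sub_add_cancel h]
        rw [Nat.succ_sub hk', Nat.succ_mul, pow_add, hpow]
        ring
    rw [sum_congr rfl hfirst, ← mul_sum, ih m x hx]
    cases m with
    | zero =>
      simp [invQFactSub_of_lt, qPochhammer_zero, qPochhammer_succ q]
      rw [← pow_succ']
      have hX' := qPochhammer_ne_zero hx (n + 1)
      field_simp
    | succ m =>
      have hm := sub_ne_zero.mpr (hq m).symm
      have hxm := one_sub_ne_zero_of_forall hx m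
      have hR := qPochhammer_self_ne_zero hq m
      have hZ := qPochhammer_ne_zero hx m
      have hshift : ∀ k ∈ range (n + 1), invQFactSub q n k * (qPochhammer q q k)⁻¹ *
          (invQFactSub q (m + 1) (k + 1) * (q ^ ((n + 1 - (k + 1)) * (m + 1 - (k + 1))) *
            (qPochhammer (x * q) q (k + 1))⁻¹)) =
          1 / (1 - x * q) * (invQFactSub q n k * (qPochhammer q q k)⁻¹ *
          (invQFactSub q m k *
            (q ^ ((n - k) * (m - k)) * (qPochhammer (x * q * q) q k)⁻¹))) := by
        intro k _
        rw [qPochhammer_succ', mul_inv, invQFactSub_succ_succ, Nat.add_sub_add_right,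
          Nat.add_sub_add_right]
        ring
      rw [sum_congr rfl hshift, ← mul_sum, ih m (x * q) (forall_mul_self_ne_one hx)]
      have hY' : ∀ j, qPochhammer (x * q * q) q j =
          qPochhammer (x * q) q (j + 1) / (1 - x * q) := by
        intro j
        rw [eq_div_iff hx0, qPochhammer_succ', mul_comm]
      rw [hY', hY', hY', show n + 1 + (m + 1) = n + (m + 1) + 1 by ring,
        show n + (m + 1) = n + m + 1 by ring, qPochhammer_succ (x * q) q (n + m + 1),
        qPochhammer_succ (x * q) q n, qPochhammer_succ (x * q) q m,
        qPochhammer_succ q q n, qPochhammer_succ q q m]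
      simp only [mul_assoc x q, ← pow_succ']
      field_simp
      ring

lemma sum_invQFactSub_mul_invQFactSub {x q : K} (hq : ∀ i : ℕ, q ^ (i + 1) ≠ 1)
    (hx : ∀ i : ℕ, x * q ^ (i + 1) ≠ 1) (n k : ℕ) :
    ∑ r ∈ range (n + 1), invQFactSub q n r * invQFactSub q r k *
        (x ^ r * q ^ (r * (r - k)) * (qPochhammer (x * q) q r)⁻¹) =
      x ^ k * invQFactSub q n k * (qPochhammer (x * q) q n)⁻¹ := by
  rcases Nat.lt_or_ge n k with h | h
  · rw [invQFactSub_of_lt q h]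
    simp only [mul_zero, zero_mul]
    refine sum_eq_zero fun r hr => ?_
    have hr' := mem_range.mp hr
    rw [invQFactSub_of_lt q (show r < k by omega)]
    simp
  · obtain ⟨N, rfl⟩ := Nat.exists_eq_add_of_le h
    have hzero : ∑ r ∈ range k, invQFactSub q (k + N) r * invQFactSub q r k *
        (x ^ r * q ^ (r * (r - k)) * (qPochhammer (x * q) q r)⁻¹) = 0 := by
      refine sum_eq_zero fun r hr => ?_
      rw [invQFactSub_of_lt q (mem_range.mp hr)]
      simp
    have hy : ∀ i : ℕ, x * q ^ k * q ^ (i + 1) ≠ 1 := by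
      intro i
      rw [mul_assoc, ← pow_add, ← add_assoc]
      exact hx (k + i)
    have hterm : ∀ t ∈ range (N + 1), invQFactSub q (k + N) (k + t) * invQFactSub q (k + t) k *
        (x ^ (k + t) * q ^ ((k + t) * (k + t - k)) * (qPochhammer (x * q) q (k + t))⁻¹) =
        x ^ k * (qPochhammer (x * q) q k)⁻¹ *
        (invQFactSub q N t * (qPochhammer q q t)⁻¹ * ((x * q ^ k) ^ t * q ^ (t ^ 2) *
          (qPochhammer (x * q ^ k * q) q t)⁻¹)) := by
      intro t _
      rw [invQFactSub_add_add, invQFactSub_of_le q (Nat.le_add_right k t),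
        Nat.add_sub_cancel_left, qPochhammer_add, mul_inv, mul_right_comm x q]
      ring
    rw [add_assoc, sum_range_add, hzero, zero_add, sum_congr rfl hterm, ← mul_sum,
      sum_qVandermonde_limit hq N _ hy, invQFactSub_of_le q h, Nat.add_sub_cancel_left,
      qPochhammer_add, mul_inv, mul_inv, mul_right_comm x q]
    ring

/-- The fixed-point property of `Φ_{n,m}(z,w;q)` under the kernel `𝒦(z,w;q)`. -/
lemma sum_kernel_mul_phi {z w q : K} (hq : ∀ i : ℕ, q ^ (i + 1) ≠ 1)
    (hz : ∀ i : ℕ, z * q ^ (i + 1) ≠ 1) (hw : ∀ i : ℕ, w * q ^ (i + 1) ≠ 1)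
    (hzw : ∀ i : ℕ, z * w * q ^ (i + 1) ≠ 1) (n m : ℕ) :
    ∑ r ∈ range (n + 1), ∑ s ∈ range (m + 1),
      z ^ r * w ^ s * q ^ (r ^ 2 + s ^ 2 - r * s) /
        (qPochhammer q q (n - r) * qPochhammer q q (m - s)) *
      (qPochhammer (z * w * q) q (r + s) /
        ((qPochhammer q q r * qPochhammer (z * q) q r * qPochhammer (z * w * q) q r) *
          (qPochhammer q q s * qPochhammer (w * q) q s * qPochhammer (z * w * q) q s))) =
      qPochhammer (z * w * q) q (n + m) /
        ((qPochhammer q q n * qPochhammer (z * q) q n * qPochhammer (z * w * q) q n) *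
          (qPochhammer q q m * qPochhammer (w * q) q m * qPochhammer (z * w * q) q m)) := by
  have hterm : ∀ r ∈ range (n + 1), ∀ s ∈ range (m + 1),
      z ^ r * w ^ s * q ^ (r ^ 2 + s ^ 2 - r * s) /
        (qPochhammer q q (n - r) * qPochhammer q q (m - s)) *
      (qPochhammer (z * w * q) q (r + s) /
        ((qPochhammer q q r * qPochhammer (z * q) q r * qPochhammer (z * w * q) q r) *
          (qPochhammer q q s * qPochhammer (w * q) q s * qPochhammer (z * w * q) q s))) =
      ∑ k ∈ range (n + 1), (qPochhammer q q k)⁻¹ * q ^ (k ^ 2) *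
        (qPochhammer (z * w * q) q k)⁻¹ *
        (invQFactSub q n r * invQFactSub q r k *
          (z ^ r * q ^ (r * (r - k)) * (qPochhammer (z * q) q r)⁻¹)) *
        (invQFactSub q m s * invQFactSub q s k *
          (w ^ s * q ^ (s * (s - k)) * (qPochhammer (w * q) q s)⁻¹)) := by
    intro r hr s hs
    have hr' : r ≤ n := by simpa [Nat.lt_succ_iff] using hr
    have hs' : s ≤ m := by simpa [Nat.lt_succ_iff] using hs
    have hsplit : qPochhammer (z * w * q) q (r + s) /
        ((qPochhammer q q r * qPochhammer (z * q) q r * qPochhammer (z * w * q) q r) *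
          (qPochhammer q q s * qPochhammer (w * q) q s * qPochhammer (z * w * q) q s)) =
        (qPochhammer (z * q) q r)⁻¹ * (qPochhammer (w * q) q s)⁻¹ *
        (qPochhammer (z * w * q) q (r + s) / (qPochhammer q q r * qPochhammer q q s *
        (qPochhammer (z * w * q) q r * qPochhammer (z * w * q) q s))) := by
      simp only [div_eq_mul_inv, mul_inv]
      ring
    have hsub : range (r + 1) ⊆ range (n + 1) := range_subset_range.mpr (by omega)
    rw [hsplit, ← sum_qVandermonde' hq r s _ hzw, sum_subset hsub, mul_sum, mul_sum]
    · refine sum_congr rfl fun k _ => ?_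
      rcases Nat.lt_or_ge r k with h | h
      · simp [invQFactSub_of_lt q h]
      rcases Nat.lt_or_ge s k with h' | h'
      · simp [invQFactSub_of_lt q h']
      have hexp : r ^ 2 + s ^ 2 - r * s + (r - k) * (s - k) =
          k ^ 2 + r * (r - k) + s * (s - k) := by
        obtain ⟨a, rfl⟩ := Nat.exists_eq_add_of_le h
        obtain ⟨b, rfl⟩ := Nat.exists_eq_add_of_le h'
        have hle : (k + a) * (k + b) ≤ (k + a) ^ 2 + (k + b) ^ 2 := by
          nlinarith [two_mul_le_add_sq (k + a) (k + b)]
        simp only [Nat.add_sub_cancel_left]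
        zify [hle]
        ring
      have hpow : q ^ (r ^ 2 + s ^ 2 - r * s) * q ^ ((r - k) * (s - k)) =
          q ^ (k ^ 2) * q ^ (r * (r - k)) * q ^ (s * (s - k)) := by
        rw [← pow_add, hexp, pow_add, pow_add]
      rw [invQFactSub_of_le q hr', invQFactSub_of_le q hs', div_eq_mul_inv, mul_inv]
      linear_combination (z ^ r * w ^ s * (qPochhammer q q (n - r))⁻¹ *
        (qPochhammer q q (m - s))⁻¹ * (qPochhammer (z * q) q r)⁻¹ *
        (qPochhammer (w * q) q s)⁻¹ * invQFactSub q r k * (qPochhammer q q k)⁻¹ *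
        invQFactSub q s k * (qPochhammer (z * w * q) q k)⁻¹) * hpow
    · intro k _ hk
      have hk' : r < k := by simpa [Nat.lt_succ_iff] using hk
      simp [invQFactSub_of_lt q hk']
  rw [sum_congr rfl fun r hr => sum_congr rfl (hterm r hr)]
  have hswap : ∀ A B : ℕ → ℕ → K, ∀ D : ℕ → K,
      ∑ r ∈ range (n + 1), ∑ s ∈ range (m + 1), ∑ k ∈ range (n + 1), D k * A r k * B s k =
      ∑ k ∈ range (n + 1), D k * (∑ r ∈ range (n + 1), A r k) *
        ∑ s ∈ range (m + 1), B s k := by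
    intro A B D
    simp only [mul_sum, sum_mul]
    rw [sum_congr rfl fun r _ => sum_comm, sum_comm]
    exact sum_congr rfl fun k _ => sum_comm
  rw [hswap (fun r k => invQFactSub q n r * invQFactSub q r k *
      (z ^ r * q ^ (r * (r - k)) * (qPochhammer (z * q) q r)⁻¹))
    (fun s k => invQFactSub q m s * invQFactSub q s k *
      (w ^ s * q ^ (s * (s - k)) * (qPochhammer (w * q) q s)⁻¹))]
  simp only [sum_invQFactSub_mul_invQFactSub hq hz, sum_invQFactSub_mul_invQFactSub hq hw]
  have hfin := sum_qVandermonde hq n m _ hzw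
  have hgoal : qPochhammer (z * w * q) q (n + m) /
        ((qPochhammer q q n * qPochhammer (z * q) q n * qPochhammer (z * w * q) q n) *
          (qPochhammer q q m * qPochhammer (w * q) q m * qPochhammer (z * w * q) q m)) =
        (qPochhammer (z * q) q n)⁻¹ * (qPochhammer (w * q) q m)⁻¹ *
        (qPochhammer (z * w * q) q (n + m) / (qPochhammer q q n * qPochhammer q q m *
        (qPochhammer (z * w * q) q n * qPochhammer (z * w * q) q m))) := by
    simp only [div_eq_mul_inv, mul_inv]
    ring
  rw [hgoal, ← hfin, mul_sum]
  refine sum_congr rfl fun k _ => ?_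
  rw [mul_pow]
  ring

end General

/-- The fixed-point property of `Phi` under `Kker`, for generic parameters. -/
lemma sum_Kker_mul_Phi {a b c : F} (hq : ∀ i : ℕ, c ^ (i + 1) ≠ 1)
    (hz : ∀ i : ℕ, a * c ^ (i + 1) ≠ 1) (hw : ∀ i : ℕ, b * c ^ (i + 1) ≠ 1)
    (hzw : ∀ i : ℕ, a * b * c ^ (i + 1) ≠ 1) (n m : ℕ) :
    ∑ r ∈ Finset.range (n + 1), ∑ s ∈ Finset.range (m + 1),
      Kker n m r s a b c * Phi r s a b c = Phi n m a b c :=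
  sum_kernel_mul_phi hq hz hw hzw n m

lemma PhiZ_natCast (n m : ℕ) (a b c : F) : PhiZ n m a b c = Phi n m a b c := by
  simp [PhiZ]

lemma PhiZ_of_neg_left {n m : ℤ} (h : n < 0) (a b c : F) : PhiZ n m a b c = 0 :=
  if_neg fun h' => absurd h'.1 (not_le.mpr h)

lemma PhiZ_of_neg_right {n m : ℤ} (h : m < 0) (a b c : F) : PhiZ n m a b c = 0 :=
  if_neg fun h' => absurd h'.2 (not_le.mpr h)

lemma mul_le_sq_add_sq (r s : ℕ) : r * s ≤ r ^ 2 + s ^ 2 := by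
  nlinarith [two_mul_le_add_sq r s]

lemma Kker_succ_left {a b c : F} (hc : c ≠ 0) (n m r s : ℕ) :
    Kker (n + 1) m (r + 1) s (a / c) b c = a * Kker n m r s (a * c) (b / c) c := by
  have hexp : (r + 1) ^ 2 + s ^ 2 - (r + 1) * s + s = r ^ 2 + s ^ 2 - r * s + r + (r + 1) := by
    zify [mul_le_sq_add_sq (r + 1) s, mul_le_sq_add_sq r s]
    ring
  have hpow : c ^ ((r + 1) ^ 2 + s ^ 2 - (r + 1) * s) * c ^ s =
      c ^ (r ^ 2 + s ^ 2 - r * s) * c ^ r * c ^ (r + 1) := by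
    rw [← pow_add, hexp, pow_add, pow_add]
  have hnum : (a / c) ^ (r + 1) * b ^ s * c ^ ((r + 1) ^ 2 + s ^ 2 - (r + 1) * s) =
      a * ((a * c) ^ r * (b / c) ^ s * c ^ (r ^ 2 + s ^ 2 - r * s)) := by
    rw [div_pow, div_pow, mul_pow, div_mul_eq_mul_div, div_mul_eq_mul_div,
      div_eq_iff (pow_ne_zero _ hc), mul_div_assoc', div_mul_eq_mul_div, mul_div_assoc',
      div_mul_eq_mul_div, eq_div_iff (pow_ne_zero _ hc)]
    linear_combination a ^ (r + 1) * b ^ s * hpow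
  rw [Kker, Kker, hnum, Nat.add_sub_add_right, mul_div_assoc]

lemma Kker_succ_succ {a b c : F} (hc : c ≠ 0) (n m r s : ℕ) :
    Kker (n + 1) (m + 1) (r + 1) (s + 1) (a / c) b c = a * b * Kker n m r s a (b * c) c := by
  have hexp : (r + 1) ^ 2 + (s + 1) ^ 2 - (r + 1) * (s + 1) =
      r ^ 2 + s ^ 2 - r * s + s + (r + 1) := by
    zify [mul_le_sq_add_sq (r + 1) (s + 1), mul_le_sq_add_sq r s]
    ring
  have hnum : (a / c) ^ (r + 1) * b ^ (s + 1) *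
      c ^ ((r + 1) ^ 2 + (s + 1) ^ 2 - (r + 1) * (s + 1)) =
      a * b * (a ^ r * (b * c) ^ s * c ^ (r ^ 2 + s ^ 2 - r * s)) := by
    rw [hexp, div_pow, mul_pow, div_mul_eq_mul_div, div_mul_eq_mul_div,
      div_eq_iff (pow_ne_zero _ hc), pow_add, pow_add]
    ring
  rw [Kker, Kker, hnum, Nat.add_sub_add_right, Nat.add_sub_add_right, mul_div_assoc]

lemma monomial_ne_one {e : Fin 5 →₀ ℕ} (he : e ≠ 0) :
    algebraMap (MvPolynomial (Fin 5) ℚ) F (MvPolynomial.monomial e 1) ≠ 1 := by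
  intro h
  rw [← map_one (algebraMap (MvPolynomial (Fin 5) ℚ) F)] at h
  have h' := IsFractionRing.injective (MvPolynomial (Fin 5) ℚ) F h
  rw [← MvPolynomial.C_1, ← MvPolynomial.monomial_zero',
    MvPolynomial.monomial_left_inj one_ne_zero] at h'
  exact he h'

lemma z_pow_mul_w_pow_mul_q_pow_ne_one {i j k : ℕ} (h : i + j + k ≠ 0) :
    z ^ i * w ^ j * q ^ k ≠ 1 := by
  have he : Finsupp.single (2 : Fin 5) i + Finsupp.single 3 j + Finsupp.single 4 k ≠ 0 := by
    intro h0
    have h2 := DFunLike.congr_fun h0 2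
    have h3 := DFunLike.congr_fun h0 3
    have h4 := DFunLike.congr_fun h0 4
    simp at h2 h3 h4
    omega
  have := monomial_ne_one he
  rwa [MvPolynomial.monomial_add_single, MvPolynomial.monomial_add_single,
    ← MvPolynomial.X_pow_eq_monomial, map_mul, map_mul, map_pow, map_pow, map_pow] at this

lemma q_ne_zero : q ≠ 0 := by
  intro h
  exact MvPolynomial.X_ne_zero (R := ℚ) (4 : Fin 5)
    (IsFractionRing.injective (MvPolynomial (Fin 5) ℚ) F (h.trans (map_zero _).symm))

lemma q_pow_succ_ne_one (i : ℕ) : q ^ (i + 1) ≠ 1 := by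
  simpa using z_pow_mul_w_pow_mul_q_pow_ne_one (i := 0) (j := 0) (k := i + 1) (by omega)

lemma sum_Kker_mul_PhiZ_zero (n m : ℕ) :
    ∑ r ∈ Finset.range (n + 1), ∑ s ∈ Finset.range (m + 1),
      Kker n m r s (z / q) w q * PhiZ r s (z / q) w q = PhiZ n m (z / q) w q := by
  simp only [PhiZ_natCast]
  have hdiv : ∀ i : ℕ, z / q * q ^ (i + 1) = z * q ^ i := fun i => by
    rw [pow_succ', ← mul_assoc, div_mul_cancel₀ _ q_ne_zero]
  refine sum_Kker_mul_Phi q_pow_succ_ne_one (fun i => ?_) (fun i => ?_) (fun i => ?_) n m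
  · rw [hdiv]
    simpa using z_pow_mul_w_pow_mul_q_pow_ne_one (i := 1) (j := 0) (k := i) (by omega)
  · simpa using z_pow_mul_w_pow_mul_q_pow_ne_one (i := 0) (j := 1) (k := i + 1) (by omega)
  · rw [mul_right_comm, hdiv, mul_right_comm]
    simpa using z_pow_mul_w_pow_mul_q_pow_ne_one (i := 1) (j := 1) (k := i) (by omega)

lemma sum_Kker_mul_PhiZ_left (n m : ℕ) :
    ∑ r ∈ Finset.range (n + 1), ∑ s ∈ Finset.range (m + 1),
      Kker n m r s (z / q) w q * PhiZ ((r : ℤ) - 1) s (z * q) (w / q) q =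
      z * PhiZ ((n : ℤ) - 1) m (z * q) (w / q) q := by
  cases n with
  | zero => simp [PhiZ_of_neg_left]
  | succ n =>
    have hdiv : ∀ i : ℕ, w / q * q ^ (i + 1) = w * q ^ i := fun i => by
      rw [pow_succ', ← mul_assoc, div_mul_cancel₀ _ q_ne_zero]
    rw [Finset.sum_range_succ']
    simp only [Nat.cast_add, Nat.cast_one, add_sub_cancel_right, PhiZ_natCast,
      Kker_succ_left q_ne_zero, mul_assoc z (Kker _ _ _ _ _ _ _), ← Finset.mul_sum]
    rw [sum_Kker_mul_Phi q_pow_succ_ne_one]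
    · simp [PhiZ_of_neg_left]
    · intro i
      rw [mul_assoc, ← pow_succ']
      simpa using z_pow_mul_w_pow_mul_q_pow_ne_one (i := 1) (j := 0) (k := i + 2) (by omega)
    · intro i
      rw [hdiv]
      simpa using z_pow_mul_w_pow_mul_q_pow_ne_one (i := 0) (j := 1) (k := i) (by omega)
    · intro i
      rw [mul_assoc (z * q), hdiv,
        show z * q * (w * q ^ i) = z * w * q ^ (i + 1) by ring]
      simpa using z_pow_mul_w_pow_mul_q_pow_ne_one (i := 1) (j := 1) (k := i + 1) (by omega)

lemma sum_Kker_mul_PhiZ_both (n m : ℕ) :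
    ∑ r ∈ Finset.range (n + 1), ∑ s ∈ Finset.range (m + 1),
      Kker n m r s (z / q) w q * PhiZ ((r : ℤ) - 1) ((s : ℤ) - 1) z (w * q) q =
      z * w * PhiZ ((n : ℤ) - 1) ((m : ℤ) - 1) z (w * q) q := by
  cases n with
  | zero => simp [PhiZ_of_neg_left]
  | succ n =>
    cases m with
    | zero => simp [PhiZ_of_neg_right]
    | succ m =>
      rw [Finset.sum_range_succ']
      simp only [Finset.sum_range_succ' _ (m + 1), Nat.cast_add, Nat.cast_one,
        add_sub_cancel_right, PhiZ_natCast, Kker_succ_succ q_ne_zero,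
        mul_assoc (z * w) (Kker _ _ _ _ _ _ _), ← Finset.mul_sum, Nat.cast_zero, zero_sub,
        PhiZ_of_neg_left (show (-1 : ℤ) < 0 by decide),
        PhiZ_of_neg_right (show (-1 : ℤ) < 0 by decide), mul_zero, add_zero,
        Finset.sum_const_zero]
      rw [sum_Kker_mul_Phi q_pow_succ_ne_one]
      · intro i
        simpa using z_pow_mul_w_pow_mul_q_pow_ne_one (i := 1) (j := 0) (k := i + 1) (by omega)
      · intro i
        rw [mul_assoc, ← pow_succ']
        simpa using z_pow_mul_w_pow_mul_q_pow_ne_one (i := 0) (j := 1) (k := i + 2) (by omega)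
      · intro i
        rw [show z * (w * q) * q ^ (i + 1) = z * w * q ^ (i + 2) by ring]
        simpa using z_pow_mul_w_pow_mul_q_pow_ne_one (i := 1) (j := 1) (k := i + 2) (by omega)

/-- Part I of the `A₂` Bailey tree (Theorem 4.6, equation (4.14b), of the paper),
as an identity of rational functions in `u, v, z, w, q`. -/
theorem A2_bailey_tree_I (n m : ℕ) :
    ∑ r ∈ Finset.range (n + 1), ∑ s ∈ Finset.range (m + 1),
      Kker n m r s (z / q) w q * PhiUV r s u v z w q
      = PhiUV n m (u * z) (v * w) z w q := by
  have hsplit : ∀ r s : ℕ, Kker n m r s (z / q) w q * PhiUV r s u v z w q =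
      Kker n m r s (z / q) w q * PhiZ r s (z / q) w q -
      u * z / qPoch z q 2 *
        (Kker n m r s (z / q) w q * PhiZ ((r : ℤ) - 1) s (z * q) (w / q) q) +
      u * v * z * w ^ 2 / (qPoch w q 2 * qPoch (z * w) q 2) *
        (Kker n m r s (z / q) w q * PhiZ ((r : ℤ) - 1) ((s : ℤ) - 1) z (w * q) q) := by
    intro r s
    rw [PhiUV]
    ring
  simp only [hsplit, Finset.sum_add_distrib, Finset.sum_sub_distrib, ← Finset.mul_sum]
  rw [sum_Kker_mul_PhiZ_zero, sum_Kker_mul_PhiZ_left, sum_Kker_mul_PhiZ_both, PhiUV]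
  ring

end Stmt13
end
end

section
/- Lemma (Schur function limit of the four-parameter Φ). Let z := x_1/x_2, w := x_2/x_3 and, for nonnegative integers a,b, let ν := (a+b+2, b+1, 0). Then lim_{n,m→∞} Φ_{n,m}(z^a, w^a; z^b, w^b; z, w; q) = det_{1≤i,j≤3}(x_i^{ν_i−ν_j}) / (q,q,z,w,zw/q;q)_∞, where the limit is taken coefficientwise (as formal power series in q with coefficients in ℚ(x_1,x_2,x_3), equivalently for |q| < 1 and generic x_i). -/
noncomputable section

namespace Stmt14

/-- `(a; q)_n`, the finite q-Pochhammer symbol. -/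
def qPoch (a q : ℂ) (n : ℕ) : ℂ := ∏ j ∈ Finset.range n, (1 - a * q ^ j)

/-- `(a; q)_∞`. -/
def qPochInf (a q : ℂ) : ℂ := ∏' j : ℕ, (1 - a * q ^ j)

/-- `(a;q)_n` for `n : ℤ`:  the usual product for `n ≥ 0` and
`(a;q)_{-m} = 1/∏_{j=1}^m (1 - a q^{-j})` for `n = -m < 0`. -/
def qPochZ (a q : ℂ) (n : ℤ) : ℂ :=
  if 0 ≤ n then qPoch a q n.toNat
  else (∏ j ∈ Finset.range (-n).toNat, (1 - a * q ^ (-(j : ℤ) - 1)))⁻¹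

/-- `Φ_{n,m;y}(z,w;q)` for `y = (y₁,y₂,y₃) ∈ ℤ³` with `y₁+y₂+y₃ = 0`. -/
def Phiy (n m : ℤ) (y : Fin 3 → ℤ) (z w q : ℂ) : ℂ :=
  qPochZ (z * w * q) q (n + m) /
    (qPochZ q q (n - y 0) * qPochZ (z * q) q (n - y 1) * qPochZ (z * w * q) q (n - y 2) *
      qPochZ q q (m + y 2) * qPochZ (w * q) q (m + y 1) * qPochZ (z * w * q) q (m + y 0))

/-- The four-parameter function `Φ_{n,m}(u,v;c,d;z,w;q)`, a signed sum over `S₃`. -/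
def Phi4 (n m : ℤ) (u v c d z w q : ℂ) : ℂ :=
  ∑ σ : Equiv.Perm (Fin 3),
    ((Equiv.Perm.sign σ : ℤ) : ℂ) * (u * z) ^ ((σ 0 : Fin 3) : ℕ) *
      (if σ 2 = 0 then v / d else 1) * (if σ 0 = 2 then c / u else 1) *
      (d * w) ^ (2 - ((σ 2 : Fin 3) : ℕ)) *
      Phiy n m (fun i => ((σ i : ℕ) : ℤ) - ((i : ℕ) : ℤ)) (z / q) (w / q) q

/-- `ν = (a+b+2, b+1, 0)`. -/
def nu (a b : ℕ) : Fin 3 → ℤ := ![(a : ℤ) + b + 2, (b : ℤ) + 1, 0]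

lemma summable_neg_mul_pow (a : ℂ) {q : ℂ} (hq : ‖q‖ < 1) :
    Summable fun j : ℕ => ‖-(a * q ^ j)‖ := by
  simpa [norm_mul, norm_pow] using
    (summable_geometric_of_lt_one (norm_nonneg q) hq).mul_left ‖a‖

lemma tendsto_qPoch (a : ℂ) {q : ℂ} (hq : ‖q‖ < 1) :
    Filter.Tendsto (qPoch a q) Filter.atTop (nhds (qPochInf a q)) := by
  have h := (multipliable_one_add_of_summable
    (summable_neg_mul_pow a hq)).hasProd.tendsto_prod_nat
  simpa only [← sub_eq_add_neg] using! h

lemma qPochInf_ne_zero {a q : ℂ} (hq : ‖q‖ < 1) (h : ∀ j : ℕ, a * q ^ j ≠ 1) :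
    qPochInf a q ≠ 0 := by
  have := tprod_one_add_ne_zero_of_summable (f := fun j : ℕ => -(a * q ^ j))
    (fun j => by rw [← sub_eq_add_neg]; exact sub_ne_zero.2 (h j).symm)
    (summable_neg_mul_pow a hq)
  simpa only [← sub_eq_add_neg] using! this

lemma tendsto_qPochZ (a : ℂ) {q : ℂ} (hq : ‖q‖ < 1) :
    Filter.Tendsto (qPochZ a q) Filter.atTop (nhds (qPochInf a q)) := by
  have hnat : Filter.Tendsto Int.toNat Filter.atTop Filter.atTop :=
    Filter.tendsto_atTop.2 fun n =>
      (Filter.eventually_ge_atTop (n : ℤ)).mono fun k hk => by omega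
  refine ((tendsto_qPoch a hq).comp hnat).congr' ?_
  filter_upwards [Filter.eventually_ge_atTop (0 : ℤ)] with k hk
  simp [qPochZ, hk]

/-- As `n, m → ∞`, `Φ_{n,m;y}(z,w;q)` tends to `1/(q,q,zq,wq,zwq;q)_∞`, whatever `y` is. -/
lemma tendsto_Phiy (y : Fin 3 → ℤ) {z w q : ℂ} (hq : ‖q‖ < 1)
    (h1 : qPochInf q q ≠ 0) (hz : qPochInf (z * q) q ≠ 0) (hw : qPochInf (w * q) q ≠ 0)
    (hzw : qPochInf (z * w * q) q ≠ 0) :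
    Filter.Tendsto (fun p : ℕ × ℕ => Phiy p.1 p.2 y z w q) Filter.atTop
      (nhds (1 / (qPochInf q q * qPochInf q q * qPochInf (z * q) q * qPochInf (w * q) q *
        qPochInf (z * w * q) q))) := by
  have hfst : Filter.Tendsto (fun p : ℕ × ℕ => (p.1 : ℤ)) Filter.atTop Filter.atTop := by
    rw [← Filter.prod_atTop_atTop_eq]
    exact tendsto_natCast_atTop_atTop.comp Filter.tendsto_fst
  have hsnd : Filter.Tendsto (fun p : ℕ × ℕ => (p.2 : ℤ)) Filter.atTop Filter.atTop := by
    rw [← Filter.prod_atTop_atTop_eq]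
    exact tendsto_natCast_atTop_atTop.comp Filter.tendsto_snd
  have hn (a : ℂ) (k : ℤ) := (tendsto_qPochZ a hq).comp
    (Filter.tendsto_atTop_add_const_right _ (-k) hfst)
  have hm (a : ℂ) (k : ℤ) := (tendsto_qPochZ a hq).comp
    (Filter.tendsto_atTop_add_const_right _ k hsnd)
  have hnm := (tendsto_qPochZ (z * w * q) hq).comp (hfst.atTop_add_atTop hsnd)
  have key := hnm.div ((((((hn q (y 0)).mul (hn (z * q) (y 1))).mul
    (hn (z * w * q) (y 2))).mul (hm q (y 2))).mul (hm (w * q) (y 1))).mul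
    (hm (z * w * q) (y 0))) (by simp [h1, hz, hw, hzw])
  convert key using 2
  · simp [Phiy, sub_eq_add_neg]
  · field_simp

/-- The coefficient of `Φ_{n,m;σ-ρ}` in the specialised four-parameter `Φ` is the product
attached to `σ` in the Leibniz expansion of `det (x_i ^ (ν_i - ν_j))`. -/
lemma Phi4_coeff_eq (a b : ℕ) (x : Fin 3 → ℂ) (hx : ∀ i, x i ≠ 0) (σ : Equiv.Perm (Fin 3)) :
    ((x 0 / x 1) ^ a * (x 0 / x 1)) ^ ((σ 0 : Fin 3) : ℕ) *
      (if σ 2 = 0 then (x 1 / x 2) ^ a / (x 1 / x 2) ^ b else 1) *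
      (if σ 0 = 2 then (x 0 / x 1) ^ b / (x 0 / x 1) ^ a else 1) *
      ((x 1 / x 2) ^ b * (x 1 / x 2)) ^ (2 - ((σ 2 : Fin 3) : ℕ)) =
    ∏ i, x i ^ (nu a b i - nu a b (σ i)) := by
  have h0 := hx 0
  have h1 := hx 1
  have h2 := hx 2
  have d01 : σ 0 ≠ σ 1 := σ.injective.ne (by decide)
  have d02 : σ 0 ≠ σ 2 := σ.injective.ne (by decide)
  have d12 : σ 1 ≠ σ 2 := σ.injective.ne (by decide)
  rw [Fin.prod_univ_three]
  generalize σ 0 = s at *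
  generalize σ 1 = t at *
  generalize σ 2 = r at *
  fin_cases s <;> fin_cases t <;> fin_cases r <;>
    first
    | exact absurd rfl d01
    | exact absurd rfl d02
    | exact absurd rfl d12
    | (simp [nu, zpow_sub₀, zpow_add₀, h0, h1, h2]
       try simp only [div_pow]
       try field_simp)

lemma det_zpow_nu (a b : ℕ) (x : Fin 3 → ℂ) :
    Matrix.det (Matrix.of fun i j : Fin 3 => x i ^ (nu a b i - nu a b j)) =
      ∑ σ : Equiv.Perm (Fin 3), ((Equiv.Perm.sign σ : ℤ) : ℂ) *
        ∏ i, x i ^ (nu a b i - nu a b (σ i)) := by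
  rw [← Matrix.det_transpose, Matrix.det_apply']
  rfl

/-- The Schur-function limit of the four-parameter `Φ` (Lemma 4.7 of the paper):
with `z = x₁/x₂` and `w = x₂/x₃`,
`lim_{n,m→∞} Φ_{n,m}(z^a,w^a;z^b,w^b;z,w;q)
  = det(x_i^{ν_i-ν_j}) / (q,q,z,w,zw/q;q)_∞`,
for `0 < |q| < 1` and generic `x₁, x₂, x₃`. -/
theorem Phi4_limit
    (a b : ℕ) (q : ℂ) (hq : ‖q‖ < 1) (hq0 : q ≠ 0)
    (x : Fin 3 → ℂ) (hx : ∀ i, x i ≠ 0)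
    (hgen : ∀ i j : Fin 3, i ≠ j → ∀ n : ℤ, x i / x j ≠ q ^ n) :
    Filter.Tendsto
      (fun p : ℕ × ℕ =>
        Phi4 p.1 p.2 ((x 0 / x 1) ^ a) ((x 1 / x 2) ^ a) ((x 0 / x 1) ^ b)
          ((x 1 / x 2) ^ b) (x 0 / x 1) (x 1 / x 2) q)
      Filter.atTop
      (nhds (Matrix.det (Matrix.of fun i j : Fin 3 => x i ^ (nu a b i - nu a b j)) /
        (qPochInf q q * qPochInf q q * qPochInf (x 0 / x 1) q * qPochInf (x 1 / x 2) q *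
          qPochInf (x 0 / x 1 * (x 1 / x 2) / q) q))) := by
  have hd (i j : Fin 3) (hij : i ≠ j) (k : ℤ) : x i / x j * q ^ k ≠ 1 := fun h =>
    hgen i j hij (-k) (by rw [zpow_neg]; exact eq_inv_of_mul_eq_one_left h)
  have e : x 0 / x 1 * (x 1 / x 2) = x 0 / x 2 := by
    have := hx 1
    field_simp
  have h1 : qPochInf q q ≠ 0 := qPochInf_ne_zero hq fun j h => by
    have h' := congrArg norm h
    rw [← pow_succ', norm_pow, norm_one] at h'
    exact (pow_lt_one₀ (norm_nonneg q) hq j.succ_ne_zero).ne h'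
  have hz : qPochInf (x 0 / x 1) q ≠ 0 := qPochInf_ne_zero hq fun j => by
    simpa using hd 0 1 (by decide) j
  have hw : qPochInf (x 1 / x 2) q ≠ 0 := qPochInf_ne_zero hq fun j => by
    simpa using hd 1 2 (by decide) j
  have hzw : qPochInf (x 0 / x 1 * (x 1 / x 2) / q) q ≠ 0 := qPochInf_ne_zero hq fun j => by
    have := hd 0 2 (by decide) (j - 1)
    rw [zpow_sub₀ hq0, zpow_natCast, zpow_one] at this
    rwa [e, div_mul_eq_mul_div, mul_div_assoc]
  have ez : x 0 / x 1 / q * q = x 0 / x 1 := div_mul_cancel₀ _ hq0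
  have ew : x 1 / x 2 / q * q = x 1 / x 2 := div_mul_cancel₀ _ hq0
  have ezw : x 0 / x 1 / q * (x 1 / x 2 / q) * q = x 0 / x 1 * (x 1 / x 2) / q := by
    rw [mul_assoc, ew, div_mul_eq_mul_div]
  rw [det_zpow_nu, Finset.sum_div]
  refine tendsto_finsetSum _ fun σ _ => ?_
  have key := (tendsto_Phiy (fun i => ((σ i : ℕ) : ℤ) - ((i : ℕ) : ℤ)) hq h1
    (ez.symm ▸ hz) (ew.symm ▸ hw) (ezw.symm ▸ hzw)).const_mul
    (((Equiv.Perm.sign σ : ℤ) : ℂ) * ∏ i, x i ^ (nu a b i - nu a b (σ i)))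
  rw [ez, ew, ezw, mul_one_div] at key
  refine key.congr fun p => ?_
  rw [← Phi4_coeff_eq a b x hx σ]
  ring

end Stmt14
end
end

section
/- Lemma (the case c = d = 1 of the four-parameter Φ). For all integers n, m, Φ_{n,m}(u,v;1,1;z,w;q) = [ Φ_{n,m}(u,v;z,w;q) − z w q^{m−1} Φ_{n,m}(u/z, v/w; z,w;q) ] / (1 − z w q^{−1}), as an identity of rational functions in u, v, z, w, q over ℚ. -/
noncomputable section

namespace Stmt15

/-- The field `ℚ(u, v, z, w, q)` of rational functions in five variables over `ℚ`. -/
abbrev F : Type := FractionRing (MvPolynomial (Fin 5) ℚ)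

/-- The variable `u`. -/
def u : F := algebraMap (MvPolynomial (Fin 5) ℚ) F (MvPolynomial.X 0)

/-- The variable `v`. -/
def v : F := algebraMap (MvPolynomial (Fin 5) ℚ) F (MvPolynomial.X 1)

/-- The variable `z`. -/
def z : F := algebraMap (MvPolynomial (Fin 5) ℚ) F (MvPolynomial.X 2)

/-- The variable `w`. -/
def w : F := algebraMap (MvPolynomial (Fin 5) ℚ) F (MvPolynomial.X 3)

/-- The variable `q`. -/
def q : F := algebraMap (MvPolynomial (Fin 5) ℚ) F (MvPolynomial.X 4)

/-- `(a;b)_n` for `n : ℤ`:  the usual finite product for `n ≥ 0`, and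
`(a;b)_{-m} = 1/∏_{j=1}^m (1 - a b^{-j})` for `n = -m < 0`. -/
def qPochZ (a b : F) (n : ℤ) : F :=
  if 0 ≤ n then ∏ j ∈ Finset.range n.toNat, (1 - a * b ^ j)
  else (∏ j ∈ Finset.range (-n).toNat, (1 - a * b ^ (-(j : ℤ) - 1)))⁻¹

/-- `Φ_{n,m}(z,w;q)` for integer indices. -/
def Phi (n m : ℤ) (zz ww qq : F) : F :=
  qPochZ (zz * ww * qq) qq (n + m) /
    (qPochZ qq qq n * qPochZ (zz * qq) qq n * qPochZ (zz * ww * qq) qq n *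
      qPochZ qq qq m * qPochZ (ww * qq) qq m * qPochZ (zz * ww * qq) qq m)

/-- The two-parameter deformation `Φ_{n,m}(u,v;z,w;q)`. -/
def PhiUV (n m : ℤ) (uu vv zz ww qq : F) : F :=
  Phi n m (zz / qq) ww qq -
    uu * zz / qPochZ zz qq 2 * Phi (n - 1) m (zz * qq) (ww / qq) qq +
    uu * vv * zz * ww ^ 2 / (qPochZ ww qq 2 * qPochZ (zz * ww) qq 2) *
      Phi (n - 1) (m - 1) zz (ww * qq) qq

/-- `Φ_{n,m;y}(z,w;q)` for `y = (y₁,y₂,y₃) ∈ ℤ³` with `y₁+y₂+y₃ = 0`. -/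
def Phiy (n m : ℤ) (y : Fin 3 → ℤ) (zz ww qq : F) : F :=
  qPochZ (zz * ww * qq) qq (n + m) /
    (qPochZ qq qq (n - y 0) * qPochZ (zz * qq) qq (n - y 1) *
      qPochZ (zz * ww * qq) qq (n - y 2) * qPochZ qq qq (m + y 2) *
      qPochZ (ww * qq) qq (m + y 1) * qPochZ (zz * ww * qq) qq (m + y 0))

/-- The four-parameter function `Φ_{n,m}(u,v;c,d;z,w;q)`, a signed sum over `S₃`. -/
def Phi4 (n m : ℤ) (uu vv cc dd zz ww qq : F) : F :=
  ∑ σ : Equiv.Perm (Fin 3),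
    ((Equiv.Perm.sign σ : ℤ) : F) * (uu * zz) ^ ((σ 0 : Fin 3) : ℕ) *
      (if σ 2 = 0 then vv / dd else 1) * (if σ 0 = 2 then cc / uu else 1) *
      (dd * ww) ^ (2 - ((σ 2 : Fin 3) : ℕ)) *
      Phiy n m (fun i => ((σ i : ℕ) : ℤ) - ((i : ℕ) : ℤ)) (zz / qq) (ww / qq) qq

section Field

variable {K : Type*} [Field K] {z w q s x y : K}

/-- The part of the identity that is constant in `u` and `v`. -/
lemma coeff_one (hq : q ≠ 0) (hzw : z * w = s * q) (s0 : 1 - s ≠ 0) (wm : 1 - w * y ≠ 0)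
    (sn : 1 - s * x ≠ 0) (sm : 1 - s * y ≠ 0) :
    1 - w * ((1 - z * x / q) * (1 - y) / ((1 - s * x) * (1 - w * y))) =
      (1 - s * y) * ((1 - s * (x * y)) * (1 - s) * (1 - w) /
        ((1 - s * x) * (1 - w * y) * (1 - s * y))) / (1 - s) := by
  have h : w * (1 - z * x / q) = w - s * x := by
    field_simp
    linear_combination -x * hzw
  rw [← mul_div_assoc w, ← mul_assoc w, h]
  field_simp
  ring

/-- The part of the identity that is linear in `u` and constant in `v`. -/
lemma coeff_u (hq : q ≠ 0) (hzw : z * w = s * q) (z0 : 1 - z ≠ 0) (z1 : 1 - z * q ≠ 0)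
    (s0 : 1 - s ≠ 0) (s1 : 1 - s * q ≠ 0) (zn : 1 - z * x ≠ 0)
    (sn : 1 - s * x ≠ 0) (sm : 1 - s * y ≠ 0) (sm' : 1 - s * y * q ≠ 0) :
    z * ((1 - x) * (1 - w * y / q) / ((1 - z * x) * (1 - s * y))) -
        z ^ 2 * w * ((1 - x / q) * (1 - x) * (1 - y) * (1 - w * y / q) /
          ((1 - z * x) * (1 - s * x) * ((1 - s * y) * (1 - s * y * q)))) =
      (z - s * y) / ((1 - z) * (1 - z * q)) *
        ((1 - s * (x * y)) * (1 - x) * ((1 - z) * (1 - z * q)) * ((1 - s) * (1 - s * q)) /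
          ((1 - z * x) * (1 - s * x) * ((1 - s * y) * (1 - s * y * q)))) / (1 - s) := by
  have h : z - s * y = z * (1 - w * y / q) := by
    field_simp
    linear_combination y * hzw
  have h' : z ^ 2 * w = z * (s * q) := by rw [← hzw]; ring
  rw [h, h']
  generalize hd : 1 - s * y * q = d, he : 1 - s * x = e, hf : 1 - s * y = f,
    1 - w * y / q = g, hr : 1 - s * q = r, 1 - z * q = t, 1 - z * x = l at *
  field_simp
  subst hd he hf hr
  ring

/-- The part of the identity that is linear in `u` and in `v`. -/
lemma coeff_uv (hq : q ≠ 0) (hzw : z * w = s * q) (w0 : 1 - w ≠ 0)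
    (w1 : 1 - w * q ≠ 0) (s0 : 1 - s ≠ 0) (s1 : 1 - s * q ≠ 0) (s2 : 1 - s * q ^ 2 ≠ 0)
    (wm : 1 - w * y ≠ 0) (sn : 1 - s * x ≠ 0) (sn' : 1 - s * x * q ≠ 0)
    (sm : 1 - s * y ≠ 0) (sm' : 1 - s * y * q ≠ 0) :
    z * w ^ 2 * ((1 - x) * (1 - z * x / q) * (1 - y / q) * (1 - y) /
          ((1 - s * x) * (1 - s * x * q) * ((1 - w * y) * (1 - s * y)))) -
        z ^ 2 * w ^ 2 * ((1 - x / q) * (1 - x) * (1 - y / q) * (1 - y) /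
          ((1 - s * x) * (1 - s * x * q) * ((1 - s * y) * (1 - s * y * q)))) =
      (z * w ^ 2 - s * y * w) / ((1 - w) * (1 - w * q) * ((1 - s * q) * (1 - s * q * q))) *
        ((1 - s * (x * y)) * (1 - x) * (1 - y) * (1 - z) * ((1 - w) * (1 - w * q)) *
          ((1 - s) * (1 - s * q) * (1 - s * q ^ 2)) /
          ((1 - w * y) * ((1 - s * x) * (1 - s * x * q)) *
            ((1 - s * y) * (1 - s * y * q)))) / (1 - s) := by
  have h : z * w ^ 2 - s * y * w = s * q * w * (1 - y / q) := by
    field_simp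
    linear_combination w * hzw
  have h1 : z * w ^ 2 * ((1 - x) * (1 - z * x / q) * (1 - y / q) * (1 - y) /
          ((1 - s * x) * (1 - s * x * q) * ((1 - w * y) * (1 - s * y)))) =
      s * q * ((1 - x) * (w - s * x) * (1 - y / q) * (1 - y) /
          ((1 - s * x) * (1 - s * x * q) * ((1 - w * y) * (1 - s * y)))) := by
    have h2 : w * (1 - z * x / q) = w - s * x := by
      field_simp
      linear_combination -x * hzw
    rw [← h2, ← hzw]
    ring
  have h' : z ^ 2 * w ^ 2 = (s * q) ^ 2 := by rw [← hzw]; ring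
  have h3 : 1 - s * q * q = 1 - s * q ^ 2 := by ring
  rw [h, h1, h', h3]
  generalize hd : 1 - s * y * q = d, he : 1 - s * x = e, hf : 1 - s * y = f,
    1 - y / q = g, 1 - s * q = r, 1 - s * q ^ 2 = r', 1 - w * q = t, hl : 1 - w * y = l,
    1 - s * x * q = p at *
  field_simp
  subst hd he hf hl
  linear_combination s * g * (1 - x) * (1 - y) * (1 - s * (x * y)) * hzw

/-- The three coefficient identities combined, with the common factor `k`. -/
lemma combine_coeffs {k a b P₁ P₂ P₃ P₄ P₅ R₁ R₂ R₃ T U : K} (hz : z ≠ 0) (hw : w ≠ 0)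
    (hq : q ≠ 0) (h₁ : 1 - w * P₁ = (1 - s * y) * R₁ / (1 - s))
    (h₂ : z * P₂ - z ^ 2 * w * P₃ = (z - s * y) / T * R₂ / (1 - s))
    (h₃ : z * w ^ 2 * P₄ - z ^ 2 * w ^ 2 * P₅ = (z * w ^ 2 - s * y * w) / U * R₃ / (1 - s)) :
    k - w * (k * P₁) - a * (z * (k * P₂) - z ^ 2 * w * (k * P₃)) +
        a * b * (z * w ^ 2 * (k * P₄) - z ^ 2 * w ^ 2 * (k * P₅)) =
      (k * R₁ - a * z / T * (k * R₂) + a * b * z * w ^ 2 / U * (k * R₃) -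
        s * q * (y * q⁻¹) *
          (k * R₁ - a / T * (k * R₂) + a / z * (b / w) * z * w ^ 2 / U * (k * R₃))) /
        (1 - s) := by
  rw [show s * q * (y * q⁻¹) = s * y by field_simp,
    show a / z * (b / w) * z * w ^ 2 = a * b * w by field_simp]
  linear_combination k * h₁ - k * a * h₂ + k * a * b * h₃

end Field

lemma qPochZ_succ (a b : F) (n : ℤ) (h : 0 ≤ n ∨ 1 - a * b ^ n ≠ 0) :
    qPochZ a b (n + 1) = qPochZ a b n * (1 - a * b ^ n) := by
  by_cases hn : 0 ≤ n
  · lift n to ℕ using hn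
    have h1 : (0 : ℤ) ≤ (n : ℤ) + 1 := by positivity
    have h2 : ((n : ℤ) + 1).toNat = n + 1 := by omega
    simp [qPochZ, h1, h2, Finset.prod_range_succ]
  · have hne := h.resolve_left hn
    obtain ⟨k, rfl⟩ : ∃ k : ℕ, n = -(k : ℤ) - 1 := ⟨(-n - 1).toNat, by omega⟩
    have hk : qPochZ a b (-(k : ℤ) - 1) =
        (∏ j ∈ Finset.range (k + 1), (1 - a * b ^ (-(j : ℤ) - 1)))⁻¹ := by
      rw [qPochZ, if_neg hn]
      congr 3
      omega
    have hk' : qPochZ a b (-(k : ℤ) - 1 + 1) =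
        (∏ j ∈ Finset.range k, (1 - a * b ^ (-(j : ℤ) - 1)))⁻¹ := by
      rcases k with _ | k
      · simp [qPochZ]
      · have h1 : ¬ (0 : ℤ) ≤ -((k + 1 : ℕ) : ℤ) - 1 + 1 := by omega
        rw [qPochZ, if_neg h1]
        congr 3
    rw [hk, hk', Finset.prod_range_succ, mul_inv, mul_assoc, inv_mul_cancel₀ hne, mul_one]

lemma qPochZ_zero (a b : F) : qPochZ a b 0 = 1 := by simp [qPochZ]

lemma qPochZ_mul_base (a b : F) (hb : b ≠ 0) (h : ∀ k : ℤ, 1 - a * b ^ k ≠ 0) (n : ℤ) :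
    qPochZ (a * b) b n = qPochZ a b (n + 1) / (1 - a) := by
  have h0 : 1 - a ≠ 0 := by simpa using h 0
  have h' (k : ℤ) : 1 - a * b * b ^ k ≠ 0 := by
    have := h (k + 1)
    rwa [zpow_add_one₀ hb, mul_comm (b ^ k), ← mul_assoc] at this
  have step (k : ℤ) : 1 - a * b * b ^ k = 1 - a * b ^ (k + 1) := by
    rw [zpow_add_one₀ hb]; ring
  induction n using Int.induction_on with
  | zero => rw [qPochZ_succ a b 0 (.inl le_rfl)]; simp [qPochZ_zero, h0]
  | succ k ih =>
    rw [qPochZ_succ (a * b) b k (.inr (h' _)), ih,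
      qPochZ_succ a b (k + 1) (.inr (h _)), step]
    ring
  | pred k ih =>
    have h1 := qPochZ_succ (a * b) b (-k - 1) (.inr (h' _))
    have h2 := qPochZ_succ a b (-k - 1 + 1) (.inr (h _))
    rw [step] at h1
    rw [sub_add_cancel] at h1 h2
    rw [ih, h2, div_eq_iff h0] at h1
    rw [sub_add_cancel, eq_div_iff h0]
    exact mul_right_cancel₀ (b := 1 - a * b ^ (-k : ℤ)) (h _) (by linear_combination -h1)

lemma q_ne_zero : q ≠ 0 := by
  simp [q, MvPolynomial.X_ne_zero]

lemma z_ne_zero : z ≠ 0 := by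
  simp [z, MvPolynomial.X_ne_zero]

lemma w_ne_zero : w ≠ 0 := by
  simp [w, MvPolynomial.X_ne_zero]

lemma u_ne_zero : u ≠ 0 := by
  simp [u, MvPolynomial.X_ne_zero]

/-- A polynomial whose value at some point with `q = 1` differs from `1` is, as an element
of `F`, not an integral power of `q`. -/
lemma one_sub_algebraMap_mul_q_zpow_ne_zero (p : MvPolynomial (Fin 5) ℚ) (x : Fin 5 → ℚ)
    (hx : x 4 = 1) (hp : MvPolynomial.eval x p ≠ 1) (k : ℤ) :
    1 - algebraMap _ F p * q ^ k ≠ 0 := by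
  have key (r s : MvPolynomial (Fin 5) ℚ) (h : algebraMap _ F r = algebraMap _ F s) :
      MvPolynomial.eval x r = MvPolynomial.eval x s := by
    rw [IsFractionRing.injective (MvPolynomial (Fin 5) ℚ) F h]
  intro h
  rw [sub_eq_zero] at h
  obtain ⟨n, rfl | rfl⟩ := k.eq_nat_or_neg
  · have := key 1 (p * MvPolynomial.X 4 ^ n) (by simpa [q] using h)
    simp [hx] at this
    exact hp this.symm
  · rw [zpow_neg, zpow_natCast, ← div_eq_mul_inv, eq_comm,
      div_eq_iff (pow_ne_zero _ q_ne_zero), one_mul] at h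
    have := key p (MvPolynomial.X 4 ^ n) (by simpa [q] using h)
    simp [hx] at this
    exact hp this

lemma one_sub_z_mul_ne_zero (k : ℤ) : 1 - z * q ^ k ≠ 0 :=
  one_sub_algebraMap_mul_q_zpow_ne_zero (.X 2) ![1, 1, 2, 2, 1] (by simp) (by simp) k

lemma one_sub_w_mul_ne_zero (k : ℤ) : 1 - w * q ^ k ≠ 0 :=
  one_sub_algebraMap_mul_q_zpow_ne_zero (.X 3) ![1, 1, 2, 2, 1] (by simp) (by simp) k

lemma one_sub_zw_mul_ne_zero (k : ℤ) : 1 - z * w * q ^ k ≠ 0 := by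
  have := one_sub_algebraMap_mul_q_zpow_ne_zero (.X 2 * .X 3) ![1, 1, 2, 2, 1] (by simp)
    (by simp; norm_num) k
  rwa [map_mul] at this

lemma one_sub_zwdq_mul_ne_zero (k : ℤ) : 1 - z * w / q * q ^ k ≠ 0 := by
  have := one_sub_zw_mul_ne_zero (k - 1)
  rwa [zpow_sub_one₀ q_ne_zero, mul_comm (q ^ k), ← mul_assoc, ← div_eq_mul_inv] at this

lemma qPochZ_q_neg (n : ℤ) (hn : n < 0) : qPochZ q q n = 0 := by
  rw [qPochZ, if_neg (by omega), inv_eq_zero]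
  refine Finset.prod_eq_zero (i := 0) (by simp; omega) ?_
  simp [q_ne_zero]

lemma one_sub_q_pow_ne_zero (n : ℕ) (hn : n ≠ 0) : 1 - q ^ n ≠ 0 := by
  intro h
  have h1 : (1 : MvPolynomial (Fin 5) ℚ) = MvPolynomial.X 4 ^ n :=
    IsFractionRing.injective (MvPolynomial (Fin 5) ℚ) F
      (by simpa [q] using sub_eq_zero.mp h)
  have h2 := congrArg (MvPolynomial.eval fun _ => (2 : ℚ)) h1
  simp only [map_one, map_pow, MvPolynomial.eval_X] at h2
  exact (one_lt_pow₀ (one_lt_two : (1 : ℚ) < 2) hn).ne h2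

lemma inv_qPochZ_q_sub_one (n : ℤ) :
    (qPochZ q q (n - 1))⁻¹ = (1 - q ^ n) * (qPochZ q q n)⁻¹ := by
  rcases le_or_gt n 0 with hn | hn
  · rw [qPochZ_q_neg (n - 1) (by omega)]
    rcases hn.eq_or_lt with rfl | hn
    · simp
    · simp [qPochZ_q_neg n hn]
  · have h0 : 1 - q ^ n ≠ 0 := by
      lift n to ℕ using hn.le
      exact_mod_cast one_sub_q_pow_ne_zero n (by omega)
    have h1 := qPochZ_succ q q (n - 1) (.inl (by omega))
    rw [zpow_sub_one₀ q_ne_zero, mul_comm (q ^ n), mul_inv_cancel_left₀ q_ne_zero,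
      sub_add_cancel] at h1
    rw [h1, mul_inv, mul_comm (qPochZ q q (n - 1))⁻¹, mul_inv_cancel_left₀ h0]

lemma inv_qPochZ_q_sub_two (n : ℤ) :
    (qPochZ q q (n - 2))⁻¹ = (1 - q ^ n / q) * (1 - q ^ n) * (qPochZ q q n)⁻¹ := by
  rw [show n - 2 = n - 1 - 1 by ring, inv_qPochZ_q_sub_one, inv_qPochZ_q_sub_one,
    zpow_sub_one₀ q_ne_zero]
  ring

section Shift

variable (a : F) (h : ∀ k : ℤ, 1 - a * q ^ k ≠ 0) (n : ℤ)
include h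

lemma qPochZ_add_one : qPochZ a q (n + 1) = qPochZ a q n * (1 - a * q ^ n) :=
  qPochZ_succ a q n (.inr (h n))

lemma qPochZ_add_two :
    qPochZ a q (n + 2) = qPochZ a q n * (1 - a * q ^ n) * (1 - a * q ^ n * q) := by
  rw [show n + 2 = n + 1 + 1 by ring, qPochZ_add_one a h, qPochZ_add_one a h,
    zpow_add_one₀ q_ne_zero, mul_assoc a]

lemma qPochZ_sub_one : qPochZ a q (n - 1) = qPochZ a q n / (1 - a * q ^ n / q) := by
  have h1 := h (n - 1)
  have h2 := qPochZ_add_one a h (n - 1)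
  rw [zpow_sub_one₀ q_ne_zero, ← mul_assoc, ← div_eq_mul_inv] at h1 h2
  rw [eq_div_iff h1, ← h2, sub_add_cancel]

lemma one_sub_mul_q_mul_zpow_ne_zero (k : ℤ) : 1 - a * q * q ^ k ≠ 0 := by
  have := h (k + 1)
  rwa [zpow_add_one₀ q_ne_zero, mul_comm (q ^ k), ← mul_assoc] at this

lemma qPochZ_mul_q : qPochZ (a * q) q n = qPochZ a q (n + 1) / (1 - a) :=
  qPochZ_mul_base a q q_ne_zero h n

lemma qPochZ_mul_q_sq :
    qPochZ (a * q ^ 2) q n = qPochZ a q (n + 2) / ((1 - a) * (1 - a * q)) := by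
  rw [pow_two, ← mul_assoc, qPochZ_mul_q (a * q) (one_sub_mul_q_mul_zpow_ne_zero a h),
    qPochZ_mul_q a h, div_div, add_assoc]
  norm_num

lemma qPochZ_mul_q_cube :
    qPochZ (a * q ^ 3) q n =
      qPochZ a q (n + 3) / ((1 - a) * (1 - a * q) * (1 - a * q ^ 2)) := by
  have h' := one_sub_mul_q_mul_zpow_ne_zero a h
  rw [show a * q ^ 3 = a * q * q ^ 2 by ring, qPochZ_mul_q_sq (a * q) h', qPochZ_mul_q a h,
    div_div, add_assoc]
  norm_num
  congr 1
  ring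

end Shift

/-- The common factor of all terms of the four-parameter `Φ`. -/
def kernel (n m : ℤ) : F :=
  qPochZ (z * w / q) q (n + m) * (qPochZ q q n)⁻¹ * (qPochZ q q m)⁻¹ * (qPochZ z q n)⁻¹ *
    (qPochZ w q m)⁻¹ * (qPochZ (z * w / q) q n)⁻¹ * (qPochZ (z * w / q) q m)⁻¹

lemma Phiy_eq (n m : ℤ) (y : Fin 3 → ℤ) :
    Phiy n m y (z / q) (w / q) q = qPochZ (z * w / q) q (n + m) *
      ((qPochZ q q (n - y 0))⁻¹ * (qPochZ z q (n - y 1))⁻¹ *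
      (qPochZ (z * w / q) q (n - y 2))⁻¹ * (qPochZ q q (m + y 2))⁻¹ *
      (qPochZ w q (m + y 1))⁻¹ * (qPochZ (z * w / q) q (m + y 0))⁻¹) := by
  have hq := q_ne_zero
  rw [Phiy, div_mul_cancel₀ _ hq, div_mul_cancel₀ _ hq,
    show z / q * (w / q) * q = z * w / q by field_simp]
  simp only [div_eq_mul_inv, mul_inv]

lemma Phi4_eq (n m : ℤ) :
    Phi4 n m u v 1 1 z w q =
      Phiy n m ![0, 0, 0] (z / q) (w / q) q
      - w * Phiy n m ![0, 1, -1] (z / q) (w / q) q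
      - u * (z * Phiy n m ![1, -1, 0] (z / q) (w / q) q
        - z ^ 2 * w * Phiy n m ![2, -1, -1] (z / q) (w / q) q)
      + u * v * (z * w ^ 2 * Phiy n m ![1, 1, -2] (z / q) (w / q) q
        - z ^ 2 * w ^ 2 * Phiy n m ![2, 0, -2] (z / q) (w / q) q) := by
  have hu := u_ne_zero
  have huniv : (Finset.univ : Finset (Equiv.Perm (Fin 3))) =
      {1, Equiv.swap 0 1, Equiv.swap 1 2, Equiv.swap 0 1 * Equiv.swap 1 2,
        Equiv.swap 1 2 * Equiv.swap 0 1, Equiv.swap 0 2} := by decide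
  have hy (σ : Equiv.Perm (Fin 3)) (y : Fin 3 → ℤ)
      (h : ∀ i, ((σ i : ℕ) : ℤ) - ((i : ℕ) : ℤ) = y i) :
      (fun i => ((σ i : ℕ) : ℤ) - ((i : ℕ) : ℤ)) = y := funext h
  rw [Phi4, huniv, Finset.sum_insert (by decide), Finset.sum_insert (by decide),
    Finset.sum_insert (by decide), Finset.sum_insert (by decide),
    Finset.sum_insert (by decide), Finset.sum_singleton,
    hy 1 ![0, 0, 0] (by decide), hy (Equiv.swap 0 1) ![1, -1, 0] (by decide),
    hy (Equiv.swap 1 2) ![0, 1, -1] (by decide),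
    hy (Equiv.swap 0 1 * Equiv.swap 1 2) ![1, 1, -2] (by decide),
    hy (Equiv.swap 1 2 * Equiv.swap 0 1) ![2, -1, -1] (by decide),
    hy (Equiv.swap 0 2) ![2, 0, -2] (by decide)]
  have e1 : (Equiv.swap 0 1 : Equiv.Perm (Fin 3)) 2 = 2 := by decide
  have e2 : (Equiv.swap 1 2 : Equiv.Perm (Fin 3)) 0 = 0 := by decide
  simp [e1, e2]
  field_simp
  ring

lemma zpow_add_eq_mul (n m : ℤ) : q ^ (n + m) = q ^ n * q ^ m := zpow_add₀ q_ne_zero n m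

lemma qPochZ_two (a b : F) : qPochZ a b 2 = (1 - a) * (1 - a * b) := by
  simp [qPochZ, Finset.prod_range_succ]

lemma Phiy_zero (n m : ℤ) : Phiy n m ![0, 0, 0] (z / q) (w / q) q = kernel n m := by
  rw [Phiy_eq, kernel]
  simp only [Matrix.cons_val, sub_zero, add_zero]
  ring

lemma Phiy_swap_one_two (n m : ℤ) :
    Phiy n m ![0, 1, -1] (z / q) (w / q) q = kernel n m *
      ((1 - z * q ^ n / q) * (1 - q ^ m) /
        ((1 - z * w / q * q ^ n) * (1 - w * q ^ m))) := by
  rw [Phiy_eq, kernel]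
  simp only [Matrix.cons_val, sub_zero, add_zero, sub_neg_eq_add, ← sub_eq_add_neg,
    inv_qPochZ_q_sub_one, qPochZ_sub_one z one_sub_z_mul_ne_zero,
    qPochZ_add_one _ one_sub_zwdq_mul_ne_zero, qPochZ_add_one w one_sub_w_mul_ne_zero,
    div_eq_mul_inv _ (_ * _), mul_inv, inv_div]
  ring

lemma Phiy_swap_zero_one (n m : ℤ) :
    Phiy n m ![1, -1, 0] (z / q) (w / q) q = kernel n m *
      ((1 - q ^ n) * (1 - w * q ^ m / q) /
        ((1 - z * q ^ n) * (1 - z * w / q * q ^ m))) := by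
  rw [Phiy_eq, kernel]
  simp only [Matrix.cons_val, sub_zero, add_zero, sub_neg_eq_add, ← sub_eq_add_neg,
    inv_qPochZ_q_sub_one, qPochZ_sub_one w one_sub_w_mul_ne_zero,
    qPochZ_add_one _ one_sub_zwdq_mul_ne_zero, qPochZ_add_one z one_sub_z_mul_ne_zero,
    div_eq_mul_inv _ (_ * _), mul_inv, inv_div]
  ring

lemma Phiy_cycle_two (n m : ℤ) :
    Phiy n m ![2, -1, -1] (z / q) (w / q) q = kernel n m *
      ((1 - q ^ n / q) * (1 - q ^ n) * (1 - q ^ m) * (1 - w * q ^ m / q) /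
        ((1 - z * q ^ n) * (1 - z * w / q * q ^ n) *
          ((1 - z * w / q * q ^ m) * (1 - z * w / q * q ^ m * q)))) := by
  rw [Phiy_eq, kernel]
  simp only [Matrix.cons_val, sub_neg_eq_add, ← sub_eq_add_neg,
    inv_qPochZ_q_sub_one, inv_qPochZ_q_sub_two, qPochZ_sub_one w one_sub_w_mul_ne_zero,
    qPochZ_add_one _ one_sub_zwdq_mul_ne_zero, qPochZ_add_one z one_sub_z_mul_ne_zero,
    qPochZ_add_two _ one_sub_zwdq_mul_ne_zero,
    div_eq_mul_inv _ (_ * _), mul_inv, inv_div]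
  ring

lemma Phiy_cycle_one (n m : ℤ) :
    Phiy n m ![1, 1, -2] (z / q) (w / q) q = kernel n m *
      ((1 - q ^ n) * (1 - z * q ^ n / q) * (1 - q ^ m / q) * (1 - q ^ m) /
        ((1 - z * w / q * q ^ n) * (1 - z * w / q * q ^ n * q) *
          ((1 - w * q ^ m) * (1 - z * w / q * q ^ m)))) := by
  rw [Phiy_eq, kernel]
  simp only [Matrix.cons_val, sub_neg_eq_add, ← sub_eq_add_neg,
    inv_qPochZ_q_sub_one, inv_qPochZ_q_sub_two, qPochZ_sub_one z one_sub_z_mul_ne_zero,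
    qPochZ_add_one _ one_sub_zwdq_mul_ne_zero, qPochZ_add_one w one_sub_w_mul_ne_zero,
    qPochZ_add_two _ one_sub_zwdq_mul_ne_zero,
    div_eq_mul_inv _ (_ * _), mul_inv, inv_div]
  ring

lemma Phiy_swap_zero_two (n m : ℤ) :
    Phiy n m ![2, 0, -2] (z / q) (w / q) q = kernel n m *
      ((1 - q ^ n / q) * (1 - q ^ n) * (1 - q ^ m / q) * (1 - q ^ m) /
        ((1 - z * w / q * q ^ n) * (1 - z * w / q * q ^ n * q) *
          ((1 - z * w / q * q ^ m) * (1 - z * w / q * q ^ m * q)))) := by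
  rw [Phiy_eq, kernel]
  simp only [Matrix.cons_val, sub_zero, add_zero, sub_neg_eq_add, ← sub_eq_add_neg,
    inv_qPochZ_q_sub_two, qPochZ_add_two _ one_sub_zwdq_mul_ne_zero,
    div_eq_mul_inv _ (_ * _), mul_inv]
  ring

lemma one_sub_zwdq_ne_zero : 1 - z * w / q ≠ 0 := by
  simpa using one_sub_zwdq_mul_ne_zero 0

lemma one_sub_zwdq_mul_q_ne_zero : 1 - z * w / q * q ≠ 0 := by
  simpa using one_sub_zwdq_mul_ne_zero 1

lemma one_sub_zwdq_mul_q_sq_ne_zero : 1 - z * w / q * q ^ 2 ≠ 0 :=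
  one_sub_zwdq_mul_ne_zero 2

lemma Phi_z_div_q (n m : ℤ) :
    Phi n m (z / q) w q = kernel n m *
      ((1 - z * w / q * (q ^ n * q ^ m)) * (1 - z * w / q) * (1 - w) /
        ((1 - z * w / q * q ^ n) * (1 - w * q ^ m) * (1 - z * w / q * q ^ m))) := by
  have hq := q_ne_zero
  have h0 := one_sub_zwdq_ne_zero
  rw [Phi, div_mul_cancel₀ _ hq, show z / q * w * q = z * w / q * q by ring, kernel]
  simp only [qPochZ_mul_q _ one_sub_zwdq_mul_ne_zero, qPochZ_mul_q w one_sub_w_mul_ne_zero,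
    qPochZ_add_one _ one_sub_zwdq_mul_ne_zero, qPochZ_add_one w one_sub_w_mul_ne_zero,
    zpow_add_eq_mul]
  generalize z * w / q = s at *
  simp only [div_eq_mul_inv, mul_inv, inv_inv]
  refine Eq.trans ?_ (mul_inv_cancel_right₀ h0 _)
  ring

lemma Phi_z_mul_q (n m : ℤ) :
    Phi (n - 1) m (z * q) (w / q) q = kernel n m *
      ((1 - z * w / q * (q ^ n * q ^ m)) * (1 - q ^ n) *
        ((1 - z) * (1 - z * q)) * ((1 - z * w / q) * (1 - z * w / q * q)) /
        ((1 - z * q ^ n) * (1 - z * w / q * q ^ n) *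
          ((1 - z * w / q * q ^ m) * (1 - z * w / q * q ^ m * q)))) := by
  have hq := q_ne_zero
  have h0 := one_sub_zwdq_ne_zero
  have h1 := one_sub_zwdq_mul_q_ne_zero
  rw [Phi, div_mul_cancel₀ _ hq,
    show z * q * (w / q) * q = z * w / q * q ^ 2 by field_simp,
    show z * q * q = z * q ^ 2 by ring, kernel]
  simp only [qPochZ_mul_q_sq _ one_sub_zwdq_mul_ne_zero, qPochZ_mul_q_sq z one_sub_z_mul_ne_zero,
    show n - 1 + m + 2 = n + m + 1 by ring, show n - 1 + 2 = n + 1 by ring,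
    qPochZ_add_one _ one_sub_zwdq_mul_ne_zero, qPochZ_add_one z one_sub_z_mul_ne_zero,
    qPochZ_add_two _ one_sub_zwdq_mul_ne_zero, zpow_add_eq_mul]
  rw [div_eq_mul_inv _ (_ * _ * _)]
  simp only [mul_inv, inv_qPochZ_q_sub_one]
  generalize z * w / q = s at *
  simp only [div_eq_mul_inv, mul_inv, inv_inv]
  generalize 1 - s = c, 1 - s * q = d at *
  refine Eq.trans ?_ (mul_inv_cancel_right₀ (mul_ne_zero h0 h1) _)
  ring

lemma Phi_w_mul_q (n m : ℤ) :
    Phi (n - 1) (m - 1) z (w * q) q = kernel n m *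
      ((1 - z * w / q * (q ^ n * q ^ m)) * (1 - q ^ n) * (1 - q ^ m) *
        (1 - z) * ((1 - w) * (1 - w * q)) *
        ((1 - z * w / q) * (1 - z * w / q * q) * (1 - z * w / q * q ^ 2)) /
        ((1 - w * q ^ m) * ((1 - z * w / q * q ^ n) * (1 - z * w / q * q ^ n * q)) *
          ((1 - z * w / q * q ^ m) * (1 - z * w / q * q ^ m * q)))) := by
  have hq := q_ne_zero
  have h0 := one_sub_zwdq_ne_zero
  have h1 := one_sub_zwdq_mul_q_ne_zero
  have h2 := one_sub_zwdq_mul_q_sq_ne_zero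
  rw [Phi, show z * (w * q) * q = z * w / q * q ^ 3 by field_simp,
    show w * q * q = w * q ^ 2 by ring, kernel]
  simp only [qPochZ_mul_q_cube _ one_sub_zwdq_mul_ne_zero,
    qPochZ_mul_q_sq w one_sub_w_mul_ne_zero, qPochZ_mul_q z one_sub_z_mul_ne_zero,
    show n - 1 + (m - 1) + 3 = n + m + 1 by ring, show n - 1 + 3 = n + 2 by ring,
    show m - 1 + 3 = m + 2 by ring, show m - 1 + 2 = m + 1 by ring, sub_add_cancel,
    qPochZ_add_one _ one_sub_zwdq_mul_ne_zero, qPochZ_add_one w one_sub_w_mul_ne_zero,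
    qPochZ_add_two _ one_sub_zwdq_mul_ne_zero, zpow_add_eq_mul]
  rw [div_eq_mul_inv _ (_ * _ * _)]
  simp only [mul_inv, inv_qPochZ_q_sub_one]
  generalize z * w / q = s at *
  simp only [div_eq_mul_inv, mul_inv, inv_inv]
  generalize 1 - s = c, 1 - s * q = d, 1 - s * q ^ 2 = e at *
  refine Eq.trans ?_ (mul_inv_cancel_right₀ (mul_ne_zero (mul_ne_zero h0 h1) h2) _)
  ring

/-- The case `c = d = 1` of the four-parameter `Φ` (Lemma 4.8 of the paper), as an
identity of rational functions in `u, v, z, w, q`, valid for all integers `n, m`. -/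
theorem Phi4_cd_one (n m : ℤ) :
    Phi4 n m u v 1 1 z w q =
      (PhiUV n m u v z w q - z * w * q ^ (m - 1) * PhiUV n m (u / z) (v / w) z w q) /
        (1 - z * w * q⁻¹) := by
  have hz := z_ne_zero
  have hw := w_ne_zero
  have hq := q_ne_zero
  have z0 : 1 - z ≠ 0 := by simpa using one_sub_z_mul_ne_zero 0
  have z1 : 1 - z * q ≠ 0 := by simpa using one_sub_z_mul_ne_zero 1
  have w0 : 1 - w ≠ 0 := by simpa using one_sub_w_mul_ne_zero 0
  have w1 : 1 - w * q ≠ 0 := by simpa using one_sub_w_mul_ne_zero 1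
  have s0 := one_sub_zwdq_ne_zero
  have s1 := one_sub_zwdq_mul_q_ne_zero
  have s2 := one_sub_zwdq_mul_q_sq_ne_zero
  have zn := one_sub_z_mul_ne_zero n
  have wm := one_sub_w_mul_ne_zero m
  have sn := one_sub_zwdq_mul_ne_zero n
  have sm := one_sub_zwdq_mul_ne_zero m
  have sn' := one_sub_zwdq_mul_ne_zero (n + 1)
  have sm' := one_sub_zwdq_mul_ne_zero (m + 1)
  rw [zpow_add_one₀ hq, ← mul_assoc] at sn' sm'
  rw [Phi4_eq, Phiy_zero, Phiy_swap_one_two, Phiy_swap_zero_one, Phiy_cycle_two,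
    Phiy_cycle_one, Phiy_swap_zero_two, PhiUV, PhiUV, Phi_z_div_q, Phi_z_mul_q, Phi_w_mul_q,
    qPochZ_two, qPochZ_two, qPochZ_two, zpow_sub_one₀ hq, div_mul_cancel₀ _ hz,
    ← div_eq_mul_inv (z * w)]
  generalize kernel n m = k, q ^ n = x, q ^ m = y, u = a, v = b at *
  have hzw : z * w = z * w / q * q := (div_mul_cancel₀ _ hq).symm
  generalize z * w / q = s at *
  rw [hzw]
  exact combine_coeffs hz hw hq (coeff_one hq hzw s0 wm sn sm)
    (coeff_u hq hzw z0 z1 s0 s1 zn sn sm sm')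
    (coeff_uv hq hzw w0 w1 s0 s1 s2 wm sn sn' sm sm')

end Stmt15
end
end

section
/- Theorem (A₂ Bailey tree, part II). For all nonnegative integers n, m, Σ_{r=0}^n Σ_{s=0}^m 𝒦_{n,m;r,s}(z/q, w/q; q) Φ_{r,s}(u,v;c,d;z,w;q) = Φ_{n,m}(uz, vw; cz, dw; z, w; q), as an identity of rational functions in u, v, c, d, z, w, q over ℚ. -/
noncomputable section

namespace Stmt16

/-- The field `ℚ(u, v, c, d, z, w, q)` of rational functions in seven variables. -/
abbrev F : Type := FractionRing (MvPolynomial (Fin 7) ℚ)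

/-- The variable `u`. -/
def u : F := algebraMap (MvPolynomial (Fin 7) ℚ) F (MvPolynomial.X 0)

/-- The variable `v`. -/
def v : F := algebraMap (MvPolynomial (Fin 7) ℚ) F (MvPolynomial.X 1)

/-- The variable `c`. -/
def c : F := algebraMap (MvPolynomial (Fin 7) ℚ) F (MvPolynomial.X 2)

/-- The variable `d`. -/
def d : F := algebraMap (MvPolynomial (Fin 7) ℚ) F (MvPolynomial.X 3)

/-- The variable `z`. -/
def z : F := algebraMap (MvPolynomial (Fin 7) ℚ) F (MvPolynomial.X 4)

/-- The variable `w`. -/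
def w : F := algebraMap (MvPolynomial (Fin 7) ℚ) F (MvPolynomial.X 5)

/-- The variable `q`. -/
def q : F := algebraMap (MvPolynomial (Fin 7) ℚ) F (MvPolynomial.X 6)

/-- `(a;b)_n` for `n : ℤ`:  the usual finite product for `n ≥ 0`, and
`(a;b)_{-m} = 1/∏_{j=1}^m (1 - a b^{-j})` for `n = -m < 0`. -/
def qPochZ (a b : F) (n : ℤ) : F :=
  if 0 ≤ n then ∏ j ∈ Finset.range n.toNat, (1 - a * b ^ j)
  else (∏ j ∈ Finset.range (-n).toNat, (1 - a * b ^ (-(j : ℤ) - 1)))⁻¹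

/-- `Φ_{n,m;y}(z,w;q)` for `y = (y₁,y₂,y₃) ∈ ℤ³` with `y₁+y₂+y₃ = 0`. -/
def Phiy (n m : ℤ) (y : Fin 3 → ℤ) (zz ww qq : F) : F :=
  qPochZ (zz * ww * qq) qq (n + m) /
    (qPochZ qq qq (n - y 0) * qPochZ (zz * qq) qq (n - y 1) *
      qPochZ (zz * ww * qq) qq (n - y 2) * qPochZ qq qq (m + y 2) *
      qPochZ (ww * qq) qq (m + y 1) * qPochZ (zz * ww * qq) qq (m + y 0))

/-- The four-parameter function `Φ_{n,m}(u,v;c,d;z,w;q)`, a signed sum over `S₃`. -/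
def Phi4 (n m : ℤ) (uu vv cc dd zz ww qq : F) : F :=
  ∑ σ : Equiv.Perm (Fin 3),
    ((Equiv.Perm.sign σ : ℤ) : F) * (uu * zz) ^ ((σ 0 : Fin 3) : ℕ) *
      (if σ 2 = 0 then vv / dd else 1) * (if σ 0 = 2 then cc / uu else 1) *
      (dd * ww) ^ (2 - ((σ 2 : Fin 3) : ℕ)) *
      Phiy n m (fun i => ((σ i : ℕ) : ℤ) - ((i : ℕ) : ℤ)) (zz / qq) (ww / qq) qq

/-- `𝒦_{n,m;r,s}(z,w;q) = z^r w^s q^{r²-rs+s²}/((q;q)_{n-r}(q;q)_{m-s})`. -/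
def Kker (n m r s : ℕ) (zz ww qq : F) : F :=
  zz ^ r * ww ^ s * qq ^ (r ^ 2 + s ^ 2 - r * s) /
    (qPochZ qq qq (n - r : ℕ) * qPochZ qq qq (m - s : ℕ))

/-! ### Shifted factorials with integer index -/

lemma qPochZ_natCast (a b : F) (n : ℕ) :
    qPochZ a b n = ∏ j ∈ Finset.range n, (1 - a * b ^ j) := by
  simp [qPochZ]

lemma qPochZ_zero (a b : F) : qPochZ a b 0 = 1 := by
  simp [qPochZ]

lemma qPochZ_neg_natCast (a b : F) (n : ℕ) :
    qPochZ a b (-n) = (∏ j ∈ Finset.range n, (1 - a * b ^ (-(j : ℤ) - 1)))⁻¹ := by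
  rcases Nat.eq_zero_or_pos n with rfl | hn
  · simp [qPochZ]
  · have h : ¬ (0 : ℤ) ≤ -n := by omega
    rw [qPochZ, if_neg h, neg_neg, Int.toNat_natCast]

lemma qPochZ_add_one {a b : F} (ha : ∀ i : ℤ, a * b ^ i ≠ 1) (n : ℤ) :
    qPochZ a b (n + 1) = qPochZ a b n * (1 - a * b ^ n) := by
  obtain ⟨k, rfl⟩ | ⟨k, rfl⟩ : (∃ k : ℕ, n = k) ∨ ∃ k : ℕ, n = -((k + 1 : ℕ) : ℤ) := by
    rcases le_or_gt 0 n with h | h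
    · exact Or.inl ⟨n.toNat, by omega⟩
    · exact Or.inr ⟨(-n - 1).toNat, by omega⟩
  · rw [← Nat.cast_succ, qPochZ_natCast, qPochZ_natCast, Finset.prod_range_succ, zpow_natCast]
  · have e : -((k + 1 : ℕ) : ℤ) + 1 = -(k : ℤ) := by push_cast; ring
    have e' : -((k + 1 : ℕ) : ℤ) = -(k : ℤ) - 1 := by push_cast; ring
    rw [e, qPochZ_neg_natCast, qPochZ_neg_natCast, Finset.prod_range_succ, e', mul_inv, mul_assoc,
      inv_mul_cancel₀ (sub_ne_zero.2 (ha _).symm), mul_one]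

lemma qPochZ_ne_zero {a b : F} (ha : ∀ i : ℤ, a * b ^ i ≠ 1) (n : ℤ) : qPochZ a b n ≠ 0 := by
  unfold qPochZ
  split_ifs
  · refine Finset.prod_ne_zero_iff.2 fun j _ => sub_ne_zero.2 ?_
    simpa using (ha j).symm
  · exact inv_ne_zero (Finset.prod_ne_zero_iff.2 fun j _ => sub_ne_zero.2 (ha _).symm)

lemma shift_ne_one {a b : F} (hb : b ≠ 0) (ha : ∀ i : ℤ, a * b ^ i ≠ 1) (k i : ℤ) :
    a * b ^ k * b ^ i ≠ 1 := by
  rw [mul_assoc, ← zpow_add₀ hb]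
  exact ha _

lemma qPochZ_add {a b : F} (hb : b ≠ 0) (ha : ∀ i : ℤ, a * b ^ i ≠ 1) (k n : ℤ) :
    qPochZ a b (k + n) = qPochZ a b k * qPochZ (a * b ^ k) b n := by
  have step : ∀ n : ℤ, qPochZ a b (k + n) = qPochZ a b k * qPochZ (a * b ^ k) b n ↔
      qPochZ a b (k + (n + 1)) = qPochZ a b k * qPochZ (a * b ^ k) b (n + 1) := by
    intro n
    have h : 1 - a * b ^ (k + n) ≠ 0 := sub_ne_zero.2 (ha _).symm
    rw [← add_assoc, qPochZ_add_one ha, qPochZ_add_one (shift_ne_one hb ha k), mul_assoc a,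
      ← zpow_add₀ hb, ← mul_assoc, mul_left_inj' h]
  induction n with
  | zero => simp [qPochZ_zero]
  | succ i ih => exact (step _).1 ih
  | pred i ih => exact (step _).2 (by rwa [sub_add_cancel])

lemma qPochZ_mul_base {a b : F} (hb : b ≠ 0) (ha : ∀ i : ℤ, a * b ^ i ≠ 1) (n : ℤ) :
    qPochZ (a * b) b n = qPochZ a b (n + 1) / (1 - a) := by
  have ha1 : 1 - a ≠ 0 := sub_ne_zero.2 (by simpa using (ha 0).symm)
  have h := qPochZ_add hb ha 1 n
  have h1 := qPochZ_add_one ha 0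
  simp only [zero_add, qPochZ_zero, zpow_zero, one_mul, mul_one, zpow_one] at h h1
  rw [add_comm n, h, h1, mul_div_cancel_left₀ _ ha1]

lemma qPochZ_self_of_neg {b : F} (hb : b ≠ 0) {n : ℤ} (hn : n < 0) : qPochZ b b n = 0 := by
  rw [qPochZ, if_neg (not_le.2 hn), inv_eq_zero, Finset.prod_eq_zero_iff]
  exact ⟨0, by simpa using hn, by simp [hb]⟩

lemma qPochZ_self_inv_sub_one {b : F} (hb : b ≠ 0) (hb1 : ∀ i : ℤ, 0 < i → b ^ i ≠ 1) (n : ℤ) :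
    (qPochZ b b (n - 1))⁻¹ = (1 - b ^ n) * (qPochZ b b n)⁻¹ := by
  rcases lt_trichotomy n 0 with h | rfl | h
  · simp [qPochZ_self_of_neg hb h, qPochZ_self_of_neg hb (show n - 1 < 0 by omega)]
  · simp [qPochZ_self_of_neg hb (show (-1 : ℤ) < 0 by norm_num)]
  · obtain ⟨k, rfl⟩ : ∃ k : ℕ, n = ((k + 1 : ℕ) : ℤ) := ⟨(n - 1).toNat, by omega⟩
    have e : ((k + 1 : ℕ) : ℤ) - 1 = k := by push_cast; ring
    have h1 := sub_ne_zero.2 (hb1 _ h).symm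
    rw [e, qPochZ_natCast, qPochZ_natCast, Finset.prod_range_succ, mul_inv, mul_left_comm,
      ← pow_succ', ← zpow_natCast, mul_inv_cancel₀ h1, mul_one]

/-! ### Summations of q-Chu–Vandermonde type -/

lemma sum_qVandermonde {b : F} (hb : b ≠ 0) (hb1 : ∀ i : ℤ, 0 < i → b ^ i ≠ 1) (n : ℕ) :
    ∀ (m : ℤ) {a : F}, (∀ i : ℤ, a * b ^ i ≠ 1) →
      ∑ k ∈ Finset.range (n + 1), a ^ k * b ^ (k ^ 2) * (qPochZ b b (n - k))⁻¹ *
          (qPochZ b b (m - k))⁻¹ * (qPochZ b b k)⁻¹ * (qPochZ (a * b) b k)⁻¹ =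
        qPochZ (a * b) b (n + m) * (qPochZ b b n)⁻¹ * (qPochZ b b m)⁻¹ *
          (qPochZ (a * b) b n)⁻¹ * (qPochZ (a * b) b m)⁻¹ := by
  induction n with
  | zero =>
    intro m a ha
    have h : qPochZ (a * b) b m ≠ 0 :=
      qPochZ_ne_zero (by simpa using shift_ne_one hb ha 1) m
    simp [qPochZ_zero]
    field_simp
  | succ n ih =>
    intro m a ha
    have hab : ∀ i : ℤ, a * b * b ^ i ≠ 1 := by simpa using shift_ne_one hb ha 1
    have hab1 : 1 - a * b ≠ 0 := sub_ne_zero.2 (by simpa using (hab 0).symm)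
    have hn : 1 - b ^ (n + 1) ≠ 0 :=
      sub_ne_zero.2 (mod_cast (hb1 (n + 1 : ℕ) (by positivity)).symm)
    have habn : 1 - a * b * b ^ n ≠ 0 := sub_ne_zero.2 (by simpa using (hab n).symm)
    have shift := qPochZ_mul_base hb hab
    have hrec := qPochZ_self_inv_sub_one hb hb1
    have split : ∀ k ∈ Finset.range (n + 1 + 1), (1 - b ^ (n + 1)) *
        (a ^ k * b ^ (k ^ 2) * (qPochZ b b ((n + 1 : ℕ) - k))⁻¹ *
          (qPochZ b b (m - k))⁻¹ * (qPochZ b b k)⁻¹ * (qPochZ (a * b) b k)⁻¹) =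
        a ^ k * b ^ (k ^ 2) * (qPochZ b b (n - k))⁻¹ *
          (qPochZ b b (m - k))⁻¹ * (qPochZ b b k)⁻¹ * (qPochZ (a * b) b k)⁻¹ +
        a ^ k * b ^ (k ^ 2) * b ^ ((n : ℤ) + 1 - k) * (qPochZ b b ((n + 1 : ℕ) - k))⁻¹ *
          (qPochZ b b (m - k))⁻¹ * (qPochZ b b (k - 1))⁻¹ * (qPochZ (a * b) b k)⁻¹ := by
      intro k _
      have h1 := hrec ((n + 1 : ℕ) - k)
      have e : ((n + 1 : ℕ) : ℤ) - k - 1 = n - k := by push_cast; ring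
      have e2 : ((n + 1 : ℕ) : ℤ) - k = n + 1 - k := by push_cast; ring
      have e3 : b ^ (n + 1) = b ^ ((n : ℤ) + 1 - k) * b ^ (k : ℤ) := by
        rw [← zpow_add₀ hb, sub_add_cancel]; norm_cast
      rw [e] at h1
      rw [h1, hrec k, e2, e3]
      ring
    have shifted : ∀ k ∈ Finset.range (n + 1),
        a ^ (k + 1) * b ^ ((k + 1) ^ 2) * b ^ ((n : ℤ) + 1 - (k + 1 : ℕ)) *
          (qPochZ b b ((n + 1 : ℕ) - (k + 1 : ℕ)))⁻¹ *
          (qPochZ b b (m - (k + 1 : ℕ)))⁻¹ * (qPochZ b b ((k + 1 : ℕ) - 1))⁻¹ *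
          (qPochZ (a * b) b (k + 1 : ℕ))⁻¹ =
        a * b ^ (n + 1) / (1 - a * b) * ((a * b) ^ k * b ^ (k ^ 2) * (qPochZ b b (n - k))⁻¹ *
          (qPochZ b b (m - 1 - k))⁻¹ * (qPochZ b b k)⁻¹ * (qPochZ (a * b * b) b k)⁻¹) := by
      intro k _
      have e1 : ((n + 1 : ℕ) : ℤ) - (k + 1 : ℕ) = n - k := by push_cast; ring
      have e2 : m - (k + 1 : ℕ) = m - 1 - k := by push_cast; ring
      have e3 : ((k + 1 : ℕ) : ℤ) - 1 = k := by push_cast; ring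
      have e4 : (n : ℤ) + 1 - (k + 1 : ℕ) = n - k := by push_cast; ring
      rw [e1, e2, e3, e4, shift, zpow_sub₀ hb, Nat.cast_succ]
      simp only [zpow_natCast]
      field_simp
      ring
    have ab : qPochZ (a * b) b n ≠ 0 := qPochZ_ne_zero hab _
    have ab' : qPochZ (a * b) b m ≠ 0 := qPochZ_ne_zero hab _
    apply mul_left_cancel₀ hn
    rw [Finset.mul_sum, Finset.sum_congr rfl split, Finset.sum_add_distrib, Finset.sum_range_succ,
      ih m ha, Finset.sum_range_succ', Finset.sum_congr rfl shifted, ← Finset.mul_sum,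
      ih (m - 1) hab]
    have z1 : qPochZ b b ((n : ℤ) - (n + 1 : ℕ)) = 0 := qPochZ_self_of_neg hb (by push_cast; omega)
    have z2 : qPochZ b b (((0 : ℕ) : ℤ) - 1) = 0 := qPochZ_self_of_neg hb (by norm_num)
    have r1 := hrec (n + 1 : ℕ)
    have e1 : ((n + 1 : ℕ) : ℤ) - 1 = n := by push_cast; ring
    have e2 : (n : ℤ) + (m - 1) + 1 = n + m := by ring
    have e3 : ((n + 1 : ℕ) : ℤ) + m = n + m + 1 := by push_cast; ring
    rw [e1, zpow_natCast] at r1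
    rw [z1, z2, hrec m, r1, shift, shift, shift, e2, e3, sub_add_cancel, Nat.cast_succ,
      qPochZ_add_one hab n, qPochZ_add_one hab, zpow_add₀ hb]
    simp only [zpow_natCast]
    field_simp
    ring

lemma sum_qVandermonde' {b : F} (hb : b ≠ 0) (hb1 : ∀ i : ℤ, 0 < i → b ^ i ≠ 1) (n : ℕ) :
    ∀ (m : ℤ) {a : F}, (∀ i : ℤ, a * b ^ i ≠ 1) →
      ∑ k ∈ Finset.range (n + 1), b ^ ((k : ℤ) ^ 2 - k * (n + m)) * (qPochZ b b (n - k))⁻¹ *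
          (qPochZ b b (m - k))⁻¹ * (qPochZ b b k)⁻¹ * (qPochZ (a * b) b k)⁻¹ =
        b ^ (-(n * m : ℤ)) * qPochZ (a * b) b (n + m) * (qPochZ b b n)⁻¹ * (qPochZ b b m)⁻¹ *
          (qPochZ (a * b) b n)⁻¹ * (qPochZ (a * b) b m)⁻¹ := by
  induction n with
  | zero =>
    intro m a ha
    have h : qPochZ (a * b) b m ≠ 0 :=
      qPochZ_ne_zero (by simpa using shift_ne_one hb ha 1) m
    simp [qPochZ_zero]
    field_simp
  | succ n ih =>
    intro m a ha
    have hab : ∀ i : ℤ, a * b * b ^ i ≠ 1 := by simpa using shift_ne_one hb ha 1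
    have hab1 : 1 - a * b ≠ 0 := sub_ne_zero.2 (by simpa using (hab 0).symm)
    have hn : 1 - b ^ (n + 1) ≠ 0 :=
      sub_ne_zero.2 (mod_cast (hb1 (n + 1 : ℕ) (by positivity)).symm)
    have habn : 1 - a * b * b ^ n ≠ 0 := sub_ne_zero.2 (by simpa using (hab n).symm)
    have shift := qPochZ_mul_base hb hab
    have hrec := qPochZ_self_inv_sub_one hb hb1
    have split : ∀ k ∈ Finset.range (n + 1 + 1), (1 - b ^ (n + 1)) *
        (b ^ ((k : ℤ) ^ 2 - k * ((n + 1 : ℕ) + m)) * (qPochZ b b ((n + 1 : ℕ) - k))⁻¹ *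
          (qPochZ b b (m - k))⁻¹ * (qPochZ b b k)⁻¹ * (qPochZ (a * b) b k)⁻¹) =
        b ^ ((k : ℤ) ^ 2 - k * (n + m)) * (qPochZ b b (n - k))⁻¹ *
          (qPochZ b b (m - k))⁻¹ * (qPochZ b b k)⁻¹ * (qPochZ (a * b) b k)⁻¹ +
        b ^ ((k : ℤ) ^ 2 - k * ((n + 1 : ℕ) + m)) * (qPochZ b b ((n + 1 : ℕ) - k))⁻¹ *
          (qPochZ b b (m - k))⁻¹ * (qPochZ b b (k - 1))⁻¹ * (qPochZ (a * b) b k)⁻¹ := by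
      intro k _
      have h1 := hrec ((n + 1 : ℕ) - k)
      have e : ((n + 1 : ℕ) : ℤ) - k - 1 = n - k := by push_cast; ring
      have e2 : ((n + 1 : ℕ) : ℤ) - k = n + 1 - k := by push_cast; ring
      have e3 : b ^ (n + 1) = b ^ ((n : ℤ) + 1 - k) * b ^ (k : ℤ) := by
        rw [← zpow_add₀ hb, sub_add_cancel]; norm_cast
      have e4 : (k : ℤ) ^ 2 - k * (n + m) = (k : ℤ) ^ 2 - k * ((n + 1 : ℕ) + m) + k := by
        push_cast; ring
      rw [e] at h1
      rw [h1, hrec k, e2, e3, e4, zpow_add₀ hb _ (k : ℤ)]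
      ring
    have shifted : ∀ k ∈ Finset.range (n + 1),
        b ^ (((k + 1 : ℕ) : ℤ) ^ 2 - (k + 1 : ℕ) * ((n + 1 : ℕ) + m)) *
          (qPochZ b b ((n + 1 : ℕ) - (k + 1 : ℕ)))⁻¹ *
          (qPochZ b b (m - (k + 1 : ℕ)))⁻¹ * (qPochZ b b ((k + 1 : ℕ) - 1))⁻¹ *
          (qPochZ (a * b) b (k + 1 : ℕ))⁻¹ =
        b ^ (-(n + m : ℤ)) / (1 - a * b) * (b ^ ((k : ℤ) ^ 2 - k * (n + (m - 1))) *
          (qPochZ b b (n - k))⁻¹ *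
          (qPochZ b b (m - 1 - k))⁻¹ * (qPochZ b b k)⁻¹ * (qPochZ (a * b * b) b k)⁻¹) := by
      intro k _
      have e1 : ((n + 1 : ℕ) : ℤ) - (k + 1 : ℕ) = n - k := by push_cast; ring
      have e2 : m - (k + 1 : ℕ) = m - 1 - k := by push_cast; ring
      have e3 : ((k + 1 : ℕ) : ℤ) - 1 = k := by push_cast; ring
      have e4 : ((k + 1 : ℕ) : ℤ) ^ 2 - (k + 1 : ℕ) * ((n + 1 : ℕ) + m) =
          -(n + m : ℤ) + ((k : ℤ) ^ 2 - k * (n + (m - 1))) := by push_cast; ring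
      rw [e1, e2, e3, e4, shift, zpow_add₀ hb, Nat.cast_succ]
      field_simp
    have ab : qPochZ (a * b) b n ≠ 0 := qPochZ_ne_zero hab _
    have ab' : qPochZ (a * b) b m ≠ 0 := qPochZ_ne_zero hab _
    apply mul_left_cancel₀ hn
    rw [Finset.mul_sum, Finset.sum_congr rfl split, Finset.sum_add_distrib, Finset.sum_range_succ,
      ih m ha, Finset.sum_range_succ', Finset.sum_congr rfl shifted, ← Finset.mul_sum,
      ih (m - 1) hab]
    have z1 : qPochZ b b ((n : ℤ) - (n + 1 : ℕ)) = 0 := qPochZ_self_of_neg hb (by push_cast; omega)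
    have z2 : qPochZ b b (((0 : ℕ) : ℤ) - 1) = 0 := qPochZ_self_of_neg hb (by norm_num)
    have r1 := hrec (n + 1 : ℕ)
    have e1 : ((n + 1 : ℕ) : ℤ) - 1 = n := by push_cast; ring
    have e2 : (n : ℤ) + (m - 1) + 1 = n + m := by ring
    have e3 : ((n + 1 : ℕ) : ℤ) + m = n + m + 1 := by push_cast; ring
    have e4 : b ^ (-(((n + 1 : ℕ) : ℤ) * m)) = b ^ (-(n * m : ℤ)) * (b ^ m)⁻¹ := by
      rw [← zpow_neg, ← zpow_add₀ hb]; push_cast; ring_nf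
    have e5 : b ^ (-(n + m : ℤ)) = (b ^ m)⁻¹ * (b ^ n)⁻¹ := by
      rw [← zpow_natCast, ← zpow_neg, ← zpow_neg, ← zpow_add₀ hb]; ring_nf
    have e6 : b ^ (-(n * (m - 1) : ℤ)) = b ^ (-(n * m : ℤ)) * b ^ n := by
      rw [← zpow_natCast, ← zpow_add₀ hb]; ring_nf
    rw [e1, zpow_natCast] at r1
    rw [z1, z2, hrec m, r1, shift, shift, shift, e2, e3, e4, e5, e6, sub_add_cancel, Nat.cast_succ,
      qPochZ_add_one hab n, qPochZ_add_one hab, zpow_add₀ hb]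
    have hm : b ^ m ≠ 0 := zpow_ne_zero _ hb
    generalize b ^ (-(n * m : ℤ)) = B
    simp only [zpow_natCast]
    generalize b ^ m = C at *
    field_simp
    ring

lemma sum_qVandermonde_limit {b : F} (hb : b ≠ 0) (hb1 : ∀ i : ℤ, 0 < i → b ^ i ≠ 1) (n : ℕ) :
    ∀ {a : F}, (∀ i : ℤ, a * b ^ i ≠ 1) →
      ∑ k ∈ Finset.range (n + 1), a ^ k * b ^ (k ^ 2) * (qPochZ b b (n - k))⁻¹ *
          (qPochZ b b k)⁻¹ * (qPochZ (a * b) b k)⁻¹ =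
        (qPochZ b b n)⁻¹ * (qPochZ (a * b) b n)⁻¹ := by
  induction n with
  | zero =>
    intro a ha
    simp [qPochZ_zero]
  | succ n ih =>
    intro a ha
    have hab : ∀ i : ℤ, a * b * b ^ i ≠ 1 := by simpa using shift_ne_one hb ha 1
    have hab1 : 1 - a * b ≠ 0 := sub_ne_zero.2 (by simpa using (hab 0).symm)
    have hn : 1 - b ^ (n + 1) ≠ 0 :=
      sub_ne_zero.2 (mod_cast (hb1 (n + 1 : ℕ) (by positivity)).symm)
    have habn : 1 - a * b * b ^ n ≠ 0 := sub_ne_zero.2 (by simpa using (hab n).symm)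
    have shift := qPochZ_mul_base hb hab
    have hrec := qPochZ_self_inv_sub_one hb hb1
    have split : ∀ k ∈ Finset.range (n + 1 + 1), (1 - b ^ (n + 1)) *
        (a ^ k * b ^ (k ^ 2) * (qPochZ b b ((n + 1 : ℕ) - k))⁻¹ *
          (qPochZ b b k)⁻¹ * (qPochZ (a * b) b k)⁻¹) =
        a ^ k * b ^ (k ^ 2) * (qPochZ b b (n - k))⁻¹ *
          (qPochZ b b k)⁻¹ * (qPochZ (a * b) b k)⁻¹ +
        a ^ k * b ^ (k ^ 2) * b ^ ((n : ℤ) + 1 - k) * (qPochZ b b ((n + 1 : ℕ) - k))⁻¹ *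
          (qPochZ b b (k - 1))⁻¹ * (qPochZ (a * b) b k)⁻¹ := by
      intro k _
      have h1 := hrec ((n + 1 : ℕ) - k)
      have e : ((n + 1 : ℕ) : ℤ) - k - 1 = n - k := by push_cast; ring
      have e2 : ((n + 1 : ℕ) : ℤ) - k = n + 1 - k := by push_cast; ring
      have e3 : b ^ (n + 1) = b ^ ((n : ℤ) + 1 - k) * b ^ (k : ℤ) := by
        rw [← zpow_add₀ hb, sub_add_cancel]; norm_cast
      rw [e] at h1
      rw [h1, hrec k, e2, e3]
      ring
    have shifted : ∀ k ∈ Finset.range (n + 1),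
        a ^ (k + 1) * b ^ ((k + 1) ^ 2) * b ^ ((n : ℤ) + 1 - (k + 1 : ℕ)) *
          (qPochZ b b ((n + 1 : ℕ) - (k + 1 : ℕ)))⁻¹ * (qPochZ b b ((k + 1 : ℕ) - 1))⁻¹ *
          (qPochZ (a * b) b (k + 1 : ℕ))⁻¹ =
        a * b ^ (n + 1) / (1 - a * b) * ((a * b) ^ k * b ^ (k ^ 2) * (qPochZ b b (n - k))⁻¹ *
          (qPochZ b b k)⁻¹ * (qPochZ (a * b * b) b k)⁻¹) := by
      intro k _
      have e1 : ((n + 1 : ℕ) : ℤ) - (k + 1 : ℕ) = n - k := by push_cast; ring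
      have e3 : ((k + 1 : ℕ) : ℤ) - 1 = k := by push_cast; ring
      have e4 : (n : ℤ) + 1 - (k + 1 : ℕ) = n - k := by push_cast; ring
      rw [e1, e3, e4, shift, zpow_sub₀ hb, Nat.cast_succ]
      simp only [zpow_natCast]
      field_simp
      ring
    have ab : qPochZ (a * b) b n ≠ 0 := qPochZ_ne_zero hab _
    apply mul_left_cancel₀ hn
    rw [Finset.mul_sum, Finset.sum_congr rfl split, Finset.sum_add_distrib, Finset.sum_range_succ,
      ih ha, Finset.sum_range_succ', Finset.sum_congr rfl shifted, ← Finset.mul_sum, ih hab]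
    have z1 : qPochZ b b ((n : ℤ) - (n + 1 : ℕ)) = 0 := qPochZ_self_of_neg hb (by push_cast; omega)
    have z2 : qPochZ b b (((0 : ℕ) : ℤ) - 1) = 0 := qPochZ_self_of_neg hb (by norm_num)
    have r1 := hrec (n + 1 : ℕ)
    have e1 : ((n + 1 : ℕ) : ℤ) - 1 = n := by push_cast; ring
    rw [e1, zpow_natCast] at r1
    rw [z1, z2, r1, shift, Nat.cast_succ, qPochZ_add_one hab n]
    simp only [zpow_natCast]
    field_simp
    ring

/-- The version of `sum_qVandermonde_limit` in which the summation starts at `k`. -/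
lemma sum_qVandermonde_limit_shift {b : F} (hb : b ≠ 0) (hb1 : ∀ i : ℤ, 0 < i → b ^ i ≠ 1)
    {a : F} (ha : ∀ i : ℤ, a * b ^ i ≠ 1) (n k : ℕ) :
    ∑ r ∈ Finset.range (n + 1), a ^ r * b ^ ((r : ℤ) ^ 2 - k * r) * (qPochZ b b (n - r))⁻¹ *
        (qPochZ b b (r - k))⁻¹ * (qPochZ (a * b) b r)⁻¹ =
      a ^ k * (qPochZ b b (n - k))⁻¹ * (qPochZ (a * b) b n)⁻¹ := by
  rcases lt_or_ge n k with h | h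
  · rw [qPochZ_self_of_neg hb (show (n : ℤ) - k < 0 by omega), inv_zero, mul_zero, zero_mul]
    refine Finset.sum_eq_zero fun r hr => ?_
    rw [Finset.mem_range] at hr
    rw [qPochZ_self_of_neg hb (show (r : ℤ) - k < 0 by omega), inv_zero, mul_zero, zero_mul]
  obtain ⟨n, rfl⟩ := Nat.exists_eq_add_of_le h
  have hab : ∀ i : ℤ, a * b * b ^ i ≠ 1 := by simpa using shift_ne_one hb ha 1
  have hak : ∀ i : ℤ, a * b ^ k * b ^ i ≠ 1 := by simpa using shift_ne_one hb ha k
  rw [add_assoc, Finset.sum_range_add, Finset.sum_eq_zero, zero_add]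
  · have e (x : ℕ) : qPochZ (a * b) b (k + x : ℕ) =
        qPochZ (a * b) b k * qPochZ (a * b ^ k * b) b x := by
      rw [Nat.cast_add, qPochZ_add hb hab, zpow_natCast, mul_right_comm]
    have h0 := sum_qVandermonde_limit hb hb1 n hak
    have e1 : ((k + n : ℕ) : ℤ) - k = n := by push_cast; ring
    rw [e, mul_inv, e1]
    calc _ = ∑ r ∈ Finset.range (n + 1), a ^ k * (qPochZ (a * b) b k)⁻¹ *
          ((a * b ^ k) ^ r * b ^ (r ^ 2) * (qPochZ b b (n - r))⁻¹ *
            (qPochZ b b r)⁻¹ * (qPochZ (a * b ^ k * b) b r)⁻¹) := by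
          refine Finset.sum_congr rfl fun r _ => ?_
          have e2 : ((k + n : ℕ) : ℤ) - (k + r : ℕ) = n - r := by push_cast; ring
          have e3 : ((k + r : ℕ) : ℤ) - k = r := by push_cast; ring
          have e4 : b ^ (((k + r : ℕ) : ℤ) ^ 2 - k * (k + r : ℕ)) = (b ^ k) ^ r * b ^ (r ^ 2) := by
            rw [← pow_mul, ← pow_add, ← zpow_natCast]; push_cast; ring_nf
          rw [e, e2, e3, e4, mul_inv, pow_add, mul_pow]
          ring
      _ = _ := by rw [← Finset.mul_sum, h0]; ring
  · intro r hr
    rw [Finset.mem_range] at hr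
    rw [qPochZ_self_of_neg hb (show (r : ℤ) - k < 0 by omega), inv_zero, mul_zero, zero_mul]

/-! ### The `A₂` Bailey lemma -/

lemma Kker_eq {n m r s : ℕ} (hr : r ≤ n) (hs : s ≤ m) {x y b : F} :
    Kker n m r s x y b = x ^ r * y ^ s * b ^ ((r : ℤ) ^ 2 + s ^ 2 - r * s) *
      (qPochZ b b (n - r))⁻¹ * (qPochZ b b (m - s))⁻¹ := by
  have h : r * s ≤ r ^ 2 + s ^ 2 := by nlinarith [sq_nonneg ((r : ℤ) - s)]
  rw [Kker, Nat.cast_sub hr, Nat.cast_sub hs, ← zpow_natCast b, Nat.cast_sub h,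
    div_eq_mul_inv, mul_inv]
  push_cast
  ring

/-- The `A₂` Bailey lemma for `y = 0`. -/
lemma sum_Kker_mul_Phiy_zero {b : F} (hb : b ≠ 0) (hb1 : ∀ i : ℤ, 0 < i → b ^ i ≠ 1) {x y : F}
    (hx : ∀ i : ℤ, x * b ^ i ≠ 1) (hy : ∀ i : ℤ, y * b ^ i ≠ 1)
    (hxy : ∀ i : ℤ, x * y * b ^ i ≠ 1) (n m : ℕ) :
    ∑ r ∈ Finset.range (n + 1), ∑ s ∈ Finset.range (m + 1),
      Kker n m r s x y b * Phiy r s 0 x y b = Phiy n m 0 x y b := by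
  have expand : ∀ r ∈ Finset.range (n + 1), ∀ s ∈ Finset.range (m + 1),
      Kker n m r s x y b * Phiy r s 0 x y b = ∑ k ∈ Finset.range (n + 1),
        b ^ (k ^ 2) * (qPochZ b b k)⁻¹ * (qPochZ (x * y * b) b k)⁻¹ *
        (x ^ r * b ^ ((r : ℤ) ^ 2 - k * r) * (qPochZ b b (n - r))⁻¹ *
          (qPochZ b b (r - k))⁻¹ * (qPochZ (x * b) b r)⁻¹) *
        (y ^ s * b ^ ((s : ℤ) ^ 2 - k * s) * (qPochZ b b (m - s))⁻¹ *
          (qPochZ b b (s - k))⁻¹ * (qPochZ (y * b) b s)⁻¹) := by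
    intro r hr s hs
    rw [Finset.mem_range, Nat.lt_succ_iff] at hr hs
    have V := sum_qVandermonde' hb hb1 r s hxy
    rw [Kker_eq hr hs, Phiy]
    calc _ = x ^ r * y ^ s * b ^ ((r : ℤ) ^ 2) * b ^ ((s : ℤ) ^ 2) *
        (qPochZ b b (n - r))⁻¹ * (qPochZ b b (m - s))⁻¹ *
        (qPochZ (x * b) b r)⁻¹ * (qPochZ (y * b) b s)⁻¹ *
        (b ^ (-(r * s : ℤ)) * qPochZ (x * y * b) b (r + s) * (qPochZ b b r)⁻¹ * (qPochZ b b s)⁻¹ *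
          (qPochZ (x * y * b) b r)⁻¹ * (qPochZ (x * y * b) b s)⁻¹) := by
          rw [sub_eq_add_neg _ ((r : ℤ) * s), zpow_add₀ hb, zpow_add₀ hb]
          simp only [Pi.zero_apply, sub_zero, add_zero, div_eq_mul_inv, mul_inv]
          ring
      _ = _ := by
          rw [← V, Finset.mul_sum]
          symm
          rw [← Finset.sum_subset (Finset.range_mono (Nat.succ_le_succ hr))]
          · refine Finset.sum_congr rfl fun k _ => ?_
            have e : (k : ℤ) ^ 2 - k * (r + s) = (k ^ 2 : ℕ) + -(k * r : ℤ) + -(k * s : ℤ) := by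
              push_cast; ring
            rw [e, sub_eq_add_neg, sub_eq_add_neg ((s : ℤ) ^ 2)]
            simp only [zpow_add₀ hb, zpow_natCast b (k ^ 2)]
            ring
          · intro k _ hk
            rw [Finset.mem_range, not_lt] at hk
            simp [qPochZ_self_of_neg hb (show (r : ℤ) - k < 0 by omega)]
  rw [Finset.sum_congr rfl fun r hr => Finset.sum_congr rfl (expand r hr),
    Finset.sum_congr rfl fun r _ => Finset.sum_comm, Finset.sum_comm]
  calc _ = ∑ k ∈ Finset.range (n + 1), (qPochZ (x * b) b n)⁻¹ * (qPochZ (y * b) b m)⁻¹ *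
        ((x * y) ^ k * b ^ (k ^ 2) * (qPochZ b b (n - k))⁻¹ *
          (qPochZ b b (m - k))⁻¹ * (qPochZ b b k)⁻¹ * (qPochZ (x * y * b) b k)⁻¹) := by
        refine Finset.sum_congr rfl fun k _ => ?_
        simp only [← Finset.mul_sum, ← Finset.sum_mul]
        rw [sum_qVandermonde_limit_shift hb hb1 hx, sum_qVandermonde_limit_shift hb hb1 hy, mul_pow]
        ring
    _ = _ := by
        rw [← Finset.mul_sum, sum_qVandermonde hb hb1 n m hxy, Phiy]
        simp only [Pi.zero_apply, sub_zero, add_zero, div_eq_mul_inv, mul_inv]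
        ring

lemma Kker_shift {n m r s : ℕ} (hr : r ≤ n) (hs : s ≤ m) (i j : ℕ) {x y b : F} (hb : b ≠ 0) :
    Kker (i + n) (j + m) (i + r) (j + s) x y b =
      x ^ i * y ^ j * b ^ ((i : ℤ) ^ 2 + j ^ 2 - i * j) *
        Kker n m r s (x * b ^ (2 * i - j : ℤ)) (y * b ^ (2 * j - i : ℤ)) b := by
  rw [Kker_eq (by omega) (by omega), Kker_eq hr hs]
  have e1 : ((i + n : ℕ) : ℤ) - (i + r : ℕ) = n - r := by push_cast; ring
  have e2 : ((j + m : ℕ) : ℤ) - (j + s : ℕ) = m - s := by push_cast; ring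
  have e3 : ((i + r : ℕ) : ℤ) ^ 2 + (j + s : ℕ) ^ 2 - (i + r : ℕ) * (j + s : ℕ) =
      ((i : ℤ) ^ 2 + j ^ 2 - i * j) + ((r : ℤ) ^ 2 + s ^ 2 - r * s) +
        (2 * i - j : ℤ) * r + (2 * j - i : ℤ) * s := by push_cast; ring
  rw [e1, e2, e3, zpow_add₀ hb, zpow_add₀ hb, zpow_add₀ hb, zpow_mul, zpow_mul]
  simp only [zpow_natCast, mul_pow, pow_add]
  ring

lemma Phiy_shift {x y b : F} (hb : b ≠ 0) (hx : ∀ i : ℤ, x * b ^ i ≠ 1)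
    (hy : ∀ i : ℤ, y * b ^ i ≠ 1) (hxy : ∀ i : ℤ, x * y * b ^ i ≠ 1) {Y : Fin 3 → ℤ} {i j : ℕ}
    (h0 : Y 0 = i) (h1 : Y 1 = j - i) (h2 : Y 2 = -j) (r s : ℕ) :
    Phiy (i + r : ℕ) (j + s : ℕ) Y x y b =
      (qPochZ (x * b) b (2 * i - j) * qPochZ (x * y * b) b (i + j) *
        qPochZ (y * b) b (2 * j - i))⁻¹ *
        Phiy r s 0 (x * b ^ (2 * i - j : ℤ)) (y * b ^ (2 * j - i : ℤ)) b := by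
  have hx' : ∀ i : ℤ, x * b * b ^ i ≠ 1 := by simpa using shift_ne_one hb hx 1
  have hy' : ∀ i : ℤ, y * b * b ^ i ≠ 1 := by simpa using shift_ne_one hb hy 1
  have hxy' : ∀ i : ℤ, x * y * b * b ^ i ≠ 1 := by simpa using shift_ne_one hb hxy 1
  have c1 (t : ℤ) : qPochZ (x * b ^ (2 * i - j : ℤ) * b) b t =
      qPochZ (x * b) b (2 * i - j + t) / qPochZ (x * b) b (2 * i - j) := by
    rw [qPochZ_add hb hx', mul_div_cancel_left₀ _ (qPochZ_ne_zero hx' _), mul_right_comm]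
  have c2 (t : ℤ) : qPochZ (y * b ^ (2 * j - i : ℤ) * b) b t =
      qPochZ (y * b) b (2 * j - i + t) / qPochZ (y * b) b (2 * j - i) := by
    rw [qPochZ_add hb hy', mul_div_cancel_left₀ _ (qPochZ_ne_zero hy' _), mul_right_comm]
  have e : x * b ^ (2 * i - j : ℤ) * (y * b ^ (2 * j - i : ℤ)) = x * y * b ^ (i + j : ℤ) := by
    rw [mul_mul_mul_comm, ← zpow_add₀ hb]; ring_nf
  have c3 (t : ℤ) : qPochZ (x * b ^ (2 * i - j : ℤ) * (y * b ^ (2 * j - i : ℤ)) * b) b t =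
      qPochZ (x * y * b) b (i + j + t) / qPochZ (x * y * b) b (i + j) := by
    rw [e, qPochZ_add hb hxy', mul_div_cancel_left₀ _ (qPochZ_ne_zero hxy' _), mul_right_comm]
  have d0 : ((i + r : ℕ) : ℤ) - Y 0 = r := by rw [h0]; push_cast; ring
  have d1 : ((i + r : ℕ) : ℤ) - Y 1 = 2 * i - j + r := by rw [h1]; push_cast; ring
  have d2 : ((i + r : ℕ) : ℤ) - Y 2 = i + j + r := by rw [h2]; push_cast; ring
  have d3 : ((j + s : ℕ) : ℤ) + Y 2 = s := by rw [h2]; push_cast; ring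
  have d4 : ((j + s : ℕ) : ℤ) + Y 1 = 2 * j - i + s := by rw [h1]; push_cast; ring
  have d5 : ((j + s : ℕ) : ℤ) + Y 0 = i + j + s := by rw [h0]; push_cast; ring
  have d6 : ((i + r : ℕ) : ℤ) + (j + s : ℕ) = i + j + (r + s) := by push_cast; ring
  have n1 := qPochZ_ne_zero hx' (2 * i - j)
  have n2 := qPochZ_ne_zero hy' (2 * j - i)
  have n3 := qPochZ_ne_zero hxy' (i + j)
  rw [Phiy, Phiy, d0, d1, d2, d3, d4, d5, d6]
  simp only [Pi.zero_apply, sub_zero, add_zero, c1, c2, c3]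
  simp only [div_eq_mul_inv, mul_inv, inv_inv]
  field_simp

/-- The `A₂` Bailey lemma. -/
lemma sum_Kker_mul_Phiy {b : F} (hb : b ≠ 0) (hb1 : ∀ i : ℤ, 0 < i → b ^ i ≠ 1) {x y : F}
    (hx : ∀ i : ℤ, x * b ^ i ≠ 1) (hy : ∀ i : ℤ, y * b ^ i ≠ 1)
    (hxy : ∀ i : ℤ, x * y * b ^ i ≠ 1) {Y : Fin 3 → ℤ} {i j : ℕ}
    (h0 : Y 0 = i) (h1 : Y 1 = j - i) (h2 : Y 2 = -j) (n m : ℕ) :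
    ∑ r ∈ Finset.range (n + 1), ∑ s ∈ Finset.range (m + 1),
      Kker n m r s x y b * Phiy r s Y x y b =
    x ^ i * y ^ j * b ^ ((i : ℤ) ^ 2 + j ^ 2 - i * j) * Phiy n m Y x y b := by
  have vanish : ∀ r s : ℕ, r < i ∨ s < j → Phiy r s Y x y b = 0 := by
    rintro r s (h | h)
    · have : qPochZ b b (r - Y 0) = 0 := qPochZ_self_of_neg hb (by omega)
      simp [Phiy, this]
    · have : qPochZ b b (s + Y 2) = 0 := qPochZ_self_of_neg hb (by omega)
      simp [Phiy, this]
  by_cases h : n < i ∨ m < j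
  · rw [vanish n m h, mul_zero]
    refine Finset.sum_eq_zero fun r hr => Finset.sum_eq_zero fun s hs => ?_
    rw [Finset.mem_range] at hr hs
    rw [vanish r s (by omega), mul_zero]
  push Not at h
  obtain ⟨n, rfl⟩ := Nat.exists_eq_add_of_le h.1
  obtain ⟨m, rfl⟩ := Nat.exists_eq_add_of_le h.2
  have hxy' : ∀ k : ℤ, x * b ^ (2 * i - j : ℤ) * (y * b ^ (2 * j - i : ℤ)) * b ^ k ≠ 1 := by
    intro k
    rw [mul_mul_mul_comm, ← zpow_add₀ hb]
    exact shift_ne_one hb hxy _ k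
  have base := sum_Kker_mul_Phiy_zero hb hb1 (shift_ne_one hb hx (2 * i - j))
    (shift_ne_one hb hy (2 * j - i)) hxy' n m
  rw [Phiy_shift hb hx hy hxy h0 h1 h2, ← base, add_assoc, Finset.sum_range_add,
    Finset.sum_eq_zero, zero_add]
  · simp only [Finset.mul_sum]
    refine Finset.sum_congr rfl fun r hr => ?_
    rw [add_assoc, Finset.sum_range_add, Finset.sum_eq_zero, zero_add]
    · refine Finset.sum_congr rfl fun s hs => ?_
      rw [Finset.mem_range, Nat.lt_succ_iff] at hr hs
      rw [Kker_shift hr hs i j hb, Phiy_shift hb hx hy hxy h0 h1 h2]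
      ring
    · intro s hs
      rw [vanish _ s (Or.inr (Finset.mem_range.1 hs)), mul_zero]
  · intro r hr
    refine Finset.sum_eq_zero fun s _ => ?_
    rw [vanish r s (Or.inl (Finset.mem_range.1 hr)), mul_zero]

/-! ### The variables -/

lemma algebraMap_ne_zero {p : MvPolynomial (Fin 7) ℚ} (hp : p ≠ 0) :
    algebraMap (MvPolynomial (Fin 7) ℚ) F p ≠ 0 :=
  (map_ne_zero_iff _ (IsFractionRing.injective _ _)).2 hp

lemma q_ne_zero : q ≠ 0 := algebraMap_ne_zero (MvPolynomial.X_ne_zero _)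

lemma z_ne_zero : z ≠ 0 := algebraMap_ne_zero (MvPolynomial.X_ne_zero _)

lemma w_ne_zero : w ≠ 0 := algebraMap_ne_zero (MvPolynomial.X_ne_zero _)

lemma q_zpow_ne_one (i : ℤ) (hi : 0 < i) : q ^ i ≠ 1 := by
  obtain ⟨k, rfl⟩ := Int.eq_ofNat_of_zero_le hi.le
  have hk : k ≠ 0 := by omega
  intro h
  rw [zpow_natCast, q, ← map_pow, ← map_one (algebraMap (MvPolynomial (Fin 7) ℚ) F)] at h
  have := congrArg (MvPolynomial.eval fun _ => (0 : ℚ)) (IsFractionRing.injective _ _ h)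
  simp [hk] at this

lemma algebraMap_mul_q_zpow_ne_one {p : MvPolynomial (Fin 7) ℚ} {f : Fin 7 → ℚ}
    (hf : f 6 = 1) (hp : MvPolynomial.eval f p = 0) (i : ℤ) :
    algebraMap (MvPolynomial (Fin 7) ℚ) F p * q ^ i ≠ 1 := by
  intro h
  obtain ⟨k, rfl | rfl⟩ := i.eq_nat_or_neg
  · rw [zpow_natCast, q, ← map_pow, ← map_mul,
      ← map_one (algebraMap (MvPolynomial (Fin 7) ℚ) F)] at h
    have := congrArg (MvPolynomial.eval f) (IsFractionRing.injective _ _ h)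
    simp [hp] at this
  · rw [zpow_neg, zpow_natCast, mul_inv_eq_one₀ (pow_ne_zero _ q_ne_zero), q, ← map_pow] at h
    have := congrArg (MvPolynomial.eval f) (IsFractionRing.injective _ _ h)
    simp [hp, hf] at this

lemma z_mul_q_zpow_ne_one (i : ℤ) : z * q ^ i ≠ 1 :=
  algebraMap_mul_q_zpow_ne_one (f := Pi.single 6 1) (by simp) (by simp) i

lemma w_mul_q_zpow_ne_one (i : ℤ) : w * q ^ i ≠ 1 :=
  algebraMap_mul_q_zpow_ne_one (f := Pi.single 6 1) (by simp) (by simp) i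

lemma z_mul_w_mul_q_zpow_ne_one (i : ℤ) : z * w * q ^ i ≠ 1 := by
  rw [z, w, ← map_mul]
  exact algebraMap_mul_q_zpow_ne_one (f := Pi.single 6 1) (by simp) (by simp) i

/-- Part II of the `A₂` Bailey tree (Theorem 4.9 of the paper), as an identity of
rational functions in `u, v, c, d, z, w, q`. -/
theorem A2_bailey_tree_II (n m : ℕ) :
    ∑ r ∈ Finset.range (n + 1), ∑ s ∈ Finset.range (m + 1),
      Kker n m r s (z / q) (w / q) q * Phi4 r s u v c d z w q
      = Phi4 n m (u * z) (v * w) (c * z) (d * w) z w q := by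
  have hx (i : ℤ) : z / q * q ^ i ≠ 1 := by
    simpa [div_eq_mul_inv] using shift_ne_one q_ne_zero z_mul_q_zpow_ne_one (-1) i
  have hy (i : ℤ) : w / q * q ^ i ≠ 1 := by
    simpa [div_eq_mul_inv] using shift_ne_one q_ne_zero w_mul_q_zpow_ne_one (-1) i
  have hxy (i : ℤ) : z / q * (w / q) * q ^ i ≠ 1 := by
    have e : z / q * (w / q) = z * w * q ^ (-2 : ℤ) := by
      rw [zpow_neg, div_mul_div_comm, div_eq_mul_inv]
      norm_cast
      rw [sq]
    rw [e]
    exact shift_ne_one q_ne_zero z_mul_w_mul_q_zpow_ne_one _ i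
  simp only [Phi4, Finset.mul_sum]
  rw [Finset.sum_congr rfl fun r _ => Finset.sum_comm, Finset.sum_comm]
  refine Finset.sum_congr rfl fun σ _ => ?_
  have hsum : ((σ 1 : Fin 3) : ℤ) - (1 : Fin 3) =
      ((2 - ((σ 2 : Fin 3) : ℕ) : ℕ) : ℤ) - ((σ 0 : Fin 3) : ℕ) := by
    revert σ; decide
  have hσ2 : ((σ 2 : Fin 3) : ℤ) - (2 : Fin 3) = -((2 - ((σ 2 : Fin 3) : ℕ) : ℕ) : ℤ) := by
    revert σ; decide
  have hexp : ((σ 0 : Fin 3) : ℤ) ^ 2 + ((2 - ((σ 2 : Fin 3) : ℕ) : ℕ) : ℤ) ^ 2 -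
      ((σ 0 : Fin 3) : ℕ) * ((2 - ((σ 2 : Fin 3) : ℕ) : ℕ) : ℤ) =
      (((σ 0 : Fin 3) : ℕ) + (2 - ((σ 2 : Fin 3) : ℕ)) : ℕ) := by
    revert σ; decide
  have bailey := sum_Kker_mul_Phiy q_ne_zero q_zpow_ne_one hx hy hxy
    (Y := fun i => ((σ i : ℕ) : ℤ) - ((i : ℕ) : ℤ)) (i := (σ 0 : Fin 3))
    (j := 2 - ((σ 2 : Fin 3) : ℕ)) (by simp) hsum hσ2 n m
  rw [hexp, zpow_natCast, pow_add] at bailey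
  rw [mul_div_mul_right _ _ w_ne_zero, mul_div_mul_right _ _ z_ne_zero]
  simp only [mul_left_comm (Kker _ _ _ _ _ _ _), ← Finset.mul_sum]
  rw [bailey, div_pow, div_pow]
  have hq := q_ne_zero
  field_simp
  simp only [mul_pow]
  ring

end Stmt16
end
end

section
/- Proposition (root identity for the A₂ Bailey tree). Let n, m be nonnegative integers and τ ∈ {−1,0,1}. Then Σ over y = (y_1,y_2,y_3) ∈ ℤ³ with y_1+y_2+y_3 = 0 of [ (q;q)_1² (q;q)_2 / (q;q)_{n+m+2}² · ∏_{i=1}^3 [n+m+2, n−3y_i+i−1]_q ] · [ ∏_{1≤i<j≤3} (1 − q^{3(y_i−y_j)+j−i})/(1 − q^{j−i}) ] · ∏_{i=1}^3 q^{3(3+τ)·C(y_i,2) − τ i y_i} = g_{n,m;τ}(q), where C(y,2) := y(y−1)/2. (The sum has finite support since the q-binomial coefficients vanish outside their range; this is the identity Σ_{y} Φ_{n,m;3y}(q,q;q) Δ_{3y}(q,q;q) ∏_i q^{3(3+τ)C(y_i,2)−τiy_i} = g_{n,m;τ}(q).) -/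
noncomputable section

namespace Stmt17

/-- `(a; q)_n`, the finite q-Pochhammer symbol. -/
def qPoch (a q : ℂ) (n : ℕ) : ℂ := ∏ j ∈ Finset.range n, (1 - a * q ^ j)

/-- The q-binomial coefficient, vanishing unless `0 ≤ m ≤ n`. -/
def qBinom (q : ℂ) (n m : ℤ) : ℂ :=
  if 0 ≤ m ∧ m ≤ n then
    qPoch q q n.toNat / (qPoch q q m.toNat * qPoch q q (n - m).toNat)
  else 0

/-- `g_{n,m;τ}(q) = q^{τ(τ-1)nm}/((q;q)_{n+m}(q²;q)_{n+m}) · [n+m, n]_p`,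
with `p = q` if `τ² = 1` and `p = q³` if `τ = 0`. -/
def g (q : ℂ) (τ : ℤ) (n m : ℕ) : ℂ :=
  q ^ ((τ * (τ - 1)).toNat * (n * m)) /
      (qPoch q q (n + m) * qPoch (q ^ 2) q (n + m)) *
    qBinom (if τ = 0 then q ^ 3 else q) (n + m) n

open PowerSeries

/-- The part of `F` supported on exponents `≡ s (mod 3)`, with weights `p ^ (k ^ 2)`. -/
def sieve (p : ℂ) (s : ℕ) (F : ℂ⟦X⟧) : ℂ⟦X⟧ :=
  PowerSeries.mk fun k => if k % 3 = s % 3 then p ^ (k ^ 2) * coeff k F else 0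

theorem coeff_sieve (p : ℂ) (s : ℕ) (F : ℂ⟦X⟧) (k : ℕ) :
    coeff k (sieve p s F) = if k % 3 = s % 3 then p ^ (k ^ 2) * coeff k F else 0 := by
  simp [sieve]

theorem sieve_sub (p : ℂ) (s : ℕ) (F G : ℂ⟦X⟧) :
    sieve p s (F - G) = sieve p s F - sieve p s G := by
  ext k
  simp only [coeff_sieve, map_sub]
  split_ifs <;> ring

theorem sieve_C_mul (p : ℂ) (s : ℕ) (c : ℂ) (F : ℂ⟦X⟧) :
    sieve p s (C c * F) = C c * sieve p s F := by
  ext k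
  simp only [coeff_sieve, coeff_C_mul]
  split_ifs <;> ring

theorem sieve_rescale (p : ℂ) (s : ℕ) (c : ℂ) (F : ℂ⟦X⟧) :
    sieve p s (rescale c F) = rescale c (sieve p s F) := by
  ext k
  simp only [coeff_sieve, coeff_rescale]
  split_ifs <;> ring

theorem sieve_add_three (p : ℂ) (s : ℕ) (F : ℂ⟦X⟧) : sieve p (s + 3) F = sieve p s F := by
  ext k
  simp only [coeff_sieve, Nat.add_mod_right]

theorem sieve_succ_X_mul (p : ℂ) (s : ℕ) (F : ℂ⟦X⟧) :
    sieve p (s + 1) (X * F) = C p * (X * rescale (p ^ 2) (sieve p s F)) := by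
  ext k
  cases k with
  | zero => simp [coeff_sieve]
  | succ k =>
    have h : (k + 1) % 3 = (s + 1) % 3 ↔ k % 3 = s % 3 := by omega
    simp only [coeff_sieve, coeff_C_mul, coeff_succ_X_mul, coeff_rescale, h]
    split_ifs
    · ring
    · ring

theorem rescale_C_mul (c d : ℂ) (F : ℂ⟦X⟧) : rescale c (C d * F) = C d * rescale c F := by
  ext k
  simp only [coeff_rescale, coeff_C_mul]
  ring

theorem sieve_X_pow_three_mul (p : ℂ) (s : ℕ) (F : ℂ⟦X⟧) :
    sieve p s (X ^ 3 * F) = C (p ^ 9) * (X ^ 3 * rescale (p ^ 6) (sieve p s F)) := by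
  ext k
  rcases lt_or_ge k 3 with hk | hk
  · simp [coeff_sieve, coeff_C_mul, coeff_X_pow_mul', hk.not_ge, -map_pow]
  · obtain ⟨m, rfl⟩ := Nat.exists_eq_add_of_le' hk
    simp only [coeff_sieve, coeff_C_mul, coeff_X_pow_mul, coeff_rescale, Nat.add_mod_right]
    split_ifs <;> ring

/-- The determinant of the `3 × 3` matrix whose rows are the sieved parts, at residues
`s`, `s + 1`, `s + 2` modulo 3, of three power series. -/
def sieveDet (p : ℂ) (s : ℕ) (F G H : ℂ⟦X⟧) : ℂ⟦X⟧ :=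
  sieve p s F * (sieve p (s + 1) G * sieve p (s + 2) H - sieve p (s + 2) G * sieve p (s + 1) H) -
  sieve p (s + 1) F * (sieve p s G * sieve p (s + 2) H - sieve p (s + 2) G * sieve p s H) +
  sieve p (s + 2) F * (sieve p s G * sieve p (s + 1) H - sieve p (s + 1) G * sieve p s H)

theorem sieveDet_succ (p : ℂ) (s : ℕ) (F G H : ℂ⟦X⟧) :
    sieveDet p (s + 1) F G H = sieveDet p s F G H := by
  simp only [sieveDet, add_assoc, Nat.reduceAdd, sieve_add_three]
  ring

theorem sieveDet_rescale (p : ℂ) (s : ℕ) (c : ℂ) (F G H : ℂ⟦X⟧) :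
    sieveDet p s (rescale c F) (rescale c G) (rescale c H) = rescale c (sieveDet p s F G H) := by
  simp only [sieveDet, sieve_rescale, map_add, map_sub, map_mul]

theorem sieveDet_X_mul (p : ℂ) (s : ℕ) (F G H : ℂ⟦X⟧) :
    sieveDet p s (X * F) (X * G) (X * H) =
      C (p ^ 3) * (X ^ 3 * rescale (p ^ 2) (sieveDet p s F G H)) := by
  rw [← sieveDet_succ]
  simp only [sieveDet, sieve_succ_X_mul, map_add, map_sub, map_mul, add_right_comm _ _ 1,
    map_pow]
  ring

theorem sieveDet_C_mul (p : ℂ) (s : ℕ) (a b c : ℂ) (F G H : ℂ⟦X⟧) :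
    sieveDet p s (C a * F) (C b * G) (C c * H) = C (a * b * c) * sieveDet p s F G H := by
  simp only [sieveDet, sieve_C_mul, map_mul]
  ring

/-- The sieved determinant of `F`, `X F`, `X² F`. -/
def shiftDet (p : ℂ) (s : ℕ) (F : ℂ⟦X⟧) : ℂ⟦X⟧ := sieveDet p s F (X * F) (X ^ 2 * F)

theorem shiftDet_rescale (p : ℂ) (s : ℕ) {c : ℂ} (hc : c ≠ 0) (F : ℂ⟦X⟧) :
    shiftDet p s (rescale c F) = C (c⁻¹ ^ 3) * rescale c (shiftDet p s F) := by
  have h0 : rescale c F = C 1 * rescale c F := by simp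
  have h1 : X * rescale c F = C c⁻¹ * rescale c (X * F) := by
    rw [map_mul, rescale_X, ← mul_assoc, ← mul_assoc, ← map_mul, inv_mul_cancel₀ hc]
    simp
  have h2 : X ^ 2 * rescale c F = C (c⁻¹ ^ 2) * rescale c (X ^ 2 * F) := by
    rw [map_mul, map_pow (rescale c), rescale_X, mul_pow, ← map_pow C c,
      ← mul_assoc, ← mul_assoc, ← map_mul, ← mul_pow, inv_mul_cancel₀ hc]
    simp
  rw [shiftDet, h1, h2]
  nth_rewrite 1 [h0]
  rw [sieveDet_C_mul, sieveDet_rescale, shiftDet]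
  ring_nf

/-- `(z; q)_N` is a solution of this functional equation with `Q = q ^ N`. -/
def IsQShift (q Q : ℂ) (F : ℂ⟦X⟧) : Prop := (1 - X) * rescale q F = (1 - C Q * X) * F

theorem IsQShift.exists_factor {q Q : ℂ} {F : ℂ⟦X⟧} (hF : IsQShift q Q F) :
    ∃ P, F = (1 - X) * P ∧ rescale q F = (1 - C Q * X) * P := by
  have h1 : (1 - X : ℂ⟦X⟧) * PowerSeries.mk 1 = 1 := by
    rw [mul_comm]; exact PowerSeries.mk_one_mul_one_sub_eq_one ℂ
  have hne : (1 - X : ℂ⟦X⟧) ≠ 0 := left_ne_zero_of_mul_eq_one h1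
  have h2 : F = (1 - X) * (PowerSeries.mk 1 * F) := by rw [← mul_assoc, h1, one_mul]
  refine ⟨PowerSeries.mk 1 * F, h2, mul_left_cancel₀ hne ?_⟩
  rw [IsQShift] at hF
  rw [hF]
  linear_combination (1 - C Q * X) * h2

theorem shiftDet_functional_equation {p Q : ℂ} (hp : p ≠ 0) (s : ℕ) {F : ℂ⟦X⟧}
    (hF : IsQShift (p ^ 6) Q F) :
    C (p ^ 15) * shiftDet p s F - C (p ^ 9) * rescale (p ^ 2) (shiftDet p s F) =
      -(X ^ 3 * (rescale (p ^ 8) (shiftDet p s F) -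
        C (Q * p ^ 6) * rescale (p ^ 6) (shiftDet p s F))) := by
  obtain ⟨P, h1, h2⟩ := hF.exists_factor
  set B := shiftDet p s F with hB
  have hA : sieveDet p s F (X * F) (X ^ 2 * F) = B := rfl
  have hA1 : sieveDet p s (X * F) (X ^ 2 * F) (X ^ 3 * F) =
      C (p ^ 3) * (X ^ 3 * rescale (p ^ 2) B) := by
    rw [← hA, ← sieveDet_X_mul]; ring_nf
  have hA' : sieveDet p s (rescale (p ^ 6) F) (X * rescale (p ^ 6) F)
      (X ^ 2 * rescale (p ^ 6) F) = C (((p ^ 6)⁻¹) ^ 3) * rescale (p ^ 6) B :=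
    shiftDet_rescale p s (pow_ne_zero 6 hp) F
  have hA1' : sieveDet p s (X * rescale (p ^ 6) F) (X ^ 2 * rescale (p ^ 6) F)
      (X ^ 3 * rescale (p ^ 6) F) =
      C (p ^ 3 * ((p ^ 6)⁻¹) ^ 3) * (X ^ 3 * rescale (p ^ 8) B) := by
    have : rescale (p ^ 8) B = rescale (p ^ 2) (rescale (p ^ 6) B) := by
      rw [rescale_rescale]; ring_nf
    rw [this, map_mul, mul_assoc, mul_left_comm (C _) (X ^ 3), ← rescale_C_mul, ← hA',
      ← sieveDet_X_mul]
    ring_nf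
  have hper : ∀ t, sieve p t (X ^ 3 * F) =
      C (p ^ 9) * (X ^ 3 * sieve p t (rescale (p ^ 6) F)) := by
    intro t
    rw [sieve_X_pow_three_mul, sieve_rescale]
  rw [h2] at hA' hA1'
  simp only [h2] at hper
  rw [h1] at hA hA1
  simp only [h1] at hper
  have e0 : (1 - X) * P = P - X * P := by ring
  have e1 : X * ((1 - X) * P) = X * P - X ^ 2 * P := by ring
  have e2 : X ^ 2 * ((1 - X) * P) = X ^ 2 * P - X ^ 3 * P := by ring
  have e3 : X ^ 3 * ((1 - X) * P) = X ^ 3 * P - X ^ 4 * P := by ring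
  have f0 : (1 - C Q * X) * P = P - C Q * (X * P) := by ring
  have f1 : X * ((1 - C Q * X) * P) = X * P - C Q * (X ^ 2 * P) := by ring
  have f2 : X ^ 2 * ((1 - C Q * X) * P) = X ^ 2 * P - C Q * (X ^ 3 * P) := by ring
  have f3 : X ^ 3 * ((1 - C Q * X) * P) = X ^ 3 * P - C Q * (X ^ 4 * P) := by ring
  rw [e2, e1, e0] at hA
  rw [e3, e2, e1] at hA1
  rw [f2, f1, f0] at hA'
  rw [f3, f2, f1] at hA1'
  simp only [e3, f0, sieve_sub, sieve_C_mul] at hper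
  have hper' : ∀ t, sieve p t (X ^ 4 * P) = sieve p t (X ^ 3 * P) -
      C (p ^ 9) * (X ^ 3 * (sieve p t P - C Q * sieve p t (X * P))) := by
    intro t; linear_combination - hper t
  simp only [sieveDet, sieve_sub, sieve_C_mul, hper'] at hA hA1 hA' hA1'
  have hc : (C p : ℂ⟦X⟧) ^ 18 * C ((p ^ 6)⁻¹) ^ 3 = 1 := by
    rw [← map_pow, ← map_pow, ← map_mul, ← map_one C]
    congr 1
    field_simp
  have hne : (C (p ^ 3) * X ^ 3 : ℂ⟦X⟧) ≠ 0 :=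
    mul_ne_zero (by simpa using hp) (pow_ne_zero 3 X_ne_zero)
  have key : C (p ^ 9) * X ^ 3 * B - C (p ^ 3) * (X ^ 3 * rescale (p ^ 2) B) =
      - (C (p ^ 9) * X ^ 3 * (C (p ^ 3 * ((p ^ 6)⁻¹) ^ 3) * (X ^ 3 * rescale (p ^ 8) B)
        - C Q * (C (p ^ 9) * X ^ 3) * (C (((p ^ 6)⁻¹) ^ 3) * rescale (p ^ 6) B))) := by
    rw [← hA1, ← hA', ← hA1', ← hA]
    ring
  apply mul_left_cancel₀ hne
  simp only [map_mul, map_pow] at key hc ⊢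
  linear_combination C p ^ 9 * key - X ^ 6 * (C p ^ 3 * rescale (p ^ 8) B
    - C Q * C p ^ 9 * rescale (p ^ 6) B) * hc

theorem shiftDet_one_functional_equation {q Q : ℂ} (hq : q ≠ 0) (s : ℕ) {F : ℂ⟦X⟧}
    (hF : IsQShift q Q F) :
    (1 - X ^ 3) * (C (q⁻¹ ^ 3) * rescale q (shiftDet 1 s F)) =
      (1 - C (Q ^ 3) * X ^ 3) * shiftDet 1 s F := by
  obtain ⟨P, h1, h2⟩ := hF.exists_factor
  rw [← shiftDet_rescale 1 s hq, h2, h1]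
  have hper : ∀ t, sieve 1 t (X ^ 3 * P) = X ^ 3 * sieve 1 t P := by
    intro t
    rw [sieve_X_pow_three_mul]
    simp
  have e0 : (1 - X) * P = P - X * P := by ring
  have e1 : X * (P - X * P) = X * P - X ^ 2 * P := by ring
  have e2 : X ^ 2 * (P - X * P) = X ^ 2 * P - X ^ 3 * P := by ring
  have f0 : (1 - C Q * X) * P = P - C Q * (X * P) := by ring
  have f1 : X * (P - C Q * (X * P)) = X * P - C Q * (X ^ 2 * P) := by ring
  have f2 : X ^ 2 * (P - C Q * (X * P)) = X ^ 2 * P - C Q * (X ^ 3 * P) := by ring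
  simp only [shiftDet, e0, e1, e2, f0, f1, f2, sieveDet, sieve_sub, sieve_C_mul, hper, map_pow]
  ring

theorem IsQShift.coeff_succ {q Q : ℂ} {F : ℂ⟦X⟧} (hF : IsQShift q Q F) (k : ℕ) :
    (1 - q ^ (k + 1)) * coeff (k + 1) F = (Q - q ^ k) * coeff k F := by
  have h := congrArg (coeff (k + 1)) hF
  simp only [sub_mul, one_mul, mul_assoc, map_sub, coeff_succ_X_mul, coeff_rescale,
    coeff_C_mul] at h
  linear_combination -h

theorem sieve_X_pow_two_mul (p : ℂ) (s : ℕ) (F : ℂ⟦X⟧) :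
    sieve p s (X ^ 2 * F) = C (p ^ 4) * (X ^ 2 * rescale (p ^ 4) (sieve p (s + 1) F)) := by
  ext k
  rcases lt_or_ge k 2 with hk | hk
  · simp [coeff_sieve, coeff_C_mul, coeff_X_pow_mul', hk.not_ge, -map_pow]
  · obtain ⟨m, rfl⟩ := Nat.exists_eq_add_of_le' hk
    have h : (m + 2) % 3 = s % 3 ↔ m % 3 = (s + 1) % 3 := by omega
    simp only [coeff_sieve, coeff_C_mul, coeff_X_pow_mul, coeff_rescale, h]
    split_ifs <;> ring

theorem sieve_X_mul (p : ℂ) (s : ℕ) (F : ℂ⟦X⟧) :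
    sieve p s (X * F) = C p * (X * rescale (p ^ 2) (sieve p (s + 2) F)) := by
  rw [← sieve_succ_X_mul, ← sieve_add_three]

theorem coeff_three_shiftDet (p : ℂ) (s : ℕ) {F : ℂ⟦X⟧} (hF : coeff 0 F = 1) :
    coeff 3 (shiftDet p s F) = p ^ 5 := by
  induction s with
  | succ s ih => rw [shiftDet, sieveDet_succ, ← shiftDet, ih]
  | zero =>
    have h : shiftDet p 0 F = X ^ 3 * (C p * C (p ^ 4) *
        (sieve p 0 F * (rescale (p ^ 2) (sieve p 3 F) * rescale (p ^ 4) (sieve p 3 F) -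
          rescale (p ^ 2) (sieve p 4 F) * rescale (p ^ 4) (sieve p 2 F)) -
        sieve p 1 F * (rescale (p ^ 2) (sieve p 2 F) * rescale (p ^ 4) (sieve p 3 F) -
          rescale (p ^ 2) (sieve p 4 F) * rescale (p ^ 4) (sieve p 1 F)) +
        sieve p 2 F * (rescale (p ^ 2) (sieve p 2 F) * rescale (p ^ 4) (sieve p 2 F) -
          rescale (p ^ 2) (sieve p 3 F) * rescale (p ^ 4) (sieve p 1 F)))) := by
      simp only [shiftDet, sieveDet, sieve_X_mul, sieve_X_pow_two_mul, zero_add, Nat.reduceAdd]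
      ring
    rw [h, ← zero_add 3, coeff_X_pow_mul, coeff_zero_eq_constantCoeff_apply]
    simp only [map_mul, map_add, map_sub, ← coeff_zero_eq_constantCoeff_apply, coeff_rescale,
      coeff_sieve, hF]
    norm_num
    ring

theorem coeff_shiftDet {p Q : ℂ} (hp : p ≠ 0) (hp1 : ∀ i : ℕ, 0 < i → (p ^ 6) ^ i ≠ 1) (s : ℕ)
    {F : ℂ⟦X⟧} (hF : IsQShift (p ^ 6) Q F) (h0 : coeff 0 F = 1) (n : ℕ) :
    coeff (3 * n + 3) (shiftDet p s F) = p ^ (9 * n ^ 2 + 5) * coeff n F := by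
  induction n with
  | zero => simp [h0, coeff_three_shiftDet p s h0]
  | succ n ih =>
    have h := congrArg (coeff (3 * n + 3 + 3)) (shiftDet_functional_equation hp s hF)
    simp only [map_sub, map_neg, coeff_C_mul, coeff_rescale, coeff_X_pow_mul, ih] at h
    have h1 : (1 - (p ^ 6) ^ (n + 1)) ≠ 0 := sub_ne_zero.2 (hp1 (n + 1) n.succ_pos).symm
    have h2 := hF.coeff_succ n
    rw [show 3 * (n + 1) + 3 = 3 * n + 3 + 3 by ring]
    apply mul_left_cancel₀ (mul_ne_zero (pow_ne_zero 15 hp) h1)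
    linear_combination h - p ^ 15 * p ^ (9 * (n + 1) ^ 2 + 5) * h2

theorem coeff_shiftDet_one {q Q : ℂ} (hq : q ≠ 0) (hq1 : ∀ i : ℕ, 0 < i → q ^ i ≠ 1) (s : ℕ)
    {F G : ℂ⟦X⟧} (hF : IsQShift q Q F) (hF0 : coeff 0 F = 1) (hG : IsQShift (q ^ 3) (Q ^ 3) G)
    (hG0 : coeff 0 G = 1) (n : ℕ) :
    coeff (3 * n + 3) (shiftDet 1 s F) = coeff n G := by
  induction n with
  | zero => simp [hG0, coeff_three_shiftDet 1 s hF0]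
  | succ n ih =>
    have h := congrArg (coeff (3 * n + 3 + 3)) (shiftDet_one_functional_equation hq s hF)
    simp only [sub_mul, one_mul, mul_assoc, map_sub, coeff_C_mul, coeff_rescale,
      coeff_X_pow_mul, ih] at h
    have h1 : (1 - (q ^ 3) ^ (n + 1)) ≠ 0 := by
      rw [← pow_mul]; exact sub_ne_zero.2 (hq1 _ (by omega)).symm
    have h2 := hG.coeff_succ n
    have h3 : q⁻¹ ^ 3 * q ^ (3 * n + 3) = q ^ (3 * n) := by
      field_simp
      ring
    have h4 : q⁻¹ ^ 3 * q ^ (3 * n + 3 + 3) = q ^ (3 * n + 3) := by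
      field_simp
      ring
    rw [← mul_assoc, ← mul_assoc, h3, h4] at h
    rw [show 3 * (n + 1) + 3 = 3 * n + 3 + 3 by ring]
    apply mul_left_cancel₀ h1
    linear_combination -h - h2

/-- The power series `(X; q)_N`. -/
def qPochSeries (q : ℂ) (N : ℕ) : ℂ⟦X⟧ := ∏ j ∈ Finset.range N, (1 - C (q ^ j) * X)

theorem rescale_qPochSeries (q c : ℂ) (N : ℕ) :
    rescale c (qPochSeries q N) = ∏ j ∈ Finset.range N, (1 - C (q ^ j * c) * X) := by
  simp only [qPochSeries, map_prod, map_sub, map_one, map_mul (rescale c), rescale_X,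
    map_mul C]
  refine Finset.prod_congr rfl fun j _ => ?_
  have : rescale c (C (q ^ j)) = C (q ^ j) := by
    simpa using rescale_C_mul c (q ^ j) 1
  rw [this]
  ring

theorem qPochSeries_succ' (q : ℂ) (N : ℕ) :
    qPochSeries q (N + 1) = (1 - X) * rescale q (qPochSeries q N) := by
  rw [rescale_qPochSeries, qPochSeries, Finset.prod_range_succ', mul_comm]
  simp [pow_succ]

theorem qPochSeries_succ (q : ℂ) (N : ℕ) :
    qPochSeries q (N + 1) = (1 - C (q ^ N) * X) * qPochSeries q N := by
  rw [qPochSeries, Finset.prod_range_succ, mul_comm, qPochSeries]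

theorem isQShift_qPochSeries (q : ℂ) (N : ℕ) : IsQShift q (q ^ N) (qPochSeries q N) := by
  rw [IsQShift, ← qPochSeries_succ', qPochSeries_succ]

theorem coeff_zero_qPochSeries (q : ℂ) (N : ℕ) : coeff 0 (qPochSeries q N) = 1 := by
  simp [qPochSeries, map_prod]

theorem qPoch_ne_zero {q : ℂ} (hq1 : ∀ i : ℕ, 0 < i → q ^ i ≠ 1) (n : ℕ) : qPoch q q n ≠ 0 := by
  rw [qPoch, Finset.prod_ne_zero_iff]
  intro j _
  rw [← pow_succ']
  exact sub_ne_zero.2 (hq1 _ j.succ_pos).symm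

theorem qPoch_succ (q : ℂ) (n : ℕ) : qPoch q q (n + 1) = qPoch q q n * (1 - q ^ (n + 1)) := by
  rw [qPoch, Finset.prod_range_succ, qPoch, pow_succ']

theorem qBinom_natCast {q : ℂ} {N k : ℕ} (h : k ≤ N) :
    qBinom q N k = qPoch q q N / (qPoch q q k * qPoch q q (N - k)) := by
  rw [qBinom, if_pos (by omega)]
  congr
  omega

theorem coeff_qPochSeries {q : ℂ} (hq1 : ∀ i : ℕ, 0 < i → q ^ i ≠ 1) (N k : ℕ) :
    coeff k (qPochSeries q N) = (-1) ^ k * q ^ (k * (k - 1) / 2) * qBinom q N k := by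
  induction k with
  | zero =>
    rw [coeff_zero_qPochSeries, qBinom_natCast N.zero_le]
    simp [qPoch]
    exact (div_self (qPoch_ne_zero hq1 N)).symm
  | succ k ih =>
    have h := (isQShift_qPochSeries q N).coeff_succ k
    have h1 : (1 - q ^ (k + 1)) ≠ 0 := sub_ne_zero.2 (hq1 (k + 1) k.succ_pos).symm
    apply mul_left_cancel₀ h1
    rw [h, ih]
    have ht : (k + 1) * (k + 1 - 1) / 2 = k * (k - 1) / 2 + k := Nat.triangle_succ k
    rw [ht]
    rcases lt_trichotomy k N with hk | rfl | hk
    · rw [qBinom_natCast hk.le, qBinom_natCast hk, qPoch_succ q k]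
      obtain ⟨m, rfl⟩ := Nat.exists_eq_add_of_lt hk
      rw [show k + m + 1 - k = m + 1 by omega, show k + m + 1 - (k + 1) = m by omega, qPoch_succ q m]
      have h2 : (1 - q ^ (m + 1)) ≠ 0 := sub_ne_zero.2 (hq1 (m + 1) m.succ_pos).symm
      have h3 := qPoch_ne_zero hq1 k
      have h4 := qPoch_ne_zero hq1 m
      field_simp
      ring
    · have : qBinom q k ((k + 1 : ℕ) : ℤ) = 0 := if_neg (by omega)
      rw [this]; ring
    · have e1 : qBinom q N ((k + 1 : ℕ) : ℤ) = 0 := if_neg (by omega)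
      have e2 : qBinom q N k = 0 := if_neg (by omega)
      rw [e1, e2]; ring

theorem sieveDet_qPochSeries {q : ℂ} (hq : q ≠ 0) (p : ℂ) (s M : ℕ) :
    sieveDet p s (qPochSeries q (M + 2)) (rescale q (qPochSeries q (M + 2)))
        (rescale (q ^ 2) (qPochSeries q (M + 2))) =
      C (q * (q - q ^ (M + 2)) * (1 - q ^ (M + 2)) ^ 2 * (q ^ 2)⁻¹ ^ 3) *
        rescale (q ^ 2) (shiftDet p s (qPochSeries q M)) := by
  rw [map_mul, mul_assoc, ← shiftDet_rescale p s (pow_ne_zero 2 hq)]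
  set T := rescale (q ^ 2) (qPochSeries q M) with hT
  have hC : ∀ c d : ℂ, rescale c (C d) = C d := fun c d => by simpa using rescale_C_mul c d 1
  have hTT : rescale q (rescale q (qPochSeries q M)) = T := by
    rw [rescale_rescale, hT, pow_two]
  have hX : rescale q (X : ℂ⟦X⟧) = C q * X := rescale_X q
  have h0 : rescale q (qPochSeries q (M + 1)) = (1 - C q * X) * T := by
    rw [qPochSeries_succ', map_mul, hTT, map_sub, map_one, hX]
  have h1 : rescale (q ^ 2) (qPochSeries q (M + 1)) = (1 - C (q ^ (M + 2)) * X) * T := by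
    rw [qPochSeries_succ, map_mul, map_sub, map_one, map_mul, rescale_X, hC, ← mul_assoc,
      ← map_mul, ← pow_add]
  have g0 : qPochSeries q (M + 2) = (1 - X) * ((1 - C q * X) * T) := by
    rw [qPochSeries_succ', h0]
  have g1 : rescale q (qPochSeries q (M + 2)) = (1 - C q * X) * ((1 - C (q ^ (M + 2)) * X) * T) := by
    rw [qPochSeries_succ', map_mul, rescale_rescale, ← pow_two, h1, map_sub, map_one, hX]
  have g2 : rescale (q ^ 2) (qPochSeries q (M + 2)) =
      (1 - C (q ^ (M + 3)) * X) * ((1 - C (q ^ (M + 2)) * X) * T) := by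
    have e : q ^ (M + 3) = q ^ (M + 1) * q ^ 2 := by ring
    rw [qPochSeries_succ, map_mul, h1, map_sub, map_one, map_mul, rescale_X, hC, e, map_mul C]
    ring
  have hs : q ^ (M + 3) = q * q ^ (M + 2) := by ring
  rw [g2, g1, g0, hs]
  generalize q ^ (M + 2) = x
  have e0 : (1 - X) * ((1 - C q * X) * T) =
      T - (C (1 + q) * (X * T) - C q * (X ^ 2 * T)) := by simp only [map_add, map_one]; ring
  have e1 : (1 - C q * X) * ((1 - C x * X) * T) =
      T - (C (q + x) * (X * T) - C (q * x) * (X ^ 2 * T)) := by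
    simp only [map_add, map_mul]; ring
  have e2 : (1 - C (q * x) * X) * ((1 - C x * X) * T) =
      T - (C (q * x + x) * (X * T) - C (q * x * x) * (X ^ 2 * T)) := by
    simp only [map_add, map_mul]; ring
  rw [e0, e1, e2]
  simp only [shiftDet, sieveDet, sieve_sub, sieve_C_mul]
  simp only [map_add, map_mul, map_one, map_sub, map_pow]
  ring

/-- Triples `(a, (b, c))` of natural numbers with sum `d`, as nested pairs. -/
def triples (d : ℕ) : Finset (Σ _ : ℕ × ℕ, ℕ × ℕ) :=
  (Finset.HasAntidiagonal.antidiagonal d).sigma fun x => Finset.HasAntidiagonal.antidiagonal x.2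

theorem coeff_mul_mul (d : ℕ) (F G H : ℂ⟦X⟧) :
    coeff d (F * (G * H)) =
      ∑ x ∈ triples d, coeff x.1.1 F * (coeff x.2.1 G * coeff x.2.2 H) := by
  rw [triples, Finset.sum_sigma, coeff_mul]
  refine Finset.sum_congr rfl fun x _ => ?_
  rw [coeff_mul, Finset.mul_sum]

theorem coeff_sieveDet_rescale (p q : ℂ) (s d : ℕ) (F : ℂ⟦X⟧) :
    coeff d (sieveDet p s F (rescale q F) (rescale (q ^ 2) F)) =
      ∑ x ∈ triples d with
        x.1.1 % 3 = s % 3 ∧ x.2.1 % 3 = (s + 1) % 3 ∧ x.2.2 % 3 = (s + 2) % 3,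
        (q ^ x.2.1 - q ^ x.1.1) * (q ^ x.2.2 - q ^ x.1.1) * (q ^ x.2.2 - q ^ x.2.1) *
          ((p ^ x.1.1 ^ 2 * coeff x.1.1 F) * (p ^ x.2.1 ^ 2 * coeff x.2.1 F) *
            (p ^ x.2.2 ^ 2 * coeff x.2.2 F)) := by
  have h : ∀ F G H, sieveDet p s F G H =
      sieve p s F * (sieve p (s + 1) G * sieve p (s + 2) H) -
      sieve p s F * (sieve p (s + 1) H * sieve p (s + 2) G) -
      sieve p s G * (sieve p (s + 1) F * sieve p (s + 2) H) +
      sieve p s H * (sieve p (s + 1) F * sieve p (s + 2) G) +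
      sieve p s G * (sieve p (s + 1) H * sieve p (s + 2) F) -
      sieve p s H * (sieve p (s + 1) G * sieve p (s + 2) F) := by
    intro F G H
    rw [sieveDet]
    ring
  rw [h]
  simp only [map_add, map_sub, coeff_mul_mul, ← Finset.sum_add_distrib, ← Finset.sum_sub_distrib]
  rw [Finset.sum_filter]
  refine Finset.sum_congr rfl fun x _ => ?_
  simp only [coeff_sieve, coeff_rescale]
  by_cases h0 : x.1.1 % 3 = s % 3 <;> by_cases h1 : x.2.1 % 3 = (s + 1) % 3 <;>
    by_cases h2 : x.2.2 % 3 = (s + 2) % 3 <;> simp only [h0, h1, h2, and_self, and_true, and_false,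
      if_true, if_false] <;> ring

theorem pow_triangle (p : ℂ) (k : ℕ) :
    (p ^ 6) ^ (k * (k - 1) / 2) = p ^ (3 * (k : ℤ) * (k - 1)) := by
  rw [← pow_mul, ← zpow_natCast]
  congr 1
  have h : 2 * (k * (k - 1) / 2) = k * (k - 1) :=
    Nat.mul_div_cancel' (Nat.even_mul_pred_self k).two_dvd
  cases k with
  | zero => simp
  | succ k =>
    simp only [Nat.add_sub_cancel] at h ⊢
    zify at h
    push_cast
    linear_combination 3 * h

theorem coeff_shiftDet_qPochSeries {p : ℂ} (hp : p ≠ 0)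
    (hp1 : ∀ i : ℕ, 0 < i → (p ^ 6) ^ i ≠ 1) {τ : ℤ} (hτ : τ = -1 ∨ τ = 0 ∨ τ = 1) (s n m : ℕ) :
    coeff (3 * n + 3) (shiftDet (p ^ τ) s (qPochSeries (p ^ 6) (n + m))) =
      (-1) ^ n * p ^ ((3 + τ) * (3 * n ^ 2 + 6 * n + 5) - 27 * n - 15) *
        ((p ^ 6) ^ ((τ * (τ - 1)).toNat * (n * m)) *
          qBinom (if τ = 0 then (p ^ 6) ^ 3 else p ^ 6) (n + m) n) := by
  have hq : p ^ 6 ≠ 0 := pow_ne_zero 6 hp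
  rcases hτ with rfl | rfl | rfl
  · set q := p ^ 6 with hqdef
    have hq' : (p⁻¹) ^ 6 = q⁻¹ := by rw [inv_pow]
    set E := qPochSeries q (n + m)
    set d : ℂ := q ^ ((n : ℤ) + m - 1) with hd
    have hd0 : d ≠ 0 := zpow_ne_zero _ hq
    have hE : E = rescale d (rescale d⁻¹ E) := by
      rw [rescale_rescale, inv_mul_cancel₀ hd0, rescale_one, RingHom.id_apply]
    have hshift : IsQShift (p⁻¹ ^ 6) ((q ^ (n + m))⁻¹) (rescale d⁻¹ E) := by
      have h := congrArg (rescale (q ^ (n + m))⁻¹) (isQShift_qPochSeries q (n + m))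
      have hqd : q * (q ^ (n + m))⁻¹ = d⁻¹ := by
        rw [hd, ← zpow_neg, ← zpow_natCast, ← zpow_neg, ← zpow_one_add₀ hq]
        congr 1
        push_cast
        ring
      have hdq : d⁻¹ * q⁻¹ = (q ^ (n + m))⁻¹ := by
        rw [← hqd]
        field_simp
      have hC : ∀ c d : ℂ, rescale c (C d) = C d := fun c d => by simpa using rescale_C_mul c d 1
      simp only [map_mul, map_sub, map_one, rescale_X, hC, rescale_rescale] at h
      rw [hqd, ← mul_assoc (C (q ^ (n + m))), ← map_mul, mul_inv_cancel₀ (pow_ne_zero _ hq),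
        map_one, one_mul] at h
      rw [IsQShift, hq', rescale_rescale, hdq]
      exact h.symm
    have hp1' : ∀ i : ℕ, 0 < i → (p⁻¹ ^ 6) ^ i ≠ 1 := by
      intro i hi h
      rw [hq', inv_pow, inv_eq_one] at h
      exact hp1 i hi h
    rw [hE, shiftDet_rescale _ _ hd0, coeff_C_mul, coeff_rescale, zpow_neg_one,
      coeff_shiftDet (inv_ne_zero hp) hp1' s hshift
        (by rw [coeff_rescale, coeff_zero_qPochSeries]; simp), coeff_rescale,
      coeff_qPochSeries hp1, hqdef, pow_triangle]
    have e : (d⁻¹ ^ 3 * (d ^ (3 * n + 3) * (p⁻¹ ^ (9 * n ^ 2 + 5) * (d⁻¹ ^ n *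
        p ^ (3 * (n : ℤ) * (n - 1)))))) =
        p ^ ((3 + (-1 : ℤ)) * (3 * n ^ 2 + 6 * n + 5) - 27 * n - 15) * (p ^ 6) ^ (2 * (n * m)) := by
      have h1 : d⁻¹ ^ 3 * d ^ (3 * n + 3) * d⁻¹ ^ n = d ^ (2 * n) := by
        rw [show d ^ (3 * n + 3) = d ^ 3 * d ^ n * d ^ (2 * n) by ring]
        rw [inv_pow, inv_pow]
        field_simp
      have h2 : d ^ (2 * n) = p ^ (12 * n * ((n : ℤ) + m - 1)) := by
        rw [hd, hqdef, ← zpow_natCast p 6, ← zpow_mul, ← zpow_natCast, ← zpow_mul]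
        congr 1
        push_cast
        ring
      rw [show ∀ a b c d e : ℂ, a * (b * (c * (d * e))) = a * b * d * (c * e) from
        fun _ _ _ _ _ => by ring, h1, h2, inv_pow, ← zpow_natCast p (9 * n ^ 2 + 5), ← zpow_neg,
        ← pow_mul, ← zpow_natCast p (6 * _), ← zpow_add₀ hp, ← zpow_add₀ hp, ← zpow_add₀ hp]
      congr 1
      push_cast
      ring
    rw [show ((-1 : ℤ) * (-1 - 1)).toNat = 2 from rfl, if_neg (by norm_num)]
    push_cast at e ⊢
    linear_combination (-1) ^ n * qBinom (p ^ 6) (n + m) n * e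
  · rw [zpow_zero, coeff_shiftDet_one hq hp1 s (isQShift_qPochSeries _ _)
      (coeff_zero_qPochSeries _ _) (G := qPochSeries ((p ^ 6) ^ 3) (n + m))
      (by convert isQShift_qPochSeries ((p ^ 6) ^ 3) (n + m) using 1; ring)
      (coeff_zero_qPochSeries _ _), coeff_qPochSeries (fun i hi => by
        rw [← pow_mul]; exact hp1 _ (by omega)), pow_right_comm p 6 3, pow_triangle, if_pos rfl]
    have e : (p ^ 3) ^ (3 * (n : ℤ) * (n - 1)) =
        p ^ ((3 + (0 : ℤ)) * (3 * n ^ 2 + 6 * n + 5) - 27 * n - 15) := by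
      rw [← zpow_natCast p 3, ← zpow_mul]
      congr 1
      push_cast
      ring
    rw [e]
    simp
  · rw [zpow_one, coeff_shiftDet hp hp1 s (isQShift_qPochSeries _ _) (coeff_zero_qPochSeries _ _),
      coeff_qPochSeries hp1, pow_triangle]
    have e : p ^ (9 * n ^ 2 + 5) * p ^ (3 * (n : ℤ) * (n - 1)) =
        p ^ ((3 + (1 : ℤ)) * (3 * n ^ 2 + 6 * n + 5) - 27 * n - 15) := by
      rw [← zpow_natCast, ← zpow_add₀ hp]
      congr 1
      push_cast
      ring
    rw [← e]
    simp
    ring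

theorem zpow_sub_zpow {q : ℂ} (hq : q ≠ 0) {a b c : ℤ} (h : b = a + c) :
    q ^ b - q ^ a = -(q ^ a * (1 - q ^ c)) := by
  rw [h, zpow_add₀ hq]
  ring

theorem triple_term_eq {p : ℂ} (hp : p ≠ 0) (τ : ℤ) (n k₀ k₁ k₂ : ℕ) (y₀ y₁ y₂ : ℤ)
    (hy : y₀ + y₁ + y₂ = 0) (h₀ : (k₀ : ℤ) = n - 3 * y₀) (h₁ : (k₁ : ℤ) = n - 3 * y₁ + 1)
    (h₂ : (k₂ : ℤ) = n - 3 * y₂ + 2) (b₀ b₁ b₂ : ℂ) :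
    ((p ^ 6) ^ k₁ - (p ^ 6) ^ k₀) * ((p ^ 6) ^ k₂ - (p ^ 6) ^ k₀) * ((p ^ 6) ^ k₂ - (p ^ 6) ^ k₁) *
        (((p ^ τ) ^ k₀ ^ 2 * ((-1) ^ k₀ * (p ^ 6) ^ (k₀ * (k₀ - 1) / 2) * b₀)) *
          ((p ^ τ) ^ k₁ ^ 2 * ((-1) ^ k₁ * (p ^ 6) ^ (k₁ * (k₁ - 1) / 2) * b₁)) *
          ((p ^ τ) ^ k₂ ^ 2 * ((-1) ^ k₂ * (p ^ 6) ^ (k₂ * (k₂ - 1) / 2) * b₂))) =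
      (-1) ^ n * p ^ ((3 + τ) * (3 * (n : ℤ) ^ 2 + 6 * n + 5) + 9 * n - 3) *
        ((b₀ * b₁ * b₂) *
          ((1 - (p ^ 6) ^ (3 * (y₀ - y₁) + 1)) * (1 - (p ^ 6) ^ (3 * (y₀ - y₂) + 2)) *
            (1 - (p ^ 6) ^ (3 * (y₁ - y₂) + 1))) *
          ((p ^ 6) ^ (3 * (3 + τ) * (y₀ * (y₀ - 1) / 2) - τ * y₀) *
            (p ^ 6) ^ (3 * (3 + τ) * (y₁ * (y₁ - 1) / 2) - τ * 2 * y₁) *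
            (p ^ 6) ^ (3 * (3 + τ) * (y₂ * (y₂ - 1) / 2) - τ * 3 * y₂))) := by
  have hq : p ^ 6 ≠ 0 := pow_ne_zero 6 hp
  have hpow : ∀ k : ℕ, (p ^ 6) ^ k = (p ^ 6) ^ (k : ℤ) := fun k => (zpow_natCast _ k).symm
  have hdiv : ∀ y : ℤ, 2 * (y * (y - 1) / 2) = y * (y - 1) := fun y =>
    Int.mul_ediv_cancel' (Int.even_mul_pred_self y).two_dvd
  have hsign : (-1 : ℂ) ^ k₀ * (-1) ^ k₁ * (-1) ^ k₂ = -(-1) ^ n := by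
    rw [← pow_add, ← pow_add, show k₀ + k₁ + k₂ = 2 * (n + 1) + n + 1 by omega, pow_succ, pow_add,
      pow_mul]
    simp
  have hexp : (p ^ 6) ^ (k₀ : ℤ) * (p ^ 6) ^ (k₀ : ℤ) * (p ^ 6) ^ (k₁ : ℤ) *
      ((p ^ τ) ^ k₀ ^ 2 * (p ^ 6) ^ (k₀ * (k₀ - 1) / 2) *
        ((p ^ τ) ^ k₁ ^ 2 * (p ^ 6) ^ (k₁ * (k₁ - 1) / 2)) *
        ((p ^ τ) ^ k₂ ^ 2 * (p ^ 6) ^ (k₂ * (k₂ - 1) / 2))) =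
      p ^ ((3 + τ) * (3 * (n : ℤ) ^ 2 + 6 * n + 5) + 9 * n - 3) *
        ((p ^ 6) ^ (3 * (3 + τ) * (y₀ * (y₀ - 1) / 2) - τ * y₀) *
            (p ^ 6) ^ (3 * (3 + τ) * (y₁ * (y₁ - 1) / 2) - τ * 2 * y₁) *
            (p ^ 6) ^ (3 * (3 + τ) * (y₂ * (y₂ - 1) / 2) - τ * 3 * y₂)) := by
    simp only [pow_triangle]
    simp only [← zpow_natCast, ← zpow_mul, ← zpow_add₀ hp]
    congr 1
    push_cast
    obtain rfl : y₂ = -y₀ - y₁ := by linear_combination hy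
    rw [h₀, h₁, h₂]
    linear_combination (-9) * (3 + τ) * (hdiv y₀ + hdiv y₁ + hdiv (-y₀ - y₁))
  rw [hpow k₀, hpow k₁, hpow k₂,
    zpow_sub_zpow hq (show (k₁ : ℤ) = k₀ + (3 * (y₀ - y₁) + 1) by linear_combination h₁ - h₀),
    zpow_sub_zpow hq (show (k₂ : ℤ) = k₀ + (3 * (y₀ - y₂) + 2) by linear_combination h₂ - h₀),
    zpow_sub_zpow hq (show (k₂ : ℤ) = k₁ + (3 * (y₁ - y₂) + 1) by linear_combination h₂ - h₁)]
  generalize 1 - (p ^ 6) ^ (3 * (y₀ - y₁) + 1) = v₁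
  generalize 1 - (p ^ 6) ^ (3 * (y₀ - y₂) + 2) = v₂
  generalize 1 - (p ^ 6) ^ (3 * (y₁ - y₂) + 1) = v₃
  trans -(((p ^ 6) ^ (k₀ : ℤ) * (p ^ 6) ^ (k₀ : ℤ) * (p ^ 6) ^ (k₁ : ℤ) *
      ((p ^ τ) ^ k₀ ^ 2 * (p ^ 6) ^ (k₀ * (k₀ - 1) / 2) *
        ((p ^ τ) ^ k₁ ^ 2 * (p ^ 6) ^ (k₁ * (k₁ - 1) / 2)) *
        ((p ^ τ) ^ k₂ ^ 2 * (p ^ 6) ^ (k₂ * (k₂ - 1) / 2)))) *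
      ((-1 : ℂ) ^ k₀ * (-1) ^ k₁ * (-1) ^ k₂) * (b₀ * b₁ * b₂) * (v₁ * v₂ * v₃))
  · ring
  · rw [hexp, hsign]
    ring

theorem one_sub_mul_qPoch_sq (q : ℂ) (n : ℕ) :
    (1 - q) * qPoch (q ^ 2) q n = qPoch q q (n + 1) := by
  rw [qPoch, qPoch, Finset.prod_range_succ', mul_comm]
  congr 1
  · exact Finset.prod_congr rfl fun j _ => by ring
  · simp

/-- The indices of the root lattice sum, written as exponents `(k₀, (k₁, k₂))`. -/
def rootTriples (n : ℕ) : Finset (Σ _ : ℕ × ℕ, ℕ × ℕ) :=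
  {x ∈ triples (3 * n + 3) |
    x.1.1 % 3 = n % 3 ∧ x.2.1 % 3 = (n + 1) % 3 ∧ x.2.2 % 3 = (n + 2) % 3}

theorem mem_rootTriples {n : ℕ} {x : Σ _ : ℕ × ℕ, ℕ × ℕ} :
    x ∈ rootTriples n ↔ (x.1.1 + x.1.2 = 3 * n + 3 ∧ x.2.1 + x.2.2 = x.1.2) ∧
      x.1.1 % 3 = n % 3 ∧ x.2.1 % 3 = (n + 1) % 3 ∧ x.2.2 % 3 = (n + 2) % 3 := by
  simp [rootTriples, triples]

/-- The lattice point `y` with `k_i = n - 3 y_i + i` for `i = 0, 1, 2`. -/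
def rootOfTriple (n : ℕ) (x : rootTriples n) : {y : Fin 3 → ℤ // y 0 + y 1 + y 2 = 0} :=
  ⟨![((n : ℤ) - x.1.1.1) / 3, ((n : ℤ) + 1 - x.1.2.1) / 3, ((n : ℤ) + 2 - x.1.2.2) / 3], by
    have := mem_rootTriples.1 x.2
    simp only [Matrix.cons_val]
    omega⟩

theorem rootOfTriple_spec (n : ℕ) (x : rootTriples n) :
    (x.1.1.1 : ℤ) = n - 3 * (rootOfTriple n x).1 0 ∧
      (x.1.2.1 : ℤ) = n - 3 * (rootOfTriple n x).1 1 + 1 ∧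
      (x.1.2.2 : ℤ) = n - 3 * (rootOfTriple n x).1 2 + 2 := by
  have := mem_rootTriples.1 x.2
  simp only [rootOfTriple, Matrix.cons_val]
  omega

theorem rootOfTriple_injective (n : ℕ) : Function.Injective (rootOfTriple n) := by
  intro x x' h
  have hx := rootOfTriple_spec n x
  have hx' := rootOfTriple_spec n x'
  have hm := mem_rootTriples.1 x.2
  have hm' := mem_rootTriples.1 x'.2
  rw [← h] at hx'
  obtain ⟨⟨⟨a, b⟩, ⟨c, d⟩⟩, hx₀⟩ := x
  obtain ⟨⟨⟨a', b'⟩, ⟨c', d'⟩⟩, hx₀'⟩ := x'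
  simp only at hx hx' hm hm'
  obtain rfl : a = a' := by omega
  obtain rfl : b = b' := by omega
  obtain rfl : c = c' := by omega
  obtain rfl : d = d' := by omega
  rfl

theorem mem_range_rootOfTriple {n : ℕ} (y : {y : Fin 3 → ℤ // y 0 + y 1 + y 2 = 0})
    (h₀ : 0 ≤ (n : ℤ) - 3 * y.1 0) (h₁ : 0 ≤ (n : ℤ) - 3 * y.1 1 + 1)
    (h₂ : 0 ≤ (n : ℤ) - 3 * y.1 2 + 2) : y ∈ Set.range (rootOfTriple n) := by
  have hy := y.2
  obtain ⟨k₀, e₀⟩ := Int.eq_ofNat_of_zero_le h₀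
  obtain ⟨k₁, e₁⟩ := Int.eq_ofNat_of_zero_le h₁
  obtain ⟨k₂, e₂⟩ := Int.eq_ofNat_of_zero_le h₂
  refine ⟨⟨⟨(k₀, k₁ + k₂), (k₁, k₂)⟩, mem_rootTriples.2 ⟨⟨?_, rfl⟩, ?_⟩⟩,
    Subtype.ext (funext fun i => ?_)⟩
  · simp only
    omega
  · simp only
    omega
  · fin_cases i <;> simp [rootOfTriple] <;> omega

theorem sum_rootTriples {p : ℂ} (hp : p ≠ 0) (hp1 : ∀ i : ℕ, 0 < i → (p ^ 6) ^ i ≠ 1) {τ : ℤ}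
    (hτ : τ = -1 ∨ τ = 0 ∨ τ = 1) (n m : ℕ) :
    ∑ x ∈ rootTriples n,
        ((p ^ 6) ^ x.2.1 - (p ^ 6) ^ x.1.1) * ((p ^ 6) ^ x.2.2 - (p ^ 6) ^ x.1.1) *
          ((p ^ 6) ^ x.2.2 - (p ^ 6) ^ x.2.1) *
          (((p ^ τ) ^ x.1.1 ^ 2 *
              ((-1) ^ x.1.1 * (p ^ 6) ^ (x.1.1 * (x.1.1 - 1) / 2) *
                qBinom (p ^ 6) ((n : ℤ) + m + 2) x.1.1)) *
            ((p ^ τ) ^ x.2.1 ^ 2 *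
              ((-1) ^ x.2.1 * (p ^ 6) ^ (x.2.1 * (x.2.1 - 1) / 2) *
                qBinom (p ^ 6) ((n : ℤ) + m + 2) x.2.1)) *
            ((p ^ τ) ^ x.2.2 ^ 2 *
              ((-1) ^ x.2.2 * (p ^ 6) ^ (x.2.2 * (x.2.2 - 1) / 2) *
                qBinom (p ^ 6) ((n : ℤ) + m + 2) x.2.2))) =
      (-1) ^ n * p ^ ((3 + τ) * (3 * (n : ℤ) ^ 2 + 6 * n + 5) + 9 * n - 3) *
        ((1 - (p ^ 6) ^ (n + m + 1)) * (1 - (p ^ 6) ^ (n + m + 2)) ^ 2 *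
          ((p ^ 6) ^ ((τ * (τ - 1)).toNat * (n * m)) *
            qBinom (if τ = 0 then (p ^ 6) ^ 3 else p ^ 6) (n + m) n)) := by
  have h := congrArg (coeff (3 * n + 3))
    (sieveDet_qPochSeries (pow_ne_zero 6 hp) (p ^ τ) n (n + m))
  rw [coeff_sieveDet_rescale, coeff_C_mul, coeff_rescale,
    coeff_shiftDet_qPochSeries hp hp1 hτ] at h
  simp only [coeff_qPochSeries hp1] at h
  push_cast at h
  rw [rootTriples, h]
  have e : p ^ ((3 + τ) * (3 * (n : ℤ) ^ 2 + 6 * n + 5) + 9 * n - 3) =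
      p ^ ((3 + τ) * (3 * (n : ℤ) ^ 2 + 6 * n + 5) - 27 * n - 15) * p ^ (36 * n + 12) := by
    rw [← zpow_natCast, ← zpow_add₀ hp]
    congr 1
    push_cast
    ring
  rw [e]
  generalize p ^ ((3 + τ) * (3 * (n : ℤ) ^ 2 + 6 * n + 5) - 27 * n - 15) = t
  generalize (p ^ 6) ^ ((τ * (τ - 1)).toNat * (n * m)) * qBinom _ _ _ = G
  rw [show ((p ^ 6) ^ 2) ^ (3 * n + 3) = ((p ^ 6) ^ 2) ^ 3 * p ^ (36 * n) by ring, inv_pow]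
  field_simp
  ring

/-- The root identity for the `A₂` Bailey tree (Proposition 5.1 of the paper):
`Σ_{y ∈ Q} Φ_{n,m;3y}(q,q;q) Δ_{3y}(q,q;q) ∏_i q^{3(3+τ)C(y_i,2)-τiy_i} = g_{n,m;τ}(q)`,
stated for all `q` that are neither `0` nor a root of unity. -/
theorem A2_root_identity (n m : ℕ) (τ : ℤ) (hτ : τ = -1 ∨ τ = 0 ∨ τ = 1)
    (q : ℂ) (hq0 : q ≠ 0) (hq1 : ∀ i : ℕ, 0 < i → q ^ i ≠ 1) :
    (∑' y : {y : Fin 3 → ℤ // y 0 + y 1 + y 2 = 0},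
      (qPoch q q 1 ^ 2 * qPoch q q 2 / qPoch q q (n + m + 2) ^ 2 *
          ∏ i : Fin 3, qBinom q ((n : ℤ) + m + 2) ((n : ℤ) - 3 * y.1 i + ((i : ℕ) : ℤ))) *
        ((1 - q ^ (3 * (y.1 0 - y.1 1) + 1)) * (1 - q ^ (3 * (y.1 0 - y.1 2) + 2)) *
            (1 - q ^ (3 * (y.1 1 - y.1 2) + 1)) /
          ((1 - q) * (1 - q ^ 2) * (1 - q))) *
        ∏ i : Fin 3,
          q ^ (3 * (3 + τ) * (y.1 i * (y.1 i - 1) / 2) - τ * (((i : ℕ) : ℤ) + 1) * y.1 i))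
      = g q τ n m := by
  obtain ⟨p, rfl⟩ := IsAlgClosed.exists_pow_nat_eq q (n := 6) (by norm_num)
  have hp : p ≠ 0 := by
    rintro rfl
    simp at hq0
  have hB : ∀ {k : ℤ}, qBinom (p ^ 6) ((n : ℤ) + m + 2) k ≠ 0 → 0 ≤ k := by
    intro k hk
    rw [qBinom] at hk
    split_ifs at hk with h
    · exact h.1
    · exact absurd rfl hk
  have hc0 : (-1) ^ n * p ^ ((3 + τ) * (3 * (n : ℤ) ^ 2 + 6 * n + 5) + 9 * n - 3) ≠ 0 :=
    mul_ne_zero (pow_ne_zero _ (by norm_num)) (zpow_ne_zero _ hp)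
  have hq1' : 1 - p ^ 6 ≠ 0 := sub_ne_zero.2 fun h => hq1 1 one_pos (by rw [pow_one, ← h])
  have hq2' : 1 - (p ^ 6) ^ 2 ≠ 0 := sub_ne_zero.2 (hq1 2 two_pos).symm
  have hP1 : qPoch (p ^ 6) (p ^ 6) 1 = 1 - p ^ 6 := by simp [qPoch]
  have hP2 : qPoch (p ^ 6) (p ^ 6) 2 = (1 - p ^ 6) * (1 - (p ^ 6) ^ 2) := by rw [qPoch_succ, hP1]
  rw [← (rootOfTriple_injective n).tsum_eq, tsum_fintype]
  · have hS := sum_rootTriples hp hq1 hτ n m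
    rw [← Finset.sum_coe_sort, Finset.sum_congr rfl fun x _ => triple_term_eq hp τ n _ _ _ _ _ _
      (rootOfTriple n x).2 (rootOfTriple_spec n x).1 (rootOfTriple_spec n x).2.1
      (rootOfTriple_spec n x).2.2 _ _ _, ← Finset.mul_sum] at hS
    have hS := congrArg ((1 - p ^ 6) / qPoch (p ^ 6) (p ^ 6) (n + m + 2) ^ 2 * ·)
      (mul_left_cancel₀ hc0 hS)
    simp only [Finset.mul_sum] at hS
    refine (Finset.sum_congr rfl fun x _ => ?_).trans (hS.trans ?_)
    · obtain ⟨h₀, h₁, h₂⟩ := rootOfTriple_spec n x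
      rw [h₀, h₁, h₂]
      simp only [Fin.prod_univ_three, Fin.val_zero, Fin.val_one, Fin.val_two, hP1, hP2]
      push_cast
      simp only [add_zero, mul_one]
      generalize p ^ 6 = q at hq1' hq2' ⊢
      field_simp
    · rw [g]
      generalize p ^ 6 = q at hq1 hq1' ⊢
      have hN := qPoch_ne_zero hq1 (n + m + 2)
      have hD := one_sub_mul_qPoch_sq q (n + m)
      have hD0 : qPoch (q ^ 2) q (n + m) ≠ 0 :=
        right_ne_zero_of_mul (hD ▸ qPoch_ne_zero hq1 (n + m + 1))
      have hM := qPoch_ne_zero hq1 (n + m)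
      have h1 := qPoch_succ q (n + m)
      have h2 := qPoch_succ q (n + m + 1)
      rw [h1] at hD h2
      rw [div_mul_eq_mul_div, div_mul_eq_mul_div, div_eq_div_iff (pow_ne_zero 2 hN)
        (mul_ne_zero hM hD0), h2]
      linear_combination (1 - q ^ (n + m + 1)) * (1 - q ^ (n + m + 2)) ^ 2 *
        (q ^ ((τ * (τ - 1)).toNat * (n * m)) * qBinom (if τ = 0 then q ^ 3 else q) (n + m) n) *
        qPoch q q (n + m) * hD
  · intro y hy
    rw [Function.mem_support] at hy
    have hy' := right_ne_zero_of_mul (left_ne_zero_of_mul (left_ne_zero_of_mul hy))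
    rw [Finset.prod_ne_zero_iff] at hy'
    refine mem_range_rootOfTriple y ?_ ?_ ?_
    · simpa using hB (hy' 0 (Finset.mem_univ _))
    · simpa using hB (hy' 1 (Finset.mem_univ _))
    · simpa using hB (hy' 2 (Finset.mem_univ _))

end Stmt17
end
end
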